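/- Let f be an integral binary cubic form with Disc(f) ≠ 0. Then the equation f(x,y) = 1 has at most 10 solutions in integers (x,y). -/

import Mathlib

/-- The discriminant of the integral binary cubic form `ax³ + bx²y + cxy² + dy³`. -/
def cubicDisc (a b c d : ℤ) : ℤ :=
  18 * a * b * c * d + b ^ 2 * c ^ 2 - 4 * a * c ^ 3 - 4 * b ^ 3 * d - 27 * a ^ 2 * d ^ 2

/-- Leading coefficients of the remainders in the Padé approximation of `(1 - z)^(1/3)`. -/
noncomputable def remLead : ℕ → ℝ
  | 0 => 1 / 3
  | n + 1 => remLead n * (((n : ℝ) + 2 / 3) * (n + 4 / 3) / (2 * (n + 1) * (2 * n + 3)))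

/-- Coefficients of the remainders in the Padé approximation of `(1 - z)^(1/3)`. -/
noncomputable def remCoeff (n : ℕ) : ℕ → ℝ
  | 0 => remLead n
  | j + 1 => remCoeff n j * (((n : ℝ) + 2 / 3 + j) * (n + 1 + j) / ((2 * n + 2 + j) * (j + 1)))

theorem remLead_pos (n : ℕ) : 0 < remLead n := by
  induction n with
  | zero => norm_num [remLead]
  | succ n ih => rw [remLead]; positivity

theorem remCoeff_nonneg (n j : ℕ) : 0 ≤ remCoeff n j := by
  induction j with
  | zero => exact (remLead_pos n).le
  | succ j ih => rw [remCoeff]; positivity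

theorem remCoeff_le (n j : ℕ) : remCoeff n j ≤ remLead n * ((j + n).choose n : ℝ) := by
  induction j with
  | zero => simp [remCoeff]
  | succ j ih =>
    have h1 : ((j + 1 + n).choose n : ℝ) * (j + 1) = ((j + n).choose n : ℝ) * (n + 1 + j) := by
      have := Nat.add_one_mul_choose_eq (j + n) j
      have e1 : (j + n).choose j = (j + n).choose n := by
        rw [← Nat.choose_symm_of_eq_add]; omega
      have e2 : (j + n + 1).choose (j + 1) = (j + 1 + n).choose n := by
        rw [← Nat.choose_symm_of_eq_add (n := j + 1 + n) (a := j + 1) (b := n) rfl]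
        congr 1; omega
      rw [e1, e2] at this
      have h := congrArg (Nat.cast (R := ℝ)) this
      push_cast at h
      linarith
    have h2 : ((n : ℝ) + 2 / 3 + j) * (n + 1 + j) / ((2 * n + 2 + j) * (j + 1)) ≤
        (n + 1 + j) / (j + 1) := by
      rw [div_le_div_iff₀ (by positivity) (by positivity)]
      have h0 : (n : ℝ) + 2 / 3 + j ≤ 2 * n + 2 + j := by
        have : (0 : ℝ) ≤ n := by positivity
        linarith
      have h3 : 0 ≤ ((n : ℝ) + 1 + j) * (j + 1) := by positivity
      nlinarith [mul_le_mul_of_nonneg_right h0 h3]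
    have h4 : ((j + 1 + n).choose n : ℝ) = ((j + n).choose n : ℝ) * ((n + 1 + j) / (j + 1)) := by
      rw [← mul_div_assoc, ← h1]; field_simp
    rw [remCoeff, h4, ← mul_assoc]
    exact mul_le_mul ih h2 (by positivity) (mul_nonneg (remLead_pos n).le (by positivity))

theorem remCoeff_shift (n j : ℕ) : ((j : ℝ) + 1) * (n + 4 / 3) * remCoeff n (j + 1) =
    (n + 1) * (2 * n + 3 + j) * remCoeff (n + 1) j := by
  induction j with
  | zero =>
    simp only [remCoeff, remLead]
    push_cast
    field_simp
    ring
  | succ j ih =>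
    rw [remCoeff, remCoeff.eq_2 (n + 1) j]
    have : remCoeff (n + 1) j = ((j : ℝ) + 1) * (n + 4 / 3) * remCoeff n (j + 1) /
      ((n + 1) * (2 * n + 3 + j)) := by
      rw [ih]; field_simp
    rw [this]
    push_cast
    field_simp
    ring

theorem remCoeff_rec (n j : ℕ) : 9 * ((n : ℝ) + 1) * (n + 2) * remCoeff (n + 2) j =
    9 * (n + 1) * (2 * n + 3) * (2 * remCoeff (n + 1) (j + 2) - remCoeff (n + 1) (j + 1)) -
    (9 * (n + 1) ^ 2 - 1) * remCoeff n (j + 2) := by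
  have h1 := remCoeff_shift (n + 1) j
  have h2 := remCoeff_shift n (j + 1)
  have h3 := remCoeff.eq_2 (n + 1) (j + 1)
  have e1 : remCoeff (n + 2) j = ((j : ℝ) + 1) * (n + 1 + 4 / 3) * remCoeff (n + 1) (j + 1) /
      ((n + 1 + 1) * (2 * (n + 1) + 3 + j)) := by
    push_cast at h1
    rw [h1]; field_simp
  have e2 : remCoeff n (j + 2) = (n + 1) * (2 * n + 3 + (j + 1)) * remCoeff (n + 1) (j + 1) /
      (((j : ℝ) + 1 + 1) * (n + 4 / 3)) := by
    push_cast at h2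
    rw [← h2]; field_simp
  rw [e1, e2, h3]
  push_cast
  field_simp
  ring

theorem remCoeff_rec_zero (n : ℕ) : 0 =
    9 * ((n : ℝ) + 1) * (2 * n + 3) * (2 * remCoeff (n + 1) 0) -
    (9 * (n + 1) ^ 2 - 1) * remCoeff n 0 := by
  simp only [remCoeff, remLead]
  field_simp
  ring

theorem remCoeff_rec_one (n : ℕ) : 0 =
    9 * ((n : ℝ) + 1) * (2 * n + 3) * (2 * remCoeff (n + 1) 1 - remCoeff (n + 1) 0) -
    (9 * (n + 1) ^ 2 - 1) * remCoeff n 1 := by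
  simp only [remCoeff, remLead]
  push_cast
  field_simp
  ring

theorem remCoeff_init (j : ℕ) :
    remCoeff 1 j = 2 * remCoeff 0 (j + 2) - 2 / 3 * remCoeff 0 (j + 1) := by
  have h1 := remCoeff_shift 0 j
  have h3 := remCoeff.eq_2 0 (j + 1)
  have e1 : remCoeff 1 j = ((j : ℝ) + 1) * (4 / 3) * remCoeff 0 (j + 1) / (3 + j) := by
    push_cast at h1
    rw [eq_div_iff (by positivity)]
    linarith
  rw [e1, h3]
  push_cast
  field_simp
  ring

/-- The remainder `A_n(z) - (1-z)^(1/3) B_n(z)`, divided by `z^(2n+1)`. -/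
noncomputable def remFun (n : ℕ) (z : ℂ) : ℂ := ∑' j, (remCoeff n j : ℂ) * z ^ j

theorem summable_remFun_norm (n : ℕ) {z : ℂ} (hz : ‖z‖ < 1) :
    Summable fun j => ‖(remCoeff n j : ℂ) * z ^ j‖ := by
  have h := (summable_choose_mul_geometric_of_norm_lt_one (R := ℝ) n (r := ‖z‖)
    (by simpa using hz)).mul_left (remLead n)
  refine Summable.of_nonneg_of_le (fun _ => norm_nonneg _) (fun j => ?_) h
  rw [norm_mul, norm_pow, Complex.norm_real, Real.norm_of_nonneg (remCoeff_nonneg n j), ← mul_assoc]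
  gcongr
  exact remCoeff_le n j

theorem norm_remFun_le (n : ℕ) {z : ℂ} (hz : ‖z‖ < 1) :
    ‖remFun n z‖ ≤ remLead n / (1 - ‖z‖) ^ (n + 1) := by
  have h := (hasSum_choose_mul_geometric_of_norm_lt_one (𝕜 := ℝ) n (r := ‖z‖)
    (by simpa using hz)).mul_left (remLead n)
  rw [mul_one_div] at h
  refine (norm_tsum_le_tsum_norm (summable_remFun_norm n hz)).trans ?_
  rw [← h.tsum_eq]
  refine Summable.tsum_le_tsum (fun j => ?_) (summable_remFun_norm n hz) h.summable
  rw [norm_mul, norm_pow, Complex.norm_real, Real.norm_of_nonneg (remCoeff_nonneg n j), ← mul_assoc]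
  gcongr
  exact remCoeff_le n j

theorem remFun_split_one (n : ℕ) {z : ℂ} (hz : ‖z‖ < 1) :
    remFun n z = remCoeff n 0 + z * ∑' j, (remCoeff n (j + 1) : ℂ) * z ^ j := by
  have hs := (summable_remFun_norm n hz).of_norm
  rw [remFun, hs.tsum_eq_zero_add, ← tsum_mul_left]
  congr 1
  · simp
  · congr 1; ext j; ring

theorem remFun_split_two (n : ℕ) {z : ℂ} (hz : ‖z‖ < 1) :
    remFun n z = remCoeff n 0 + remCoeff n 1 * z +
      z ^ 2 * ∑' j, (remCoeff n (j + 2) : ℂ) * z ^ j := by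
  have hs := (summable_remFun_norm n hz).of_norm
  rw [remFun, ← hs.sum_add_tsum_nat_add 2, ← tsum_mul_left, Finset.sum_range_succ,
    Finset.sum_range_one]
  congr 1
  · simp
  · congr 1; ext j; ring

theorem summable_remFun_shift (n k : ℕ) {z : ℂ} (hz : ‖z‖ < 1) :
    Summable fun j => (remCoeff n (j + k) : ℂ) * z ^ j := by
  rcases eq_or_ne z 0 with rfl | h0
  · refine summable_of_ne_finset_zero (s := {0}) fun j hj => ?_
    have : j ≠ 0 := by simpa using hj
    simp [this]
  · have hs := (summable_remFun_norm n hz).of_norm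
    have h1 := ((summable_nat_add_iff k).2 hs).mul_left ((z ^ k)⁻¹)
    refine h1.congr fun j => ?_
    rw [pow_add]
    field_simp

theorem remFun_rec (n : ℕ) {z : ℂ} (hz : ‖z‖ < 1) :
    9 * ((n : ℂ) + 1) * (n + 2) * (z ^ 2 * remFun (n + 2) z) =
    9 * (n + 1) * (2 * n + 3) * (2 - z) * remFun (n + 1) z -
    (9 * (n + 1) ^ 2 - 1) * remFun n z := by
  have key : 9 * ((n : ℂ) + 1) * (n + 2) * remFun (n + 2) z =
      9 * (n + 1) * (2 * n + 3) * (2 * (∑' j, (remCoeff (n + 1) (j + 2) : ℂ) * z ^ j) -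
        ∑' j, (remCoeff (n + 1) (j + 1) : ℂ) * z ^ j) -
      (9 * (n + 1) ^ 2 - 1) * ∑' j, (remCoeff n (j + 2) : ℂ) * z ^ j := by
    have s1 := (summable_remFun_shift (n + 1) 2 hz).hasSum.mul_left 2
    have s2 := (summable_remFun_shift (n + 1) 1 hz).hasSum
    have s3 := (summable_remFun_shift n 2 hz).hasSum.mul_left (9 * ((n : ℂ) + 1) ^ 2 - 1)
    have s4 := ((s1.sub s2).mul_left (9 * ((n : ℂ) + 1) * (2 * n + 3))).sub s3
    have s5 := (summable_remFun_shift (n + 2) 0 hz).hasSum.mul_left (9 * ((n : ℂ) + 1) * (n + 2))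
    refine (HasSum.unique s4 ?_).symm
    refine s5.congr_fun ?_ |> fun h => h
    intro j
    have h := congrArg (Complex.ofReal) (remCoeff_rec n j)
    push_cast at h
    simp only [add_zero]
    linear_combination (-z ^ j) * h
  have h0 := congrArg (Complex.ofReal) (remCoeff_rec_zero n)
  have h1 := congrArg (Complex.ofReal) (remCoeff_rec_one n)
  push_cast at h0 h1
  have e1 := remFun_split_one (n + 1) hz
  have e2 := remFun_split_two (n + 1) hz
  have e3 := remFun_split_two n hz
  linear_combination z ^ 2 * key - 2 * (9 * (n + 1) * (2 * n + 3)) * e2 +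
    (9 * (n + 1) * (2 * n + 3)) * z * e1 + (9 * ((n : ℂ) + 1) ^ 2 - 1) * e3 + h0 + z * h1

theorem remFun_init {z : ℂ} (hz : ‖z‖ < 1) :
    z ^ 2 * remFun 1 z = (2 - 2 / 3 * z) * remFun 0 z - 2 / 3 := by
  have key : remFun 1 z = 2 * (∑' j, (remCoeff 0 (j + 2) : ℂ) * z ^ j) -
        2 / 3 * ∑' j, (remCoeff 0 (j + 1) : ℂ) * z ^ j := by
    have s1 := (summable_remFun_shift 0 2 hz).hasSum.mul_left 2
    have s2 := (summable_remFun_shift 0 1 hz).hasSum.mul_left (2 / 3)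
    have s5 := (summable_remFun_shift 1 0 hz).hasSum
    refine (HasSum.unique (s1.sub s2) ?_).symm
    refine s5.congr_fun ?_
    intro j
    have h := congrArg (Complex.ofReal) (remCoeff_init j)
    push_cast at h
    simp only [add_zero]
    linear_combination (-z ^ j) * h
  have e1 := remFun_split_one 0 hz
  have e2 := remFun_split_two 0 hz
  have h0 : remCoeff 0 0 = 1 / 3 := by simp [remCoeff, remLead]
  have h1 : remCoeff 0 1 = 1 / 9 := by norm_num [remCoeff, remLead]
  rw [h0] at e1 e2
  rw [h1] at e2
  push_cast at e1 e2
  linear_combination z ^ 2 * key - 2 * e2 + 2 / 3 * z * e1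

theorem remCoeff_zero_eq_choose (j : ℕ) :
    ((-1) ^ j * remCoeff 0 j : ℝ) = Ring.choose (1 / 3 : ℝ) (j + 1) := by
  have hd : ∀ m : ℕ, ((m + 1 : ℕ) : ℝ) * Ring.choose (1 / 3 : ℝ) (m + 1) =
      (1 / 3 - m) * Ring.choose (1 / 3 : ℝ) m := by
    intro m
    rw [Ring.choose_eq_smul, Ring.choose_eq_smul, descPochhammer_succ_right]
    rw [Polynomial.smeval_mul, Polynomial.smeval_sub, Polynomial.smeval_X, pow_one,
      Polynomial.smeval_natCast, Nat.factorial_succ]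
    simp only [smul_eq_mul, pow_zero, nsmul_eq_mul, mul_one]
    have := Nat.factorial_ne_zero m
    push_cast
    field_simp
  induction j with
  | zero =>
    have := hd 0
    simp [remCoeff, remLead]
  | succ j ih =>
    have h := hd (j + 1)
    rw [← ih] at h
    rw [remCoeff]
    push_cast at h ⊢
    have h0 : Ring.choose (1 / 3 : ℝ) (j + 1 + 1) =
      (1 / 3 - (j + 1)) * ((-1) ^ j * remCoeff 0 j) / (j + 1 + 1) := by
      rw [← h]; field_simp
    rw [h0]
    field_simp
    ring

theorem exists_cube_root_remFun {z : ℂ} (hz : ‖z‖ < 1) : (1 - z * remFun 0 z) ^ 3 = 1 - z := by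
  have h := (Complex.one_add_cpow_hasFPowerSeriesOnBall_zero (a := 1 / 3)).hasSum
    (y := -z) (by simpa [← ofReal_norm] using hz)
  simp only [binomialSeries_apply, zero_add] at h
  have h2 := h.tsum_eq
  rw [h.summable.tsum_eq_zero_add] at h2
  have h3 : (1 - z * remFun 0 z) = (1 + -z) ^ (1 / 3 : ℂ) := by
    rw [← h2, remFun, ← tsum_mul_left, sub_eq_add_neg, ← tsum_neg]
    congr 1
    · simp
    · congr 1
      ext j
      have := congrArg Complex.ofReal (remCoeff_zero_eq_choose j)
      rw [Complex.ofReal_choose] at this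
      push_cast at this
      rw [← this]
      simp only [List.prod_ofFn, Finset.prod_const, Finset.card_univ, Fintype.card_fin, smul_eq_mul]
      rw [pow_succ (-z), neg_pow z]
      have h1 : ((-1 : ℂ) ^ j) * (-1) ^ j = 1 := by rw [← mul_pow]; simp
      linear_combination (z ^ j * z * remCoeff 0 j) * h1
  rw [h3, ← Complex.cpow_nat_mul]
  norm_num
  ring

/-- The three-term recurrence satisfied by the homogenized Padé approximants of `(1 - z)^(1/3)`. -/
noncomputable def padeRec (s q x₀ x₁ : ℂ) : ℕ → ℂ
  | 0 => x₀
  | 1 => x₁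
  | n + 2 => (9 * ((n : ℂ) + 1) * (2 * n + 3) * s * padeRec s q x₀ x₁ (n + 1) -
      (9 * (n + 1) ^ 2 - 1) * q * padeRec s q x₀ x₁ n) / (9 * (n + 1) * (n + 2))

theorem padeRec_succ (s q x₀ x₁ : ℂ) (n : ℕ) :
    9 * ((n : ℂ) + 1) * (n + 2) * padeRec s q x₀ x₁ (n + 2) =
      9 * (n + 1) * (2 * n + 3) * s * padeRec s q x₀ x₁ (n + 1) -
      (9 * (n + 1) ^ 2 - 1) * q * padeRec s q x₀ x₁ n := by
  rw [padeRec]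
  have h1 : ((n : ℂ) + 1) ≠ 0 := by exact_mod_cast n.succ_ne_zero
  have h2 : ((n : ℂ) + 2) ≠ 0 := by exact_mod_cast (n + 1).succ_ne_zero
  field_simp

theorem eq_padeRec (s q : ℂ) (f : ℕ → ℂ)
    (h : ∀ n : ℕ, 9 * ((n : ℂ) + 1) * (n + 2) * f (n + 2) =
      9 * (n + 1) * (2 * n + 3) * s * f (n + 1) - (9 * (n + 1) ^ 2 - 1) * q * f n) (n : ℕ) :
    f n = padeRec s q (f 0) (f 1) n := by
  induction n using Nat.twoStepInduction with
  | zero => rfl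
  | one => rfl
  | more n ih1 ih2 =>
    have h1 : ((n : ℂ) + 1) ≠ 0 := by exact_mod_cast n.succ_ne_zero
    have h2 : ((n : ℂ) + 2) ≠ 0 := by exact_mod_cast (n + 1).succ_ne_zero
    have h3 : 9 * ((n : ℂ) + 1) * (n + 2) ≠ 0 := mul_ne_zero (mul_ne_zero (by norm_num) h1) h2
    apply mul_left_cancel₀ h3
    rw [h, padeRec_succ, ← ih1, ← ih2]

theorem padeRec_linear (s q x₀ x₁ y₀ y₁ c d : ℂ) (n : ℕ) :
    padeRec s q (c * x₀ - d * y₀) (c * x₁ - d * y₁) n =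
      c * padeRec s q x₀ x₁ n - d * padeRec s q y₀ y₁ n := by
  symm
  refine eq_padeRec s q (fun n => c * padeRec s q x₀ x₁ n - d * padeRec s q y₀ y₁ n) ?_ n
  intro n
  linear_combination c * padeRec_succ s q x₀ x₁ n - d * padeRec_succ s q y₀ y₁ n

/-- Homogenized Padé numerators of `(v / u)^(1/3)`. -/
noncomputable def padeNum (u v : ℂ) : ℕ → ℂ :=
  padeRec (u + v) ((u - v) ^ 2) 1 ((2 * u + 4 * v) / 3)

theorem norm_padeNum_le (u v z : ℂ) (hz : u - v = u * z) (n : ℕ) :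
    ‖padeNum u v n‖ ≤ n.centralBinom * (‖u‖ * (1 + ‖z‖)) ^ n := by
  have hr : 0 ≤ ‖z‖ := norm_nonneg z
  have hu : 0 ≤ ‖u‖ := norm_nonneg u
  set r := ‖z‖ with hrdef
  set p := ‖u‖ with hpdef
  have hv : v = u * (1 - z) := by linear_combination -hz
  induction n using Nat.twoStepInduction with
  | zero => simp [padeNum, padeRec]
  | one =>
    have : padeNum u v 1 = u * (2 - 4 / 3 * z) := by
      simp only [padeNum, padeRec]; rw [hv]; ring
    rw [this, norm_mul]
    have h2 : ‖2 - 4 / 3 * z‖ ≤ 2 + 4 / 3 * r := by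
      refine (norm_sub_le _ _).trans ?_
      rw [norm_mul]
      norm_num
      exact le_refl _
    have : Nat.centralBinom 1 = 2 := rfl
    rw [this]
    push_cast
    have : ‖u‖ * ‖2 - 4 / 3 * z‖ ≤ p * (2 + 4 / 3 * r) := by gcongr
    nlinarith [mul_nonneg hu hr]
  | more n ih1 ih2 =>
    have hrec := padeRec_succ (u + v) ((u - v) ^ 2) 1 ((2 * u + 4 * v) / 3) n
    change 9 * ((n : ℂ) + 1) * (n + 2) * padeNum u v (n + 2) =
      9 * (n + 1) * (2 * n + 3) * (u + v) * padeNum u v (n + 1) -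
      (9 * (n + 1) ^ 2 - 1) * (u - v) ^ 2 * padeNum u v n at hrec
    have hs : ‖u + v‖ ≤ p * (2 + r) := by
      have : u + v = u * (2 - z) := by rw [hv]; ring
      rw [this, norm_mul]
      gcongr
      refine (norm_sub_le _ _).trans ?_
      norm_num
      exact le_refl _
    have hq : ‖(u - v) ^ 2‖ = p ^ 2 * r ^ 2 := by
      rw [hz, norm_pow, norm_mul]; ring
    have hc1 := Nat.succ_mul_centralBinom_succ n
    have hc2 := Nat.succ_mul_centralBinom_succ (n + 1)
    have hc1' := congrArg (Nat.cast (R := ℝ)) hc1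
    have hc2' := congrArg (Nat.cast (R := ℝ)) hc2
    push_cast at hc1' hc2'
    set C0 : ℝ := (n.centralBinom : ℝ)
    set C1 : ℝ := ((n + 1).centralBinom : ℝ)
    set C2 : ℝ := ((n + 1 + 1).centralBinom : ℝ)
    have hC1 : 0 ≤ C1 := Nat.cast_nonneg _
    have hC0 : 0 ≤ C0 := Nat.cast_nonneg _
    have hn : (0 : ℝ) ≤ n := Nat.cast_nonneg _
    have e1 : ‖9 * ((n : ℂ) + 1) * (n + 2) * padeNum u v (n + 2)‖ =
        9 * ((n : ℝ) + 1) * (n + 2) * ‖padeNum u v (n + 2)‖ := by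
      rw [norm_mul]
      congr 1
      have : (9 * ((n : ℂ) + 1) * (n + 2)) = ((9 * ((n : ℝ) + 1) * (n + 2) : ℝ) : ℂ) := by
        push_cast; ring
      rw [this, Complex.norm_real, Real.norm_of_nonneg (by positivity)]
    have e2 : ‖9 * ((n : ℂ) + 1) * (2 * n + 3) * (u + v) * padeNum u v (n + 1)‖ =
        9 * ((n : ℝ) + 1) * (2 * n + 3) * ‖u + v‖ * ‖padeNum u v (n + 1)‖ := by
      rw [norm_mul, norm_mul]
      congr 2
      have : (9 * ((n : ℂ) + 1) * (2 * n + 3)) = ((9 * ((n : ℝ) + 1) * (2 * n + 3) : ℝ) : ℂ) := by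
        push_cast; ring
      rw [this, Complex.norm_real, Real.norm_of_nonneg (by positivity)]
    have e3 : ‖(9 * ((n : ℂ) + 1) ^ 2 - 1) * (u - v) ^ 2 * padeNum u v n‖ =
        (9 * ((n : ℝ) + 1) ^ 2 - 1) * (p ^ 2 * r ^ 2) * ‖padeNum u v n‖ := by
      rw [norm_mul, norm_mul, hq]
      congr 2
      have : (9 * ((n : ℂ) + 1) ^ 2 - 1) = ((9 * ((n : ℝ) + 1) ^ 2 - 1 : ℝ) : ℂ) := by
        push_cast; ring
      rw [this, Complex.norm_real, Real.norm_of_nonneg (by nlinarith)]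
    have h1 : 9 * ((n : ℝ) + 1) * (n + 2) * ‖padeNum u v (n + 2)‖ ≤
        9 * ((n : ℝ) + 1) * (2 * n + 3) * (p * (2 + r)) * (C1 * (p * (1 + r)) ^ (n + 1)) +
        (9 * ((n : ℝ) + 1) ^ 2) * (p ^ 2 * r ^ 2) * (C0 * (p * (1 + r)) ^ n) := by
      rw [← e1, hrec]
      refine (norm_sub_le _ _).trans ?_
      rw [e2, e3]
      gcongr
      linarith
    have h2 : 9 * ((n : ℝ) + 1) * (2 * n + 3) * (p * (2 + r)) * (C1 * (p * (1 + r)) ^ (n + 1)) +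
        (9 * ((n : ℝ) + 1) ^ 2) * (p ^ 2 * r ^ 2) * (C0 * (p * (1 + r)) ^ n) ≤
        9 * ((n : ℝ) + 1) * (n + 2) * (C2 * (p * (1 + r)) ^ (n + 2)) := by
      have e : 9 * ((n : ℝ) + 1) * (n + 2) * (C2 * (p * (1 + r)) ^ (n + 2)) =
        9 * ((n : ℝ) + 1) * (2 * (2 * (n + 1) + 1) * C1) * (p * (1 + r)) ^ (n + 2) := by
        rw [← hc2']; ring
      rw [e, pow_succ _ (n + 1), pow_succ _ n]
      have hX : 0 ≤ (p * (1 + r)) ^ n := by positivity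
      set X := (p * (1 + r)) ^ n
      have h3 : (n + 1) * C0 ≤ (2 * n + 3) * C1 := by
        have : (0 : ℝ) ≤ (n + 1) * C1 := by positivity
        nlinarith
      have h4 : 0 ≤ 9 * ((n : ℝ) + 1) * (p ^ 2 * r ^ 2) * X *
          ((2 * n + 3) * C1 - (n + 1) * C0) :=
        mul_nonneg (by positivity) (by linarith)
      have h5 : 0 ≤ 9 * ((n : ℝ) + 1) * p ^ 2 * X * ((2 * n + 3) * C1 * r) := by
        positivity
      nlinarith
    exact le_of_mul_le_mul_left (h1.trans h2) (by positivity)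

theorem padeNum_remainder {u v z w : ℂ} (hz : u - v = u * z) (hz1 : ‖z‖ < 1)
    (hw : w = 1 - z * remFun 0 z) (n : ℕ) :
    padeNum u v n - w * padeNum v u n = u ^ n * z ^ (2 * n + 1) * remFun n z := by
  have hv : v = u * (1 - z) := by linear_combination -hz
  have h1 : padeNum v u n = padeRec (u + v) ((u - v) ^ 2) 1 ((2 * v + 4 * u) / 3) n := by
    rw [padeNum, add_comm v u, sub_sq_comm]
  have h2 := padeRec_linear (u + v) ((u - v) ^ 2) 1 ((2 * u + 4 * v) / 3) 1
    ((2 * v + 4 * u) / 3) 1 w n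
  have h3 := eq_padeRec (u + v) ((u - v) ^ 2) (fun n => u ^ n * z ^ (2 * n + 1) * remFun n z)
    (fun n => by
      have := remFun_rec n hz1
      rw [hv]
      linear_combination u ^ (n + 2) * z ^ (2 * n + 3) * this) n
  have hi := remFun_init hz1
  rw [h1, padeNum, h3, ← one_mul (padeRec _ _ 1 ((2 * u + 4 * v) / 3) n), ← h2]
  congr 1
  · rw [hw]; ring
  · rw [hw, hv]; linear_combination (-u * z) * hi

theorem factorial_dvd_prod_sub (y : ℤ) (m : ℕ) :
    (m.factorial : ℤ) ∣ ∏ j ∈ Finset.range m, (y - j) := by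
  rw [← descPochhammer_eval_eq_prod_range, Polynomial.eval_eq_smeval,
    Ring.descPochhammer_eq_factorial_smul_choose]
  simp

theorem factorial_dvd_three_pow_mul_prod (n : ℤ) (m : ℕ) :
    (m.factorial : ℤ) ∣ 3 ^ (m / 2) * ∏ j ∈ Finset.range m, (3 * n + 1 - 3 * j) := by
  obtain ⟨e, M, hM, he⟩ := Nat.exists_eq_pow_mul_and_not_dvd (Nat.factorial_ne_zero m) 3
    (by norm_num)
  have hcop : Nat.Coprime 3 M := (Nat.Prime.coprime_iff_not_dvd Nat.prime_three).2 hM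
  have hle : e ≤ m / 2 := by
    have : Fact (Nat.Prime 3) := ⟨Nat.prime_three⟩
    have h1 := sub_one_mul_padicValNat_factorial (p := 3) m
    have h2 : padicValNat 3 m.factorial = e := by
      have hM0 : M ≠ 0 := by rintro rfl; simp at hM
      rw [he, padicValNat.mul (by positivity) hM0, padicValNat.prime_pow,
        padicValNat.eq_zero_of_not_dvd hM, add_zero]
    rw [h2] at h1
    omega
  have hM1 : (M : ℤ) ∣ ∏ j ∈ Finset.range m, (3 * n + 1 - 3 * j) := by
    have hc : IsCoprime (3 : ℤ) (M : ℤ) := by exact_mod_cast hcop.isCoprime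
    obtain ⟨t, s, hts⟩ := hc
    have hdvd : (M : ℤ) ∣ ∏ j ∈ Finset.range m, (n + t - j) :=
      (Dvd.intro_left _ (by rw [he]; push_cast; rfl)).trans (factorial_dvd_prod_sub (n + t) m)
    have h3 : (∏ j ∈ Finset.range m, (3 * n + 1 - 3 * (j : ℤ))) ≡
        ∏ j ∈ Finset.range m, (3 * (n + t - j)) [ZMOD M] := by
      apply Int.ModEq.prod
      intro j _
      rw [Int.modEq_iff_dvd]
      exact ⟨-s, by linear_combination hts⟩
    rw [Finset.prod_mul_distrib] at h3
    exact (Int.modEq_zero_iff_dvd).1 (h3.trans (Int.modEq_zero_iff_dvd.2 (hdvd.mul_left _)))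
  rw [he]
  push_cast
  exact mul_dvd_mul (pow_dvd_pow 3 hle) hM1

/-- Coefficients of the homogenized Padé numerators of `(1 - z)^(1/3)`. -/
noncomputable def padeCoeff (n m : ℕ) : ℂ :=
  (-1) ^ m * (∏ j ∈ Finset.range m, ((n : ℂ) + 1 / 3 - j)) / m.factorial * (2 * n - m).choose n

theorem padeCoeff_rec (k m : ℕ) : 9 * (((k + m : ℕ) : ℂ) + 1) * ((k + m : ℕ) + 2) *
    padeCoeff (k + m + 2) (m + 2) =
    9 * ((k + m : ℕ) + 1) * (2 * (k + m : ℕ) + 3) *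
      (2 * padeCoeff (k + m + 1) (m + 2) - padeCoeff (k + m + 1) (m + 1)) -
    (9 * ((k + m : ℕ) + 1) ^ 2 - 1) * padeCoeff (k + m) m := by
  simp only [padeCoeff]
  generalize hn : k + m = n
  have e0 : 2 * n - m = n + k := by omega
  have e1 : 2 * (n + 1) - (m + 2) = n + k := by omega
  have e2 : 2 * (n + 1) - (m + 1) = n + k + 1 := by omega
  have e3 : 2 * (n + 2) - (m + 2) = n + k + 2 := by omega
  rw [e0, e1, e2, e3]
  have hF1 : ∀ a b : ℕ, ∏ j ∈ Finset.range (b + 1), (((a + 1 : ℕ) : ℂ) + 1 / 3 - j) =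
      (a + 4 / 3) * ∏ j ∈ Finset.range b, ((a : ℂ) + 1 / 3 - j) := by
    intro a b
    rw [Finset.prod_range_succ', mul_comm]
    congr 1
    · push_cast; ring
    · apply Finset.prod_congr rfl; intro j _; push_cast; ring
  have f1 := hF1 n m
  have f2 := hF1 (n + 1) (m + 1)
  have f3 := Finset.prod_range_succ (fun j : ℕ => ((n + 1 : ℕ) : ℂ) + 1 / 3 - j) (m + 1)
  rw [f1] at f2 f3
  rw [f1, f2, f3]
  generalize ∏ j ∈ Finset.range m, ((n : ℂ) + 1 / 3 - j) = F
  have c1 : ((n + k).choose (n + 1) : ℂ) = (n + k).choose n * k / (n + 1) := by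
    rw [eq_div_iff (by exact_mod_cast n.succ_ne_zero)]
    have := Nat.choose_succ_right_eq (n + k) n
    rw [Nat.add_sub_cancel_left] at this
    exact_mod_cast this
  have c2 : ∀ a b : ℕ, ((b + 1).choose (a + 1) : ℂ) = b.choose a * (b + 1) / (a + 1) := by
    intro a b
    rw [eq_div_iff (by exact_mod_cast a.succ_ne_zero)]
    have := Nat.add_one_mul_choose_eq b a
    rw [mul_comm] at this
    exact_mod_cast this.symm
  have c3 := c2 n (n + k)
  have c4 := c2 (n + 1) (n + k + 1)
  rw [c3] at c4
  rw [c1, c3, c4, Nat.factorial_succ (m + 1), Nat.factorial_succ m]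
  generalize ((n + k).choose n : ℂ) = β
  have hm := Nat.factorial_ne_zero m
  have hm' : (m.factorial : ℂ) ≠ 0 := by exact_mod_cast hm
  have h1 : (m : ℂ) + 1 ≠ 0 := by exact_mod_cast m.succ_ne_zero
  have h2 : (m : ℂ) + 1 + 1 ≠ 0 := by exact_mod_cast (m + 1).succ_ne_zero
  have h3 : (n : ℂ) + 1 ≠ 0 := by exact_mod_cast n.succ_ne_zero
  have h4 : (n : ℂ) + 1 + 1 ≠ 0 := by exact_mod_cast (n + 1).succ_ne_zero
  have h5 : (k : ℂ) = n - m := by rw [← hn]; push_cast; ring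
  push_cast
  rw [h5]
  rw [pow_succ _ (m + 1), pow_succ _ m]
  generalize (-1 : ℂ) ^ m = σ
  field_simp
  ring

theorem padeNum_eq_sum (u v : ℂ) (n : ℕ) : padeNum u v n =
    ∑ m ∈ Finset.range (n + 1), padeCoeff n m * (u - v) ^ m * u ^ (n - m) := by
  set f : ℕ → ℂ := fun n =>
    ∑ m ∈ Finset.range (n + 1), padeCoeff n m * (u - v) ^ m * u ^ (n - m) with hf
  have h := eq_padeRec (u + v) ((u - v) ^ 2) f ?_ n
  · change _ = f n
    rw [h, padeNum]
    congr 1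
    · simp [hf, padeCoeff]
    · simp [hf, padeCoeff, Finset.sum_range_succ]; ring
  intro n
  have s0 : f n * (u - v) ^ 2 =
      ∑ m ∈ Finset.range (n + 1), padeCoeff n m * (u - v) ^ (m + 2) * u ^ (n - m) := by
    rw [hf, Finset.sum_mul]
    exact Finset.sum_congr rfl fun m _ => by ring
  have s1 : f (n + 1) * (u - v) = padeCoeff (n + 1) 0 * (u - v) * u ^ (n + 1) +
      ∑ m ∈ Finset.range (n + 1), padeCoeff (n + 1) (m + 1) * (u - v) ^ (m + 2) * u ^ (n - m) := by
    simp only [hf]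
    rw [Finset.sum_range_succ', add_mul, Finset.sum_mul, add_comm]
    congr 1
    · simp; ring
    · refine Finset.sum_congr rfl fun m _ => ?_
      rw [show n + 1 - (m + 1) = n - m by omega]; ring
  have s2 : f (n + 1) * u = padeCoeff (n + 1) 0 * u ^ (n + 2) +
      padeCoeff (n + 1) 1 * (u - v) * u ^ (n + 1) +
      ∑ m ∈ Finset.range (n + 1), padeCoeff (n + 1) (m + 2) * (u - v) ^ (m + 2) * u ^ (n - m) := by
    have hz : padeCoeff (n + 1) (n + 2) = 0 := by
      rw [padeCoeff, Nat.choose_eq_zero_of_lt (by omega)]; simp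
    have : f (n + 1) * u = ∑ m ∈ Finset.range (n + 3),
        padeCoeff (n + 1) m * (u - v) ^ m * u ^ (n + 2 - m) := by
      rw [Finset.sum_range_succ, hz, hf, Finset.sum_mul]
      simp only [zero_mul, add_zero]
      refine Finset.sum_congr rfl fun m hm => ?_
      have : m ≤ n + 1 := by simpa [Nat.lt_succ_iff] using hm
      rw [show n + 2 - m = n + 1 - m + 1 by omega]; ring
    rw [this, Finset.sum_range_succ', Finset.sum_range_succ', add_comm, add_comm (Finset.sum _ _),
      ← add_assoc]
    congr 1
    · simp
    · refine Finset.sum_congr rfl fun m _ => ?_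
      rw [show n + 2 - (m + 1 + 1) = n - m by omega]
  have s3 : f (n + 2) = padeCoeff (n + 2) 0 * u ^ (n + 2) +
      padeCoeff (n + 2) 1 * (u - v) * u ^ (n + 1) +
      ∑ m ∈ Finset.range (n + 1), padeCoeff (n + 2) (m + 2) * (u - v) ^ (m + 2) * u ^ (n - m) := by
    simp only [hf]
    rw [Finset.sum_range_succ', Finset.sum_range_succ', add_comm, add_comm (Finset.sum _ _),
      ← add_assoc]
    congr 1
    · simp
    · refine Finset.sum_congr rfl fun m _ => ?_
      rw [show n + 2 - (m + 1 + 1) = n - m by omega]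
  have key : 9 * ((n : ℂ) + 1) * (n + 2) * (∑ m ∈ Finset.range (n + 1),
      padeCoeff (n + 2) (m + 2) * (u - v) ^ (m + 2) * u ^ (n - m)) =
      9 * (n + 1) * (2 * n + 3) * (2 * (∑ m ∈ Finset.range (n + 1),
        padeCoeff (n + 1) (m + 2) * (u - v) ^ (m + 2) * u ^ (n - m)) -
        ∑ m ∈ Finset.range (n + 1), padeCoeff (n + 1) (m + 1) * (u - v) ^ (m + 2) * u ^ (n - m)) -
      (9 * ((n : ℂ) + 1) ^ 2 - 1) * ∑ m ∈ Finset.range (n + 1),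
        padeCoeff n m * (u - v) ^ (m + 2) * u ^ (n - m) := by
    simp only [Finset.mul_sum]
    rw [← Finset.sum_sub_distrib, Finset.mul_sum, ← Finset.sum_sub_distrib]
    refine Finset.sum_congr rfl fun m hm => ?_
    have hmn : m ≤ n := by simpa [Nat.lt_succ_iff] using hm
    obtain ⟨k, rfl⟩ := Nat.exists_eq_add_of_le' hmn
    linear_combination ((u - v) ^ (m + 2) * u ^ (k + m - m)) * padeCoeff_rec k m
  have hcn : ∀ a b : ℕ, ((b + 1).choose (a + 1) : ℂ) = b.choose a * (b + 1) / (a + 1) := by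
    intro a b
    rw [eq_div_iff (by exact_mod_cast a.succ_ne_zero)]
    have := Nat.add_one_mul_choose_eq b a
    rw [mul_comm] at this
    exact_mod_cast this.symm
  have h3 : (n : ℂ) + 1 ≠ 0 := by exact_mod_cast n.succ_ne_zero
  have h4 : (n : ℂ) + 1 + 1 ≠ 0 := by exact_mod_cast (n + 1).succ_ne_zero
  have hsy : ((2 * n + 1).choose n : ℂ) = (2 * n + 1).choose (n + 1) := by
    rw [Nat.choose_symm_of_eq_add (show 2 * n + 1 = n + (n + 1) by ring)]
  have k2 := hcn (n + 1) (2 * n + 2)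
  have k1 := hcn n (2 * n + 1)
  rw [hsy] at k1
  have k3 := congrArg (Nat.cast (R := ℂ)) (Nat.succ_mul_centralBinom_succ (n + 1))
  simp only [Nat.centralBinom] at k3
  have g0 : 9 * ((n : ℂ) + 1) * (n + 2) * padeCoeff (n + 2) 0 =
      9 * (n + 1) * (2 * n + 3) * (2 * padeCoeff (n + 1) 0) := by
    simp only [padeCoeff, Nat.sub_zero]
    push_cast at k3
    simp
    linear_combination 9 * ((n : ℂ) + 1) * k3
  have g1 : 9 * ((n : ℂ) + 1) * (n + 2) * padeCoeff (n + 2) 1 =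
      9 * (n + 1) * (2 * n + 3) * (2 * padeCoeff (n + 1) 1 - padeCoeff (n + 1) 0) := by
    simp only [padeCoeff, Nat.sub_zero]
    rw [show 2 * (n + 2) - 1 = 2 * n + 2 + 1 by omega, show 2 * (n + 1) - 1 = 2 * n + 1 by omega,
      show n + 2 = n + 1 + 1 by ring, k2, show 2 * (n + 1) = 2 * n + 1 + 1 by ring, k1]
    simp
    field_simp
    ring
  rw [s3]
  linear_combination key + u ^ (n + 2) * g0 + (u - v) * u ^ (n + 1) * g1 -
    (2 * (9 * ((n : ℂ) + 1) * (2 * n + 3))) * s2 + (9 * ((n : ℂ) + 1) * (2 * n + 3)) * s1 +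
    (9 * ((n : ℂ) + 1) ^ 2 - 1) * s0

/-- The order `ℤ[(D + √(-3D)) / 2]`, embedded through both conjugations. -/
def quadOrder (D : ℤ) (δ : ℂ) (hδ : δ ^ 2 = -3 * D) (hD : 4 ∣ D * (D + 3)) : Subring (ℂ × ℂ) where
  carrier := {x | ∃ i j : ℤ, x = ((i : ℂ) + j * ((D + δ) / 2), (i : ℂ) + j * ((D - δ) / 2))}
  one_mem' := ⟨1, 0, by simp; rfl⟩
  zero_mem' := ⟨0, 0, by simp; rfl⟩
  add_mem' := by
    rintro _ _ ⟨i, j, rfl⟩ ⟨k, l, rfl⟩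
    refine ⟨i + k, j + l, ?_⟩
    ext <;> · push_cast; simp; ring
  neg_mem' := by
    rintro _ ⟨i, j, rfl⟩
    refine ⟨-i, -j, ?_⟩
    ext <;> · push_cast; simp; ring
  mul_mem' := by
    rintro _ _ ⟨i, j, rfl⟩ ⟨k, l, rfl⟩
    obtain ⟨m, hm⟩ := hD
    have hm' := congrArg (Int.cast (R := ℂ)) hm
    push_cast at hm'
    refine ⟨i * k - j * l * m, i * l + j * k + j * l * D, ?_⟩
    ext
    · push_cast
      simp only [Prod.mk_mul_mk]
      linear_combination ((j : ℂ) * l / 4) * hδ - ((j : ℂ) * l / 4) * hm'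
    · push_cast
      simp only [Prod.mk_mul_mk]
      linear_combination ((j : ℂ) * l / 4) * hδ - ((j : ℂ) * l / 4) * hm'

theorem padeNum_mem_quadOrder (D G : ℤ) (δ : ℂ) (hδ : δ ^ 2 = -3 * D) (hD : 4 ∣ D * (D + 3))
    (hG : 2 ∣ G - D) (n : ℕ) :
    (padeNum ((G + 3 * δ) / 2) ((G - 3 * δ) / 2) n, padeNum ((G - 3 * δ) / 2) ((G + 3 * δ) / 2) n) ∈
      quadOrder D δ hδ hD := by
  obtain ⟨g, hg⟩ := hG
  have hg' := congrArg (Int.cast (R := ℂ)) hg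
  push_cast at hg'
  set O := quadOrder D δ hδ hD
  have hu : ((G + 3 * δ) / 2, (G - 3 * δ) / 2) ∈ O := by
    refine ⟨g - D, 3, ?_⟩
    ext
    · push_cast; linear_combination hg' / 2
    · push_cast; linear_combination hg' / 2
  have hd : (δ, -δ) ∈ O := by
    refine ⟨-D, 2, ?_⟩
    ext <;> · push_cast; ring
  have hdiag : ∀ i : ℤ, ((i : ℂ), (i : ℂ)) ∈ O := fun i => ⟨i, 0, by simp⟩
  have hterm : ∀ m : ℕ, (padeCoeff n m * (3 * δ) ^ m, padeCoeff n m * (-(3 * δ)) ^ m) ∈ O := by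
    intro m
    obtain ⟨I, hI⟩ := factorial_dvd_three_pow_mul_prod n m
    have hI' := congrArg (Int.cast (R := ℂ)) hI
    push_cast at hI'
    have hm' : (m.factorial : ℂ) ≠ 0 := by exact_mod_cast Nat.factorial_ne_zero m
    have hprod : ∏ j ∈ Finset.range m, (3 * (n : ℂ) + 1 - 3 * j) =
        3 ^ m * ∏ j ∈ Finset.range m, ((n : ℂ) + 1 / 3 - j) := by
      rw [← Finset.card_range m, ← Finset.prod_const, Finset.card_range, ← Finset.prod_mul_distrib]
      exact Finset.prod_congr rfl fun j _ => by ring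
    rw [hprod] at hI'
    have key : ∀ e : ℂ, e ^ 2 = -3 * D → padeCoeff n m * (3 * e) ^ m =
        (((-1) ^ m * ((2 * n - m).choose n : ℤ) * I * (-D) ^ (m / 2) : ℤ) : ℂ) * e ^ (m % 2) := by
      intro e he
      have h1 : e ^ m = (3 : ℂ) ^ (m / 2) * ((-D) ^ (m / 2)) * e ^ (m % 2) := by
        conv_lhs => rw [← Nat.div_add_mod m 2, pow_add, pow_mul, he]
        rw [← mul_pow]; congr 2; ring
      rw [mul_pow, h1, padeCoeff]
      push_cast
      have hI2 : (I : ℂ) = 3 ^ (m / 2) * (3 ^ m * ∏ j ∈ Finset.range m, ((n : ℂ) + 1 / 3 - j)) /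
          m.factorial := by
        rw [hI']; field_simp
      rw [hI2]
      generalize ∏ j ∈ Finset.range m, ((n : ℂ) + 1 / 3 - j) = F
      ring
    have h2 := key (-δ) (by rw [neg_sq]; exact hδ)
    rw [show 3 * -δ = -(3 * δ) by ring] at h2
    rw [key δ hδ, h2]
    exact O.mul_mem (hdiag _) (O.pow_mem hd (m % 2))
  have hs : ∀ m, ((padeCoeff n m * (3 * δ) ^ m * ((G + 3 * δ) / 2) ^ (n - m),
      padeCoeff n m * (-(3 * δ)) ^ m * ((G - 3 * δ) / 2) ^ (n - m)) : ℂ × ℂ) ∈ O := fun m =>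
    O.mul_mem (hterm m) (O.pow_mem hu (n - m))
  have := O.sum_mem (t := Finset.range (n + 1)) fun m _ => hs m
  rw [padeNum_eq_sum, padeNum_eq_sum]
  convert this using 1
  ext
  · simp only [Prod.fst_sum]
    refine Finset.sum_congr rfl fun m _ => ?_
    congr 2; ring
  · simp only [Prod.snd_sum]
    refine Finset.sum_congr rfl fun m _ => ?_
    congr 2; ring

theorem norm_sq_add_add_one_ge (w : ℂ) {t : ℝ} (h : ‖w - 1‖ ≤ t) :
    3 - 3 * t - t ^ 2 ≤ ‖w ^ 2 + w + 1‖ := by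
  have e : w ^ 2 + w + 1 = 3 - (-(3 * (w - 1)) - (w - 1) ^ 2) := by ring
  have h1 : ‖-(3 * (w - 1)) - (w - 1) ^ 2‖ ≤ 3 * t + t ^ 2 := by
    refine (norm_sub_le _ _).trans ?_
    rw [norm_neg, norm_mul, norm_pow]
    norm_num
    gcongr
  have h2 := norm_sub_norm_le (3 : ℂ) (-(3 * (w - 1)) - (w - 1) ^ 2)
  rw [e]
  norm_num at h2 ⊢
  linarith

theorem norm_sub_one_mul_le (w : ℂ) {r : ℝ} (h : ‖w - 1‖ ≤ 1 / 2) (hr : ‖w ^ 3 - 1‖ ≤ r)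
    (hr1 : r ≤ 1 / 20) : 3 * ‖w - 1‖ ≤ (1 + r) * ‖w ^ 3 - 1‖ := by
  have e : ‖w ^ 3 - 1‖ = ‖w - 1‖ * ‖w ^ 2 + w + 1‖ := by rw [← norm_mul]; congr 1; ring
  have h1 := norm_sq_add_add_one_ge w h
  have h0 := norm_nonneg (w - 1)
  have h2 : ‖w - 1‖ ≤ 4 / 5 * r := by nlinarith
  have h3 := norm_sq_add_add_one_ge w h2
  have hr0 : 0 ≤ r := (norm_nonneg _).trans hr
  rw [e]
  have h4 : 3 ≤ (1 + r) * ‖w ^ 2 + w + 1‖ := by nlinarith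
  nlinarith

theorem eq_of_cube_eq {w θ : ℂ} (h : w ^ 3 = θ ^ 3) (hw : ‖w - 1‖ ≤ 1 / 2)
    (hθ : ‖θ - 1‖ ≤ 1 / 20) : w = θ := by
  have h1 : (w - θ) * (w ^ 2 + w * θ + θ ^ 2) = 0 := by linear_combination h
  rcases mul_eq_zero.1 h1 with h2 | h2
  · exact sub_eq_zero.1 h2
  exfalso
  have e : (3 : ℂ) =
      -(3 * (w - 1) + 3 * (θ - 1) + (w - 1) ^ 2 + (w - 1) * (θ - 1) + (θ - 1) ^ 2) := by
    linear_combination h2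
  have h3 : ‖(3 : ℂ)‖ ≤ 3 * ‖w - 1‖ + 3 * ‖θ - 1‖ + ‖w - 1‖ ^ 2 + ‖w - 1‖ * ‖θ - 1‖ +
      ‖θ - 1‖ ^ 2 := by
    conv_lhs => rw [e]
    rw [norm_neg]
    refine (norm_add_le _ _).trans (add_le_add ((norm_add_le _ _).trans (add_le_add
      ((norm_add_le _ _).trans (add_le_add ((norm_add_le _ _).trans
        (add_le_add ?_ ?_)) ?_)) ?_)) ?_)
    all_goals simp
  have a0 := norm_nonneg (w - 1)
  have b0 := norm_nonneg (θ - 1)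
  norm_num at h3
  nlinarith

/-- Coordinates of a pair of solutions of a cubic Thue equation in which the form is diagonal. -/
structure DiagPair (D : ℤ) (δ : ℂ) (g : ℝ) (G k B : ℤ) (ξ₁ η₁ ξ₂ η₂ : ℂ) : Prop where
  sq_delta : δ ^ 2 = -3 * D
  disc_ne : D ≠ 0
  disc_mod : 4 ∣ D * (D + 3)
  g_pos : 0 < g
  parity_G : 2 ∣ G - D
  parity_B : 2 ∣ B - D * k
  cube_xi : ξ₁ ^ 3 = g * ((G + 3 * δ) / 2)
  cube_eta : η₁ ^ 3 = g * ((G - 3 * δ) / 2)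
  cube_sub : ξ₂ ^ 3 - η₂ ^ 3 = g * (3 * δ)
  mul_eta : ξ₁ * η₂ = g * ((B + k * δ) / 2)
  mul_xi : ξ₂ * η₁ = g * ((B - k * δ) / 2)
  near_one : ‖ξ₁ - η₁‖ ≤ 1 / 2 * ‖ξ₁‖
  near_two : ‖ξ₂ - η₂‖ ≤ 1 / 2 * ‖ξ₂‖
  norm_pos : 0 < ‖ξ₁‖
  norm_le : ‖ξ₁‖ ≤ ‖ξ₂‖

/-- The integer linear forms attached to a pair of solutions. -/
structure PadeForms (D G k B : ℤ) (l : ℕ → ℤ) : Prop where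
  zero : l 0 = k
  one : l 1 = G * k - B
  step : ∀ n : ℕ, ((n : ℤ) + 1) * (n + 2) * l (n + 2) =
    (n + 1) * (2 * n + 3) * G * l (n + 1) + 3 * D * (9 * (n + 1) ^ 2 - 1) * l n

theorem DiagPair.delta_ne {D : ℤ} {δ : ℂ} {g : ℝ} {G k B : ℤ} {ξ₁ η₁ ξ₂ η₂ : ℂ}
    (h : DiagPair D δ g G k B ξ₁ η₁ ξ₂ η₂) : δ ≠ 0 := by
  rintro rfl
  have := h.sq_delta
  have h2 : (D : ℂ) = 0 := by linear_combination this / 3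
  exact h.disc_ne (by exact_mod_cast h2)

theorem DiagPair.exists_forms {D : ℤ} {δ : ℂ} {g : ℝ} {G k B : ℤ} {ξ₁ η₁ ξ₂ η₂ : ℂ}
    (h : DiagPair D δ g G k B ξ₁ η₁ ξ₂ η₂) : ∃ l : ℕ → ℤ, PadeForms D G k B l ∧
    ∀ n, (g * δ * l n : ℂ) = padeNum ((G + 3 * δ) / 2) ((G - 3 * δ) / 2) n * (ξ₁ * η₂) -
      padeNum ((G - 3 * δ) / 2) ((G + 3 * δ) / 2) n * (ξ₂ * η₁) := by
  have hδ0 := h.delta_ne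
  have hg0 : (g : ℂ) ≠ 0 := by exact_mod_cast h.g_pos.ne'
  have hex : ∀ n, ∃ l : ℤ, (g * δ * l : ℂ) =
      padeNum ((G + 3 * δ) / 2) ((G - 3 * δ) / 2) n * (ξ₁ * η₂) -
      padeNum ((G - 3 * δ) / 2) ((G + 3 * δ) / 2) n * (ξ₂ * η₁) := by
    intro n
    obtain ⟨i, j, hij⟩ := padeNum_mem_quadOrder D G δ h.sq_delta h.disc_mod h.parity_G n
    have h1 := congrArg Prod.fst hij
    have h2 := congrArg Prod.snd hij
    simp only at h1 h2
    obtain ⟨b, hb⟩ := h.parity_B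
    have hb' := congrArg (Int.cast (R := ℂ)) hb
    push_cast at hb'
    refine ⟨i * k + j * b + j * D * k, ?_⟩
    rw [h1, h2, h.mul_eta, h.mul_xi]
    push_cast
    linear_combination (-(g : ℂ) * j * δ / 2) * hb'
  choose l hl using hex
  refine ⟨l, ⟨?_, ?_, ?_⟩, hl⟩
  · have := hl 0
    rw [h.mul_eta, h.mul_xi] at this
    simp only [padeNum, padeRec] at this
    have h2 : (g * δ) * (l 0 : ℂ) = (g * δ) * (k : ℂ) := by linear_combination this
    exact_mod_cast mul_left_cancel₀ (mul_ne_zero hg0 hδ0) h2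
  · have := hl 1
    rw [h.mul_eta, h.mul_xi] at this
    simp only [padeNum, padeRec] at this
    have h2 : (g * δ) * (l 1 : ℂ) = (g * δ) * (G * k - B : ℂ) := by linear_combination this
    exact_mod_cast mul_left_cancel₀ (mul_ne_zero hg0 hδ0) h2
  · intro n
    have h0 := hl n
    have h1 := hl (n + 1)
    have h2 := hl (n + 2)
    have r1 := padeRec_succ ((G + 3 * δ) / 2 + (G - 3 * δ) / 2)
      (((G + 3 * δ) / 2 - (G - 3 * δ) / 2) ^ 2) 1
      ((2 * ((G + 3 * δ) / 2) + 4 * ((G - 3 * δ) / 2)) / 3) n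
    have r2 := padeRec_succ ((G - 3 * δ) / 2 + (G + 3 * δ) / 2)
      (((G - 3 * δ) / 2 - (G + 3 * δ) / 2) ^ 2) 1
      ((2 * ((G - 3 * δ) / 2) + 4 * ((G + 3 * δ) / 2)) / 3) n
    simp only [padeNum] at h0 h1 h2
    have e1 : ((G : ℂ) + 3 * δ) / 2 + (G - 3 * δ) / 2 = G := by ring
    have e2 : ((G : ℂ) - 3 * δ) / 2 + (G + 3 * δ) / 2 = G := by ring
    have e3 : (((G : ℂ) + 3 * δ) / 2 - (G - 3 * δ) / 2) ^ 2 = -27 * D := by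
      linear_combination 9 * h.sq_delta
    have e4 : (((G : ℂ) - 3 * δ) / 2 - (G + 3 * δ) / 2) ^ 2 = -27 * D := by
      linear_combination 9 * h.sq_delta
    rw [e1, e3] at r1
    rw [e2, e4] at r2
    rw [e1, e3, e2, e4] at h0 h1 h2
    have key : (9 * (g * δ)) * (((n : ℂ) + 1) * (n + 2) * l (n + 2)) =
        (9 * (g * δ)) * ((n + 1) * (2 * n + 3) * G * l (n + 1) +
          3 * D * (9 * (n + 1) ^ 2 - 1) * l n) := by
      linear_combination (ξ₁ * η₂) * r1 - (ξ₂ * η₁) * r2 + 9 * ((n : ℂ) + 1) * (n + 2) * h2 -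
        9 * (n + 1) * (2 * n + 3) * G * h1 - 27 * D * (9 * (n + 1) ^ 2 - 1) * h0
    have := mul_left_cancel₀ (mul_ne_zero (by norm_num) (mul_ne_zero hg0 hδ0)) key
    exact_mod_cast this

theorem DiagPair.forms_bound {D : ℤ} {δ : ℂ} {g : ℝ} {G k B : ℤ} {ξ₁ η₁ ξ₂ η₂ : ℂ}
    (h : DiagPair D δ g G k B ξ₁ η₁ ξ₂ η₂) {p r R : ℝ} (hp : g * p = ‖ξ₁‖ ^ 3)
    (hr0 : 0 ≤ r) (hr : r ^ 2 * p ^ 2 = 27 * |(D : ℝ)|) (hr1 : r ≤ 1 / 20)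
    (hR : ‖ξ₂‖ = R * ‖ξ₁‖ ^ 2) :
    ∃ l : ℕ → ℤ, PadeForms D G k B l ∧ ∀ n, |(l n : ℝ)| ≤
      n.centralBinom * (p * (1 + r)) ^ n * (1 + r) / (R ^ 2 * (g * p)) +
      3 * remLead n * (27 * |(D : ℝ)| / p) ^ n * R / (1 - r) ^ (n + 1) := by
  obtain ⟨l, hl, hln⟩ := h.exists_forms
  refine ⟨l, hl, fun n => ?_⟩
  have hg := h.g_pos
  have hN := h.norm_pos
  have hM := hN.trans_le h.norm_le
  have hδ0 := h.delta_ne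
  have hδ : 0 < ‖δ‖ := norm_pos_iff.2 hδ0
  have hp0 : 0 < p := by
    have : 0 < g * p := by rw [hp]; positivity
    exact (mul_pos_iff_of_pos_left hg).1 this
  have hR0 : 0 < R := by
    have : 0 < R * ‖ξ₁‖ ^ 2 := by rw [← hR]; exact hM
    exact (mul_pos_iff_of_pos_right (by positivity)).1 this
  have hδ2 : ‖δ‖ ^ 2 = 3 * |(D : ℝ)| := by
    rw [← norm_pow, h.sq_delta, norm_mul]
    simp
  have hrp : r * p = 3 * ‖δ‖ := by
    have : (r * p) ^ 2 = (3 * ‖δ‖) ^ 2 := by rw [mul_pow, mul_pow, hr, hδ2]; ring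
    exact (pow_left_inj₀ (by positivity) (by positivity) two_ne_zero).1 this
  have hr' : 0 < r := by
    by_contra hc
    have : r = 0 := le_antisymm (not_lt.1 hc) hr0
    rw [this, zero_mul] at hrp
    linarith
  have hξ1 : ξ₁ ≠ 0 := norm_pos_iff.1 hN
  have hξ2 : ξ₂ ≠ 0 := norm_pos_iff.1 hM
  set u : ℂ := (G + 3 * δ) / 2 with hu
  set v : ℂ := (G - 3 * δ) / 2 with hv
  have hgC : (g : ℂ) ≠ 0 := by exact_mod_cast hg.ne'
  have hup : ‖u‖ = p := by
    have := congrArg norm h.cube_xi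
    rw [norm_pow, ← hp, norm_mul, Complex.norm_real, Real.norm_of_nonneg hg.le] at this
    exact (mul_left_cancel₀ hg.ne' this).symm
  have hu0 : u ≠ 0 := norm_pos_iff.1 (hup ▸ hp0)
  set z : ℂ := 3 * δ / u with hz
  have hzu : u - v = u * z := by rw [hz, mul_div_cancel₀ _ hu0, hu, hv]; ring
  have hzr : ‖z‖ = r := by
    rw [hz, norm_div, hup, norm_mul, div_eq_iff hp0.ne', hrp]
    norm_num
  have hz1 : ‖z‖ < 1 := by rw [hzr]; linarith
  set w : ℂ := η₁ / ξ₁ with hw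
  have hw3 : w ^ 3 = 1 - z := by
    rw [hw, div_pow, h.cube_xi, h.cube_eta, mul_div_mul_left _ _ hgC]
    change v / u = 1 - z
    rw [div_eq_iff hu0]; linear_combination -hzu
  have hw1 : ‖w - 1‖ ≤ 1 / 2 := by
    have : w - 1 = -((ξ₁ - η₁) / ξ₁) := by rw [hw]; field_simp; ring
    rw [this, norm_neg, norm_div, div_le_iff₀ hN]
    exact h.near_one
  have hθ : w = 1 - z * remFun 0 z := by
    apply eq_of_cube_eq _ hw1
    · have := norm_remFun_le 0 hz1
      rw [hzr] at this
      have e : 1 - z * remFun 0 z - 1 = -(z * remFun 0 z) := by ring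
      rw [e, norm_neg, norm_mul, hzr]
      have h3 : remLead 0 / (1 - r) ^ (0 + 1) ≤ 1 := by
        rw [zero_add, pow_one, div_le_one (by linarith)]
        simp only [remLead]; linarith
      nlinarith [norm_nonneg (remFun 0 z)]
    · rw [hw3, exists_cube_root_remFun hz1]
  have hrem := padeNum_remainder hzu hz1 hθ n
  have hnum := norm_padeNum_le u v z hzu n
  rw [hup, hzr] at hnum
  have hrf := norm_remFun_le n hz1
  rw [hzr] at hrf
  -- the second solution
  have h2 : ‖ξ₂ - η₂‖ ≤ (1 + r) * (g * ‖δ‖) / ‖ξ₂‖ ^ 2 := by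
    have hw2 : ‖η₂ / ξ₂ - 1‖ ≤ 1 / 2 := by
      have : η₂ / ξ₂ - 1 = -((ξ₂ - η₂) / ξ₂) := by field_simp; ring
      rw [this, norm_neg, norm_div, div_le_iff₀ hM]
      exact h.near_two
    have hc : ‖(η₂ / ξ₂) ^ 3 - 1‖ = 3 * (g * ‖δ‖) / ‖ξ₂‖ ^ 3 := by
      have : (η₂ / ξ₂) ^ 3 - 1 = -((ξ₂ ^ 3 - η₂ ^ 3) / ξ₂ ^ 3) := by field_simp; ring
      rw [this, norm_neg, norm_div, norm_pow, h.cube_sub, norm_mul, norm_mul, Complex.norm_real,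
        Real.norm_of_nonneg hg.le]
      congr 1
      norm_num
      ring
    have hcr : ‖(η₂ / ξ₂) ^ 3 - 1‖ ≤ r := by
      rw [hc, div_le_iff₀ (by positivity)]
      have : ‖ξ₁‖ ^ 3 ≤ ‖ξ₂‖ ^ 3 := pow_le_pow_left₀ hN.le h.norm_le 3
      calc 3 * (g * ‖δ‖) = r * (g * p) := by linear_combination -g * hrp
        _ = r * ‖ξ₁‖ ^ 3 := by rw [hp]
        _ ≤ _ := by gcongr
    have := norm_sub_one_mul_le _ hw2 hcr hr1
    rw [hc] at this
    have e : ‖ξ₂ - η₂‖ = ‖ξ₂‖ * ‖η₂ / ξ₂ - 1‖ := by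
      rw [← norm_mul, mul_sub, mul_div_cancel₀ _ hξ2, mul_one, norm_sub_rev]
    rw [e, le_div_iff₀ (by positivity)]
    have h3 : ‖η₂ / ξ₂ - 1‖ * ‖ξ₂‖ ^ 3 ≤ (1 + r) * (g * ‖δ‖) := by
      rw [← le_div_iff₀ (by positivity)]
      calc _ ≤ (1 + r) * (3 * (g * ‖δ‖) / ‖ξ₂‖ ^ 3) / 3 := by linarith
        _ = _ := by ring
    calc _ = ‖η₂ / ξ₂ - 1‖ * ‖ξ₂‖ ^ 3 := by ring
      _ ≤ _ := h3
  have hmain : (g * δ * l n : ℂ) = padeNum u v n * ξ₁ * (η₂ - ξ₂) +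
      ξ₂ * ξ₁ * (u ^ n * z ^ (2 * n + 1) * remFun n z) := by
    rw [hln n, ← hrem]
    have : η₁ = w * ξ₁ := by rw [hw]; field_simp
    rw [this]; ring
  have hnorm : g * ‖δ‖ * |(l n : ℝ)| ≤
      n.centralBinom * (p * (1 + r)) ^ n * ‖ξ₁‖ * ((1 + r) * (g * ‖δ‖) / ‖ξ₂‖ ^ 2) +
      ‖ξ₂‖ * ‖ξ₁‖ * (p ^ n * r ^ (2 * n + 1) * (remLead n / (1 - r) ^ (n + 1))) := by
    have : g * ‖δ‖ * |(l n : ℝ)| = ‖(g * δ * l n : ℂ)‖ := by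
      rw [norm_mul, norm_mul, Complex.norm_real, Real.norm_of_nonneg hg.le, Complex.norm_intCast]
    rw [this, hmain]
    refine (norm_add_le _ _).trans ?_
    simp only [norm_mul, norm_pow, hup, hzr]
    rw [norm_sub_rev η₂ ξ₂]
    gcongr
  have hgδ : 0 < g * ‖δ‖ := by positivity
  refine le_of_mul_le_mul_left (hnorm.trans (le_of_eq ?_)) hgδ
  have hN3 : ‖ξ₁‖ ^ 3 = g * p := hp.symm
  have h1r : 0 < 1 - r := by linarith
  have hrr : r ^ (2 * n + 1) * p ^ n = (27 * |(D : ℝ)| / p) ^ n * r := by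
    rw [pow_succ, pow_mul, ← hr, mul_right_comm, ← mul_pow]
    congr 2; field_simp
  rw [hR, mul_add (g * ‖δ‖)]
  refine congrArg₂ (fun s t : ℝ => s + t) ?_ ?_
  · rw [← hN3]; field_simp
  · have e1 : p ^ n * r ^ (2 * n + 1) = (27 * |(D : ℝ)| / p) ^ n * r := by rw [mul_comm, hrr]
    rw [e1]
    have e2 : R * ‖ξ₁‖ ^ 2 * ‖ξ₁‖ = R * (g * p) := by rw [← hN3]; ring
    rw [e2]
    have e3 : R * (g * p) * ((27 * |(D : ℝ)| / p) ^ n * r * (remLead n / (1 - r) ^ (n + 1))) =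
      R * g * (r * p) * ((27 * |(D : ℝ)| / p) ^ n * (remLead n / (1 - r) ^ (n + 1))) := by ring
    rw [e3, hrp]; ring

theorem DiagPair.relation {D : ℤ} {δ : ℂ} {g : ℝ} {G k B : ℤ} {ξ₁ η₁ ξ₂ η₂ : ℂ}
    (h : DiagPair D δ g G k B ξ₁ η₁ ξ₂ η₂) {γ : ℤ} (hγ : g = γ) :
    γ * (B ^ 3 - 9 * D * B * k ^ 2 - G * (B ^ 2 * k - D * k ^ 3)) = 2 * (G ^ 2 + 27 * D) := by
  have hδ0 := h.delta_ne
  have hg0 : (g : ℂ) ≠ 0 := by exact_mod_cast h.g_pos.ne'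
  have e1 : ξ₁ ^ 3 * η₂ ^ 3 = (g * ((B + k * δ) / 2)) ^ 3 := by rw [← mul_pow, h.mul_eta]
  have e2 : ξ₂ ^ 3 * η₁ ^ 3 = (g * ((B - k * δ) / 2)) ^ 3 := by rw [← mul_pow, h.mul_xi]
  rw [h.cube_xi] at e1
  rw [h.cube_eta] at e2
  have h3 := h.cube_sub
  have key : ((g : ℂ) ^ 2 * (3 * δ)) *
      (g * (B ^ 3 - 9 * D * B * k ^ 2 - G * (B ^ 2 * k - D * k ^ 3))) =
      (g ^ 2 * (3 * δ)) * (2 * (G ^ 2 + 27 * D)) := by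
    have hD : (D : ℂ) = -δ ^ 2 / 3 := by rw [h.sq_delta]; ring
    rw [hD]
    linear_combination (-4 : ℂ) * (G + 3 * δ) * e2 + 4 * (G - 3 * δ) * e1 +
      8 * ((g : ℂ) * ((G + 3 * δ) / 2) * ((G - 3 * δ) / 2)) * h3
  have := mul_left_cancel₀ (mul_ne_zero (pow_ne_zero 2 hg0) (mul_ne_zero (by norm_num) hδ0)) key
  have hgc : (g : ℂ) = (γ : ℂ) := by rw [hγ]; simp
  rw [hgc] at this
  exact_mod_cast this

theorem PadeForms.not_consecutive {D G k B : ℤ} {l : ℕ → ℤ} (h : PadeForms D G k B l)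
    (hD : D ≠ 0) (hk : k ≠ 0) (n : ℕ) : l n = 0 → l (n + 1) ≠ 0 := by
  induction n with
  | zero => intro h0; rw [h.zero] at h0; exact absurd h0 hk
  | succ n ih =>
    intro h1 h2
    have := h.step n
    rw [h1, h2] at this
    have h3 : l n = 0 := by
      have h4 : 3 * D * (9 * ((n : ℤ) + 1) ^ 2 - 1) ≠ 0 := by
        refine mul_ne_zero (mul_ne_zero (by norm_num) hD) ?_
        have : (0 : ℤ) ≤ n := by positivity
        nlinarith
      have h5 : 3 * D * (9 * ((n : ℤ) + 1) ^ 2 - 1) * l n = 0 := by linarith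
      exact (mul_eq_zero.1 h5).resolve_left h4
    exact ih h3 h1

theorem abs_le_of_dvd_ne {G m : ℤ} (h : G ∣ m) (hm : m ≠ 0) : |(G : ℝ)| ≤ |(m : ℝ)| := by
  have := Int.le_of_dvd (abs_pos.2 hm) ((abs_dvd_abs _ _).2 h)
  exact_mod_cast this

theorem DiagPair.norm_cube {D : ℤ} {δ : ℂ} {g : ℝ} {G k B : ℤ} {ξ₁ η₁ ξ₂ η₂ : ℂ}
    (h : DiagPair D δ g G k B ξ₁ η₁ ξ₂ η₂) {p r : ℝ} (hp : g * p = ‖ξ₁‖ ^ 3) (hp0 : 0 < p)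
    (hr0 : 0 ≤ r) (hr : r ^ 2 * p ^ 2 = 27 * |(D : ℝ)|) : p * (2 - r) ≤ |(G : ℝ)| := by
  have hδ2 : ‖δ‖ ^ 2 = 3 * |(D : ℝ)| := by
    rw [← norm_pow, h.sq_delta, norm_mul]
    simp
  have hrp : r * p = 3 * ‖δ‖ := by
    have : (r * p) ^ 2 = (3 * ‖δ‖) ^ 2 := by rw [mul_pow, mul_pow, hr, hδ2]; ring
    exact (pow_left_inj₀ (by positivity) (by positivity) two_ne_zero).1 this
  have h1 := congrArg norm h.cube_xi
  rw [norm_pow, ← hp, norm_mul, Complex.norm_real, Real.norm_of_nonneg h.g_pos.le] at h1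
  have h2 := mul_left_cancel₀ h.g_pos.ne' h1
  have h3 : ‖(G : ℂ) + 3 * δ‖ ≤ |(G : ℝ)| + 3 * ‖δ‖ := by
    refine (norm_add_le _ _).trans ?_
    rw [norm_mul, Complex.norm_intCast]
    norm_num
  rw [norm_div] at h2
  norm_num at h2
  linarith

theorem DiagPair.two_dvd_form_one {D : ℤ} {δ : ℂ} {g : ℝ} {G k B : ℤ} {ξ₁ η₁ ξ₂ η₂ : ℂ}
    (h : DiagPair D δ g G k B ξ₁ η₁ ξ₂ η₂) : 2 ∣ G * k - B := by
  obtain ⟨i, hi⟩ := h.parity_G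
  obtain ⟨j, hj⟩ := h.parity_B
  exact ⟨i * k - j, by linear_combination k * hi - hj⟩

theorem DiagPair.form_one_ne {D : ℤ} {δ : ℂ} {g : ℝ} {G k B : ℤ} {ξ₁ η₁ ξ₂ η₂ : ℂ}
    (h : DiagPair D δ g G k B ξ₁ η₁ ξ₂ η₂) {γ : ℤ} (hγ : g = γ)
    (hG : 27 * |(D : ℝ)| < |(G : ℝ)|) : G * k - B ≠ 0 := by
  intro h0
  have hB : B = G * k := by linarith
  have hrel := h.relation hγ
  rw [hB] at hrel
  have hdvd : G ∣ 27 * D := ⟨-(4 * γ * k ^ 3 * D) - G, by linarith⟩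
  have := abs_le_of_dvd_ne hdvd (mul_ne_zero (by norm_num) h.disc_ne)
  push_cast at this
  rw [abs_mul, abs_of_pos (by norm_num : (0 : ℝ) < 27)] at this
  linarith

theorem DiagPair.form_one_ge_four {D : ℤ} {δ : ℂ} {G k B : ℤ} {ξ₁ η₁ ξ₂ η₂ : ℂ}
    (h : DiagPair D δ 1 G k B ξ₁ η₁ ξ₂ η₂) (hG : 27 * |(D : ℝ)| < |(G : ℝ)|)
    (hk : k = 1 ∨ k = -1) : 4 ≤ |((G * k - B : ℤ) : ℝ)| := by
  have h0 := h.form_one_ne (γ := 1) (by simp) hG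
  obtain ⟨t, ht⟩ := h.two_dvd_form_one
  have hrel := h.relation (γ := 1) (by simp)
  have hD1 : 1 ≤ |(D : ℝ)| := by exact_mod_cast Int.one_le_abs h.disc_ne
  have hB : B = G * k - 2 * t := by linarith
  have ht2 : 2 ≤ |t| := by
    by_contra hlt
    have ht' : t = 1 ∨ t = -1 := by
      have h1 := abs_lt.1 (not_le.1 hlt)
      have h2 : t ≠ 0 := by rintro rfl; exact h0 (by simpa using ht)
      omega
    have hdvd : ∃ m : ℤ, G ∣ m ∧ m ≠ 0 ∧ |(m : ℝ)| ≤ 27 * |(D : ℝ)| := by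
      have hx : ∀ s₁ s₂ : ℝ, |s₁| ≤ 9 → |s₂| ≤ 2 → |s₁ * (D : ℝ) + s₂| ≤ 27 * |(D : ℝ)| := by
        intro s₁ s₂ h1 h2
        refine (abs_add_le _ _).trans ?_
        rw [abs_mul]
        nlinarith
      have hm := h.disc_mod
      rcases hk with rfl | rfl <;> rcases ht' with rfl | rfl <;> rw [hB] at hrel
      · refine ⟨9 * D + 2, ⟨-G - 2 * (D - 1), by linarith⟩, by omega, ?_⟩
        have := hx 9 2 (by norm_num) (by norm_num)
        push_cast; exact this
      · refine ⟨9 * D - 1, ⟨1 - D, by linarith⟩, by omega, ?_⟩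
        have := hx 9 (-1) (by norm_num) (by norm_num)
        push_cast; exact this
      · refine ⟨9 * D + 2, ⟨-G + 2 * (D - 1), by linarith⟩, by omega, ?_⟩
        have := hx 9 2 (by norm_num) (by norm_num)
        push_cast; exact this
      · refine ⟨9 * D - 1, ⟨D - 1, by linarith⟩, by omega, ?_⟩
        have := hx 9 (-1) (by norm_num) (by norm_num)
        push_cast; exact this
    obtain ⟨m, h1, h2, h3⟩ := hdvd
    linarith [abs_le_of_dvd_ne h1 h2]
  have : 4 ≤ |G * k - B| := by rw [ht, abs_mul]; norm_num; omega
  exact_mod_cast this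

theorem DiagPair.form_two_ne {D : ℤ} {δ : ℂ} {g : ℝ} {G k B : ℤ} {ξ₁ η₁ ξ₂ η₂ : ℂ}
    (h : DiagPair D δ g G k B ξ₁ η₁ ξ₂ η₂) {γ : ℤ} (hγ : g = γ)
    (hG : 1200 * (D : ℝ) ^ 2 ≤ |(G : ℝ)|) : G * (G * k - B) + 8 * D * k ≠ 0 := by
  intro h0
  have hD1 : 1 ≤ |(D : ℝ)| := by exact_mod_cast Int.one_le_abs h.disc_ne
  have hD2 : (D : ℝ) ^ 2 = |(D : ℝ)| ^ 2 := (sq_abs _).symm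
  have hG2 : (G : ℝ) ^ 2 = |(G : ℝ)| ^ 2 := (sq_abs _).symm
  rw [hD2] at hG
  have hG0 : G ≠ 0 := by
    rintro rfl
    norm_num at hG
    nlinarith
  have hrel := h.relation hγ
  have hGB : G * B = k * (G ^ 2 + 8 * D) := by linarith
  have h3 : G ^ 3 * (G ^ 2 + 27 * D) = 4 * γ * k ^ 3 * D ^ 2 * (7 * G ^ 2 + 64 * D) := by
    have : 2 * (G ^ 3 * (G ^ 2 + 27 * D)) =
        2 * (4 * γ * k ^ 3 * D ^ 2 * (7 * G ^ 2 + 64 * D)) := by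
      calc _ = G ^ 3 * (2 * (G ^ 2 + 27 * D)) := by ring
        _ = γ * ((G * B) ^ 3 - 9 * D * (G * B) * k ^ 2 * G ^ 2 -
              G ^ 2 * ((G * B) ^ 2 * k - D * G ^ 2 * k ^ 3)) := by rw [← hrel]; ring
        _ = _ := by rw [hGB]; ring
    linarith
  have hdvd : 7 * G ^ 2 + 64 * D ∣ 8000 * G * D ^ 2 := by
    have h4 : 7 * G ^ 2 + 64 * D ∣ G ^ 3 * (G ^ 2 + 27 * D) :=
      ⟨4 * γ * k ^ 3 * D ^ 2, by rw [h3]; ring⟩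
    obtain ⟨m, hm⟩ := h4
    exact ⟨(7 * G ^ 3 + 125 * G * D) - 49 * m, by linear_combination (-49) * hm⟩
  have h5 := abs_le_of_dvd_ne hdvd (mul_ne_zero (mul_ne_zero (by norm_num) hG0)
    (pow_ne_zero 2 h.disc_ne))
  push_cast at h5
  rw [abs_mul, abs_mul, abs_pow] at h5
  norm_num at h5
  have h6 : 7 * |(G : ℝ)| ^ 2 - 64 * |(D : ℝ)| ≤ |7 * (G : ℝ) ^ 2 + 64 * D| := by
    refine le_trans ?_ (le_abs_self _)
    rw [hG2]
    linarith [neg_abs_le (D : ℝ)]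
  set x := |(G : ℝ)|
  set y := |(D : ℝ)|
  have h7 : 1200 * y ^ 2 * x ≤ x ^ 2 := by nlinarith
  have h8 : 1 ≤ y ^ 2 := by nlinarith
  nlinarith

/-- The normalised size of the Padé remainder, scaled to be an integer for small index. -/
noncomputable def remConst (n : ℕ) : ℝ := 3 * remLead n * 27 ^ n

theorem remConst_pos (n : ℕ) : 0 < remConst n := by
  have := remLead_pos n
  unfold remConst; positivity

theorem remConst_succ (n : ℕ) : remConst (n + 1) =
    remConst n * (27 * (((n : ℝ) + 2 / 3) * (n + 4 / 3) / (2 * (n + 1) * (2 * n + 3)))) := by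
  simp only [remConst, remLead, pow_succ]; ring

theorem remConst_succ_le (n : ℕ) : remConst (n + 1) ≤ remConst n * (27 / 4) := by
  rw [remConst_succ]
  refine mul_le_mul_of_nonneg_left ?_ (remConst_pos n).le
  have : ((n : ℝ) + 2 / 3) * (n + 4 / 3) / (2 * (n + 1) * (2 * n + 3)) ≤ 1 / 4 := by
    rw [div_le_iff₀ (by positivity)]
    nlinarith [(Nat.cast_nonneg n : (0 : ℝ) ≤ n)]
  linarith

theorem remConst_two : remConst 2 = 21 := by norm_num [remConst, remLead]
theorem remConst_three : remConst 3 = 120 := by norm_num [remConst, remLead]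

theorem centralBinom_succ_le (n : ℕ) :
    ((n + 1).centralBinom : ℝ) ≤ 4 * n.centralBinom := by
  have h := Nat.succ_mul_centralBinom_succ n
  have h1 : (n + 1) * (n + 1).centralBinom ≤ (n + 1) * (4 * n.centralBinom) := by
    rw [h]; nlinarith [Nat.zero_le n.centralBinom]
  exact_mod_cast Nat.le_of_mul_le_mul_left h1 (by omega)

theorem growth_weight {d p r : ℝ} (hd : 1 ≤ d) (hr0 : 0 ≤ r) (hr : r ≤ 435 / 100000)
    (hp : 1200 * d ^ 2 ≤ p) (hp2 : 1500000 * d ^ 5 ≤ p ^ 2) (m : ℕ) :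
    4 * ((m + 5).centralBinom * remConst (m + 3) ^ 2) * d ^ (2 * m + 6) * (1 + r) ^ (m + 6) ≤
      11 * d * p ^ (m + 2) * (1 - r) ^ (2 * m + 8) := by
  have hd0 : 0 < d := by linarith
  have hp0 : 0 < p := by nlinarith
  have h1 : 0 < 1 - r := by linarith
  induction m with
  | zero =>
    have hC : Nat.centralBinom 5 = 252 := by decide
    simp only [zero_add, hC, remConst_three, mul_zero]
    have a : (1 + r) ^ 6 ≤ 1.0264 := by
      calc (1 + r) ^ 6 ≤ (1 + 435 / 100000) ^ 6 := by gcongr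
        _ ≤ _ := by norm_num
    have b : 0.9657 ≤ (1 - r) ^ 8 := by
      calc (0.9657 : ℝ) ≤ (1 - 435 / 100000) ^ 8 := by norm_num
        _ ≤ _ := by gcongr
    have hd5 : 0 < d ^ 5 := by positivity
    calc _ = (14515200 * d * d ^ 5) * (1 + r) ^ 6 := by push_cast; ring
      _ ≤ (14515200 * d * d ^ 5) * 1.0264 := by gcongr
      _ ≤ 11 * d * (1500000 * d ^ 5) * 0.9657 := by nlinarith [mul_pos hd0 hd5]
      _ ≤ _ := by gcongr
  | succ m ih =>
    have hc := remConst_succ_le (m + 3)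
    have hb := centralBinom_succ_le (m + 5)
    have hc0 := (remConst_pos (m + 3)).le
    have hc1 := (remConst_pos (m + 3 + 1)).le
    have hs : 182.25 * (d ^ 2 * (1 + r)) ≤ p * (1 - r) ^ 2 := by
      have : (0.9 : ℝ) ≤ (1 - r) ^ 2 := by nlinarith
      nlinarith [sq_nonneg d]
    calc 4 * (((m + 1 + 5).centralBinom : ℝ) * remConst (m + 1 + 3) ^ 2) * d ^ (2 * (m + 1) + 6) *
          (1 + r) ^ (m + 1 + 6)
        ≤ 4 * ((4 * (m + 5).centralBinom : ℝ) * (remConst (m + 3) * (27 / 4)) ^ 2) *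
          d ^ (2 * (m + 1) + 6) * (1 + r) ^ (m + 1 + 6) := by
          rw [show m + 1 + 5 = m + 5 + 1 by ring, show m + 1 + 3 = m + 3 + 1 by ring]
          gcongr
      _ = (4 * ((m + 5).centralBinom * remConst (m + 3) ^ 2) * d ^ (2 * m + 6) *
          (1 + r) ^ (m + 6)) * (182.25 * (d ^ 2 * (1 + r))) := by ring
      _ ≤ (11 * d * p ^ (m + 2) * (1 - r) ^ (2 * m + 8)) * (p * (1 - r) ^ 2) := by
          refine mul_le_mul ih hs (by positivity) (by positivity)
      _ = _ := by ring

set_option maxHeartbeats 1000000 in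
/-- Linear forms bounded as in the Padé construction cannot exist when the data are large. -/
theorem PadeForms.absurd_of_bound {D G k B : ℤ} {l : ℕ → ℤ} (h : PadeForms D G k B l)
    (hD : D ≠ 0) (hk : k ≠ 0) (h2 : l 2 ≠ 0) (h3 : 3 ∣ l 2) {d p r R : ℝ} (hd : d = |(D : ℝ)|)
    (hr0 : 0 ≤ r) (hr : r ≤ 435 / 100000) (hp : 1200 * d ^ 2 ≤ p)
    (hp3 : 190 * d ^ 3 ≤ p) (hp2 : 1500000 * d ^ 5 ≤ p ^ 2) (hR : 39 / 100 * p ≤ R * d)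
    (hl : ∀ n, |(l n : ℝ)| ≤ n.centralBinom * (p * (1 + r)) ^ n * (1 + r) / (R ^ 2 * p) +
      3 * remLead n * (27 * d / p) ^ n * R / (1 - r) ^ (n + 1)) : False := by
  have hd1 : 1 ≤ d := by rw [hd]; exact_mod_cast Int.one_le_abs hD
  have hd0 : 0 < d := by linarith
  have hp0 : 0 < p := by nlinarith
  have h1 : 0 < 1 - r := by linarith
  have hR0 : 0 < R := by
    by_contra hc
    nlinarith
  have one_le : ∀ n, l n ≠ 0 → (1 : ℝ) ≤ |(l n : ℝ)| := fun n hn => by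
    exact_mod_cast Int.one_le_abs hn
  set A : ℕ → ℝ := fun n => n.centralBinom * p ^ n * (1 + r) ^ (n + 1) / (R ^ 2 * p) with hA
  set E : ℕ → ℝ := fun n => remConst n * d ^ n * R / (p ^ n * (1 - r) ^ (n + 1)) with hE
  have hl' : ∀ n, |(l n : ℝ)| ≤ A n + E n := fun n => by
    refine (hl n).trans (le_of_eq ?_)
    simp only [hA, hE, remConst]
    congr 1
    · rw [mul_pow]; ring
    · rw [div_pow, mul_pow]; field_simp
  have hAle : ∀ n (t : ℝ), n.centralBinom * p ^ n * (1 + r) ^ (n + 1) ≤ t * (R ^ 2 * p) →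
      A n ≤ t := fun n t ht => by
    simp only [hA]; rw [div_le_iff₀ (by positivity)]; exact ht
  have hEle : ∀ n (t : ℝ), t ≤ E n → t * (p ^ n * (1 - r) ^ (n + 1)) ≤ remConst n * d ^ n * R :=
    fun n t ht => by
      simp only [hE] at ht; rwa [le_div_iff₀ (by positivity)] at ht
  have skip : ∀ n, 2 ≤ n → l (n + 1) = 0 → 20 * d * |(l n : ℝ)| ≤ |(l (n + 2) : ℝ)| := by
    intro n hn h0
    have hs := h.step n
    rw [h0, mul_zero, zero_add] at hs
    have hs' := congrArg (fun z : ℤ => |(z : ℝ)|) hs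
    push_cast at hs'
    have hn' : (2 : ℝ) ≤ n := by exact_mod_cast hn
    have e9 : 0 ≤ 9 * ((n : ℝ) + 1) ^ 2 - 1 := by nlinarith
    simp only [abs_mul] at hs'
    rw [← hd, abs_of_nonneg e9, abs_of_nonneg (by positivity : 0 ≤ (n : ℝ) + 1),
      abs_of_nonneg (by positivity : 0 ≤ (n : ℝ) + 2),
      abs_of_pos (by norm_num : (0 : ℝ) < 3)] at hs'
    have hq : 0 < ((n : ℝ) + 1) * (n + 2) := by positivity
    refine le_of_mul_le_mul_left ?_ hq
    rw [hs']
    have : ((n : ℝ) + 1) * (n + 2) * 20 ≤ 3 * (9 * ((n : ℝ) + 1) ^ 2 - 1) := by nlinarith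
    calc _ = (((n : ℝ) + 1) * (n + 2) * 20) * (d * |(l n : ℝ)|) := by ring
      _ ≤ (3 * (9 * ((n : ℝ) + 1) ^ 2 - 1)) * (d * |(l n : ℝ)|) := by gcongr
      _ = _ := by ring
  have hl2 : (3 : ℝ) ≤ |(l 2 : ℝ)| := by
    obtain ⟨m, hm⟩ := h3
    have hm0 : m ≠ 0 := by rintro rfl; exact h2 (by simpa using hm)
    have : 3 ≤ |l 2| := by rw [hm, abs_mul]; norm_num; exact Int.one_le_abs hm0
    exact_mod_cast this
  have hRR : 0.152 * p ^ 2 ≤ R ^ 2 * d ^ 2 := by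
    have : (39 / 100 * p) ^ 2 ≤ (R * d) ^ 2 := by gcongr
    nlinarith
  have b3 : (1 + r) ^ 3 ≤ 1.0132 := by
    calc (1 + r) ^ 3 ≤ (1 + 435 / 100000) ^ 3 := by gcongr
      _ ≤ _ := by norm_num
  have b5 : (1 + r) ^ 5 ≤ 1.03 := by
    calc (1 + r) ^ 5 ≤ (1 + 435 / 100000) ^ 5 := by gcongr
      _ ≤ _ := by norm_num
  have b4 : (1 + r) ^ 4 ≤ 1.03 := by
    calc (1 + r) ^ 4 ≤ (1 + 435 / 100000) ^ 4 := by gcongr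
      _ ≤ _ := by norm_num
  have c3 : 0.98 ≤ (1 - r) ^ 3 := by
    calc (0.98 : ℝ) ≤ (1 - 435 / 100000) ^ 3 := by norm_num
      _ ≤ _ := by gcongr
  have hA2 : A 2 ≤ 0.1 := by
    apply hAle
    have hC : Nat.centralBinom 2 = 6 := by decide
    rw [hC]
    have hw : 6.1 * p ≤ 0.1 * R ^ 2 := by
      have : (6.1 * p) * d ^ 2 ≤ (0.1 * R ^ 2) * d ^ 2 := by nlinarith
      exact le_of_mul_le_mul_right this (by positivity)
    calc ((6 : ℕ) : ℝ) * p ^ 2 * (1 + r) ^ (2 + 1) ≤ (6 : ℕ) * p ^ 2 * 1.0132 := by gcongr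
      _ ≤ (6.1 * p) * p := by push_cast; nlinarith
      _ ≤ (0.1 * R ^ 2) * p := by gcongr
      _ = _ := by ring
  have hE2 : 2.9 ≤ E 2 := by linarith [hl' 2]
  have hR2 : 0.13 * p ^ 2 ≤ R * d ^ 2 := by
    have := hEle 2 _ hE2
    rw [remConst_two] at this
    have h4 : 2.9 * (p ^ 2 * 0.98) ≤ 2.9 * (p ^ 2 * (1 - r) ^ (2 + 1)) := by gcongr
    nlinarith
  have hRR2 : 0.0169 * p ^ 4 ≤ R ^ 2 * d ^ 4 := by
    have : (0.13 * p ^ 2) ^ 2 ≤ (R * d ^ 2) ^ 2 := by gcongr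
    nlinarith
  have hstart : ∃ n, 3 ≤ n ∧ l n ≠ 0 ∧ 1 / 2 ≤ E n := by
    by_cases h30 : l 3 = 0
    · refine ⟨4, by norm_num, ?_, ?_⟩
      · exact fun h4 => h.not_consecutive hD hk 3 h30 h4
      · have h4 := skip 2 le_rfl h30
        have hA4 : A 4 ≤ 30 * d := by
          apply hAle
          have hC : Nat.centralBinom 4 = 70 := by decide
          rw [hC]
          have hw : 72.1 * p ^ 3 ≤ 30 * d * R ^ 2 := by
            have : (72.1 * p ^ 3) * d ^ 4 ≤ (30 * d * R ^ 2) * d ^ 4 := by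
              calc (72.1 * p ^ 3) * d ^ 4 = (72.1 * p ^ 3 * d) * d ^ 3 := by ring
                _ ≤ (72.1 * p ^ 3 * d) * (p / 190) := by gcongr; linarith
                _ ≤ 30 * d * (0.0169 * p ^ 4) := by nlinarith [mul_pos hd0 (pow_pos hp0 4)]
                _ ≤ 30 * d * (R ^ 2 * d ^ 4) := by gcongr
                _ = _ := by ring
            exact le_of_mul_le_mul_right this (by positivity)
          calc ((70 : ℕ) : ℝ) * p ^ 4 * (1 + r) ^ (4 + 1) ≤ (70 : ℕ) * p ^ 4 * 1.03 := by gcongr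
            _ = (72.1 * p ^ 3) * p := by push_cast; ring
            _ ≤ (30 * d * R ^ 2) * p := by gcongr
            _ = _ := by ring
        have := hl' 4
        nlinarith
    · refine ⟨3, le_rfl, h30, ?_⟩
      have hA3 : A 3 ≤ 1 / 2 := by
        apply hAle
        have hC : Nat.centralBinom 3 = 20 := by decide
        rw [hC]
        have hw : 20.6 * p ^ 2 ≤ 1 / 2 * R ^ 2 := by
          have : (20.6 * p ^ 2) * d ^ 4 ≤ (1 / 2 * R ^ 2) * d ^ 4 := by
            have h5 : (1200 * d ^ 2) ^ 2 ≤ p ^ 2 := by gcongr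
            calc (20.6 * p ^ 2) * d ^ 4 ≤ (20.6 * p ^ 2) * (p ^ 2 / 1440000) := by
                  gcongr; nlinarith
              _ ≤ 1 / 2 * (0.0169 * p ^ 4) := by nlinarith [pow_pos hp0 4]
              _ ≤ 1 / 2 * (R ^ 2 * d ^ 4) := by gcongr
              _ = _ := by ring
          exact le_of_mul_le_mul_right this (by positivity)
        calc ((20 : ℕ) : ℝ) * p ^ 3 * (1 + r) ^ (3 + 1) ≤ (20 : ℕ) * p ^ 3 * 1.03 := by gcongr
          _ = (20.6 * p ^ 2) * p := by push_cast; ring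
          _ ≤ (1 / 2 * R ^ 2) * p := by gcongr
          _ = _ := by ring
      linarith [hl' 3, one_le 3 h30]
  have hAnn : ∀ n, 3 ≤ n → 1 / 2 ≤ E n → A (n + 2) ≤ 11 * d := by
    intro n hn hEn
    obtain ⟨m, rfl⟩ := Nat.exists_eq_add_of_le' hn
    apply hAle
    have hw := growth_weight hd1 hr0 hr hp hp2 m
    have hR1 := hEle _ _ hEn
    have hR2 : (1 / 2 * (p ^ (m + 3) * (1 - r) ^ (m + 3 + 1))) ^ 2 ≤
        (remConst (m + 3) * d ^ (m + 3) * R) ^ 2 := by gcongr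
    have hc0 := remConst_pos (m + 3)
    have hX : 0 < remConst (m + 3) ^ 2 * d ^ (2 * m + 6) := by positivity
    refine le_of_mul_le_mul_left ?_ hX
    calc _ = (4 * ((m + 5).centralBinom * remConst (m + 3) ^ 2) * d ^ (2 * m + 6) *
          (1 + r) ^ (m + 6)) * p ^ (m + 5) / 4 := by
          rw [show m + 3 + 2 = m + 5 by ring]; ring
      _ ≤ (11 * d * p ^ (m + 2) * (1 - r) ^ (2 * m + 8)) * p ^ (m + 5) / 4 := by gcongr
      _ = 11 * d * p * (1 / 2 * (p ^ (m + 3) * (1 - r) ^ (m + 3 + 1))) ^ 2 := by ring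
      _ ≤ 11 * d * p * (remConst (m + 3) * d ^ (m + 3) * R) ^ 2 := by gcongr
      _ = _ := by ring
  have hAsucc : ∀ n, 3 ≤ n → 1 / 2 ≤ E n → A (n + 1) ≤ 1 / 2 := by
    intro n hn hEn
    have ha := hAnn n hn hEn
    have hle : A (n + 1) * p ≤ A (n + 2) := by
      simp only [hA]
      rw [div_mul_eq_mul_div]
      refine div_le_div_of_nonneg_right ?_ (by positivity)
      have hm : ((n + 1).centralBinom : ℝ) ≤ ((n + 2).centralBinom : ℝ) := by
        exact_mod_cast Nat.centralBinom_strictMono.monotone (Nat.le_succ (n + 1))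
      calc _ = ((n + 1).centralBinom : ℝ) * p ^ (n + 2) * ((1 + r) ^ (n + 1 + 1) * 1) := by ring
        _ ≤ ((n + 2).centralBinom : ℝ) * p ^ (n + 2) * ((1 + r) ^ (n + 1 + 1) * (1 + r)) := by
          gcongr; linarith
        _ = _ := by ring
    by_contra hc
    nlinarith
  have hstep : ∀ n, 3 ≤ n ∧ l n ≠ 0 ∧ 1 / 2 ≤ E n →
      ∃ n', n < n' ∧ 3 ≤ n' ∧ l n' ≠ 0 ∧ 1 / 2 ≤ E n' := by
    rintro n ⟨hn, hln, hEn⟩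
    by_cases h0 : l (n + 1) = 0
    · refine ⟨n + 2, by omega, by omega, fun h4 => h.not_consecutive hD hk _ h0 h4, ?_⟩
      have h4 := skip n (by omega) h0
      have h5 := one_le n hln
      have h6 := hl' (n + 2)
      have h7 := hAnn n hn hEn
      nlinarith
    · refine ⟨n + 1, by omega, by omega, h0, ?_⟩
      linarith [hl' (n + 1), one_le _ h0, hAsucc n hn hEn]
  have hinf : ∀ m : ℕ, ∃ n, m ≤ n ∧ 3 ≤ n ∧ l n ≠ 0 ∧ 1 / 2 ≤ E n := by
    intro m
    induction m with
    | zero => obtain ⟨n, hn⟩ := hstart; exact ⟨n, by omega, hn⟩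
    | succ m ih =>
      obtain ⟨n, hmn, hn⟩ := ih
      obtain ⟨n', h5, h6⟩ := hstep n hn
      exact ⟨n', by omega, h6⟩
  have hcn : ∀ n, remConst n ≤ (27 / 4) ^ n := by
    intro n
    induction n with
    | zero => norm_num [remConst, remLead]
    | succ n ih => rw [pow_succ]; linarith [remConst_succ_le n]
  obtain ⟨m, hm⟩ := pow_unbounded_of_one_lt (R / (1 / 2 * (1 - r))) (by norm_num : (1 : ℝ) < 2)
  obtain ⟨n, hmn, -, -, hEn⟩ := hinf m
  have h5 := hEle n _ hEn
  have h6 : (2 : ℝ) ^ m ≤ 2 ^ n := pow_le_pow_right₀ (by norm_num) hmn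
  rw [div_lt_iff₀ (by positivity)] at hm
  have h7 : ((27 / 4) ^ n * d ^ n) * 2 ^ n ≤ p ^ n * (1 - r) ^ n := by
    rw [← mul_pow, ← mul_pow, ← mul_pow]
    refine pow_le_pow_left₀ (by positivity) ?_ n
    nlinarith
  have h8 : remConst n * d ^ n * R ≤ (27 / 4) ^ n * d ^ n * R := by gcongr; exact hcn n
  have h9 : (27 / 4 : ℝ) ^ n * d ^ n * R <
      (27 / 4 : ℝ) ^ n * d ^ n * (2 ^ n * (1 / 2 * (1 - r))) := by
    gcongr
    refine hm.trans_le ?_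
    gcongr
  have h10 : (27 / 4 : ℝ) ^ n * d ^ n * (2 ^ n * (1 / 2 * (1 - r))) ≤
      1 / 2 * (p ^ n * (1 - r) ^ (n + 1)) := by
    calc _ = ((27 / 4) ^ n * d ^ n) * 2 ^ n * (1 / 2 * (1 - r)) := by ring
      _ ≤ p ^ n * (1 - r) ^ n * (1 / 2 * (1 - r)) := by gcongr
      _ = _ := by ring
  linarith

set_option maxHeartbeats 1000000 in
/-- The first Padé approximant forces a strong gap between nearly parallel solutions. -/
theorem DiagPair.ratio_ge {D : ℤ} {δ : ℂ} {g : ℝ} {G k B : ℤ} {ξ₁ η₁ ξ₂ η₂ : ℂ}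
    (h : DiagPair D δ g G k B ξ₁ η₁ ξ₂ η₂) {γ : ℤ} (hγ : g = γ) (hγ' : γ = 1 ∨ 7 ≤ γ)
    (hk : k ≠ 0) {p R : ℝ} (hp : g * p = ‖ξ₁‖ ^ 3) (hp1 : 15 * |(D : ℝ)| ≤ p) (hp2 : 735 ≤ p)
    (hR : ‖ξ₂‖ = R * ‖ξ₁‖ ^ 2) : 39 / 100 * p ≤ R * |(D : ℝ)| := by
  have hD1 : 1 ≤ |(D : ℝ)| := by exact_mod_cast Int.one_le_abs h.disc_ne
  set d := |(D : ℝ)| with hd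
  have hp0 : 0 < p := by linarith
  have hg1 : 1 ≤ g := by
    rw [hγ]; rcases hγ' with rfl | h7
    · simp
    · exact_mod_cast (by omega : 1 ≤ γ)
  obtain ⟨r, hr0, hr⟩ : ∃ r : ℝ, 0 ≤ r ∧ r ^ 2 * p ^ 2 = 27 * d :=
    ⟨√(27 * d) / p, by positivity, by rw [div_pow, Real.sq_sqrt (by positivity)]; field_simp⟩
  have hr1 : r ≤ 1 / 20 := by
    by_contra hc
    have hc' : (1 / 20) ^ 2 < r ^ 2 := by gcongr; exact not_le.1 hc
    nlinarith
  obtain ⟨l, hl, hb⟩ := h.forms_bound hp hr0 hr hr1 hR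
  have hG : 27 * d < |(G : ℝ)| := by
    have := h.norm_cube hp hp0 hr0 hr
    nlinarith
  have hN := h.norm_pos
  set N := ‖ξ₁‖ with hNdef
  have hR0 : 0 < R := by
    have : 0 < R * N ^ 2 := by rw [← hR]; exact hN.trans_le h.norm_le
    exact (mul_pos_iff_of_pos_right (by positivity)).1 this
  have hN9 : 9 ≤ N := by
    by_contra hc
    have : N ^ 3 < 9 ^ 3 := by gcongr; exact not_le.1 hc
    rw [← hp] at this
    nlinarith
  have hRN : 1 ≤ R * N := by
    have h1 : N ≤ R * N ^ 2 := hR ▸ h.norm_le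
    have h2 : N * 1 ≤ N * (R * N) := by linarith
    exact le_of_mul_le_mul_left h2 hN
  have hRp : 9 ≤ R ^ 2 * (g * p) := by
    rw [hp]
    calc (9 : ℝ) ≤ N * (1 * 1) := by linarith
      _ ≤ N * ((R * N) * (R * N)) := by gcongr
      _ = _ := by ring
  have b0 := hb 0
  rw [hl.zero] at b0
  simp only [Nat.centralBinom_zero, pow_zero, remLead, zero_add, pow_one] at b0
  have hk0 : (1 : ℝ) ≤ |(k : ℝ)| := by exact_mod_cast Int.one_le_abs hk
  have t1 : ((1 : ℕ) : ℝ) * 1 * (1 + r) / (R ^ 2 * (g * p)) ≤ 0.117 := by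
    rw [div_le_iff₀ (by positivity)]; push_cast; nlinarith
  have t2 : 3 * (1 / 3) * 1 * R / (1 - r) ≤ R / 0.95 := by
    have : 3 * (1 / 3) * 1 * R = R := by ring
    rw [this]
    gcongr; linarith
  have hRk : (|(k : ℝ)| - 0.117) * 0.95 ≤ R := by
    have : |(k : ℝ)| - 0.117 ≤ R / 0.95 := by linarith
    rwa [le_div_iff₀ (by norm_num)] at this
  have b1 := hb 1
  rw [hl.one] at b1
  have hC : Nat.centralBinom 1 = 2 := by decide
  rw [hC] at b1
  have hE : 3 * remLead 1 * (27 * d / p) ^ 1 * R / (1 - r) ^ (1 + 1) ≤ 4.4322 * (R * d / p) := by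
    have e : 3 * remLead 1 * (27 * d / p) ^ 1 * R = 4 * (R * d / p) := by
      norm_num [remLead]; ring
    rw [e, div_le_iff₀ (pow_pos (by linarith) _)]
    have h1 : 0.9025 ≤ (1 - r) ^ (1 + 1) := by nlinarith
    have h2 : 0 ≤ R * d / p := by positivity
    nlinarith
  have hAle : ((2 : ℕ) : ℝ) * (p * (1 + r)) ^ 1 * (1 + r) / (R ^ 2 * (g * p)) ≤
      2.205 / (R ^ 2 * g) := by
    rw [div_le_div_iff₀ (by positivity) (by positivity)]
    have : (1 + r) ^ 2 ≤ 1.1025 := by nlinarith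
    calc _ = 2 * (1 + r) ^ 2 * (p * (R ^ 2 * g)) := by push_cast; ring
      _ ≤ 2 * 1.1025 * (p * (R ^ 2 * g)) := by gcongr
      _ = _ := by ring
  have hmain : |((G * k - B : ℤ) : ℝ)| ≤ 2.205 / (R ^ 2 * g) + 4.4322 * (R * d / p) := by linarith
  have hl2 : (2 : ℝ) ≤ |((G * k - B : ℤ) : ℝ)| := by
    have h0 := h.form_one_ne hγ hG
    obtain ⟨t, ht⟩ := h.two_dvd_form_one
    have ht0 : t ≠ 0 := by rintro rfl; exact h0 (by simpa using ht)
    have : 2 ≤ |G * k - B| := by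
      rw [ht, abs_mul]; have := Int.one_le_abs ht0; norm_num; omega
    exact_mod_cast this
  have hfirst : 0.863 ≤ 4.4322 * (R * d / p) := by
    by_cases hk1 : k = 1 ∨ k = -1
    · have hR1' : 0.8388 ≤ R := by linarith
      have hR1 : 0.703 ≤ R ^ 2 := by nlinarith
      rcases hγ' with h1 | h7
      · subst h1
        have hg : g = 1 := by simpa using hγ
        subst hg
        have h4 := h.form_one_ge_four hG hk1
        have : 2.205 / (R ^ 2 * 1) ≤ 3.137 := by
          rw [div_le_iff₀ (by positivity)]; linarith
        linarith
      · have hg7 : (7 : ℝ) ≤ g := by rw [hγ]; exact_mod_cast h7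
        have : 2.205 / (R ^ 2 * g) ≤ 1 := by
          rw [div_le_iff₀ (by positivity)]; nlinarith
        linarith
    · have hk2 : (2 : ℝ) ≤ |(k : ℝ)| := by
        have : 2 ≤ |k| := by
          by_contra hlt
          have := abs_lt.1 (not_le.1 hlt)
          omega
        exact_mod_cast this
      have hR2 : 1.788 ≤ R := by linarith
      have hR1 : 3.19 ≤ R ^ 2 := by nlinarith
      have : 2.205 / (R ^ 2 * g) ≤ 1 := by
        rw [div_le_iff₀ (by positivity)]; nlinarith
      linarith
  have hR3 : 2.89 ≤ R := by
    have h1 : 0.1947 ≤ R * d / p := by linarith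
    rw [le_div_iff₀ hp0] at h1
    have : 2.89 * d ≤ R * d := by linarith
    exact le_of_mul_le_mul_right this (by linarith)
  have hA3 : 2.205 / (R ^ 2 * g) ≤ 0.265 := by
    have h2 : 8.35 ≤ R ^ 2 := by nlinarith
    have h3 : R ^ 2 * 1 ≤ R ^ 2 * g := by gcongr
    rw [div_le_iff₀ (by positivity)]; linarith
  have h1 : 39 / 100 ≤ R * d / p := by linarith
  rwa [le_div_iff₀ hp0] at h1

/-- Two very large, nearly parallel solutions cannot coexist. -/
theorem DiagPair.absurd_of_large {D : ℤ} {δ : ℂ} {g : ℝ} {G k B : ℤ} {ξ₁ η₁ ξ₂ η₂ : ℂ}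
    (h : DiagPair D δ g G k B ξ₁ η₁ ξ₂ η₂) {γ : ℤ} (hγ : g = γ) (hγ' : γ = 1 ∨ 7 ≤ γ)
    (hk : k ≠ 0) {p : ℝ} (hp : g * p = ‖ξ₁‖ ^ 3) (hp1 : 1200 * |(D : ℝ)| ^ 2 ≤ p)
    (hp3 : 190 * |(D : ℝ)| ^ 3 ≤ p) (hp2 : 1500000 * |(D : ℝ)| ^ 5 ≤ p ^ 2) : False := by
  have hD1 : 1 ≤ |(D : ℝ)| := by exact_mod_cast Int.one_le_abs h.disc_ne
  have hN := h.norm_pos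
  have hR : ‖ξ₂‖ = (‖ξ₂‖ / ‖ξ₁‖ ^ 2) * ‖ξ₁‖ ^ 2 := by field_simp
  have hratio := h.ratio_ge hγ hγ' hk hp (by nlinarith) (by nlinarith) hR
  set R := ‖ξ₂‖ / ‖ξ₁‖ ^ 2
  have hg1 : 1 ≤ g := by
    rw [hγ]; rcases hγ' with rfl | h7
    · simp
    · exact_mod_cast (by omega : 1 ≤ γ)
  set d := |(D : ℝ)| with hd
  have hp0 : 0 < p := by nlinarith
  obtain ⟨r, hr0, hr⟩ : ∃ r : ℝ, 0 ≤ r ∧ r ^ 2 * p ^ 2 = 27 * d :=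
    ⟨√(27 * d) / p, by positivity, by rw [div_pow, Real.sq_sqrt (by positivity)]; field_simp⟩
  have hr1 : r ≤ 435 / 100000 := by
    by_contra hc
    have hc' : (435 / 100000) ^ 2 < r ^ 2 := by gcongr; exact not_le.1 hc
    have h3 : 1440000 * d ≤ p ^ 2 := by
      have : (1200 * d ^ 2) ^ 2 ≤ p ^ 2 := by gcongr
      nlinarith [one_le_pow₀ hD1 (n := 3)]
    nlinarith
  obtain ⟨l, hl, hb⟩ := h.forms_bound hp hr0 hr (by linarith) hR
  have hG : 1200 * (D : ℝ) ^ 2 ≤ |(G : ℝ)| := by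
    have := h.norm_cube hp hp0 hr0 hr
    have h2 : (D : ℝ) ^ 2 = d ^ 2 := (sq_abs _).symm
    rw [h2]
    nlinarith
  have hne := h.form_two_ne hγ hG
  have h2 : l 2 * 2 = 3 * (G * (G * k - B) + 8 * D * k) := by
    have := hl.step 0
    rw [zero_add, hl.one, hl.zero] at this
    push_cast at this
    linarith
  refine hl.absurd_of_bound h.disc_ne hk (fun h0 => ?_) ?_ hd hr0 hr1 hp1 hp3 hp2 hratio
    (fun n => (hb n).trans ?_)
  · rw [h0] at h2; exact hne (by linarith)
  · omega
  · have hR0 : 0 ≤ R := by positivity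
    gcongr
    all_goals first | positivity | nlinarith

/-- The value of the binary cubic form at `(x, y)`. -/
def cubicEval (a b c d x y : ℤ) : ℤ := a * x ^ 3 + b * x ^ 2 * y + c * x * y ^ 2 + d * y ^ 3

/-- The Hessian covariant of a binary cubic form, in polarised form. -/
def cubicPolar (a b c d x y z w : ℤ) : ℤ :=
  2 * (b ^ 2 - 3 * a * c) * x * z + (b * c - 9 * a * d) * (x * w + y * z) +
    2 * (c ^ 2 - 3 * b * d) * y * w

/-- The Hessian covariant of a binary cubic form. -/
def cubicHess (a b c d x y : ℤ) : ℤ :=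
  (b ^ 2 - 3 * a * c) * x ^ 2 + (b * c - 9 * a * d) * x * y + (c ^ 2 - 3 * b * d) * y ^ 2

/-- The cubic covariant of a binary cubic form. -/
def cubicCov (a b c d x y : ℤ) : ℤ :=
  (9 * a * b * c - 27 * a ^ 2 * d - 2 * b ^ 3) * x ^ 3 +
    (18 * a * c ^ 2 - 3 * b ^ 2 * c - 27 * a * b * d) * x ^ 2 * y +
    (3 * b * c ^ 2 + 27 * a * c * d - 18 * b ^ 2 * d) * x * y ^ 2 +
    (2 * c ^ 3 + 27 * a * d ^ 2 - 9 * b * c * d) * y ^ 3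

theorem two_dvd_cubicCov_sub (a b c d x y : ℤ) :
    2 ∣ cubicCov a b c d x y - cubicDisc a b c d * cubicEval a b c d x y := by
  refine (ZMod.intCast_zmod_eq_zero_iff_dvd _ 2).1 ?_
  have : ∀ a b c d x y : ZMod 2,
      ((9 * a * b * c - 27 * a ^ 2 * d - 2 * b ^ 3) * x ^ 3 +
    (18 * a * c ^ 2 - 3 * b ^ 2 * c - 27 * a * b * d) * x ^ 2 * y +
    (3 * b * c ^ 2 + 27 * a * c * d - 18 * b ^ 2 * d) * x * y ^ 2 +
    (2 * c ^ 3 + 27 * a * d ^ 2 - 9 * b * c * d) * y ^ 3) -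
    (18 * a * b * c * d + b ^ 2 * c ^ 2 - 4 * a * c ^ 3 - 4 * b ^ 3 * d - 27 * a ^ 2 * d ^ 2) *
    (a * x ^ 3 + b * x ^ 2 * y + c * x * y ^ 2 + d * y ^ 3) = 0 := by decide
  simp only [cubicCov, cubicDisc, cubicEval]
  push_cast
  exact this _ _ _ _ _ _

theorem two_dvd_cubicPolar_sub (a b c d x y z w : ℤ) :
    2 ∣ cubicPolar a b c d x y z w - cubicDisc a b c d * (x * w - y * z) := by
  refine (ZMod.intCast_zmod_eq_zero_iff_dvd _ 2).1 ?_
  have : ∀ a b c d s t : ZMod 2,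
      ((b * c - 9 * a * d) * (s + t)) -
    (18 * a * b * c * d + b ^ 2 * c ^ 2 - 4 * a * c ^ 3 - 4 * b ^ 3 * d - 27 * a ^ 2 * d ^ 2) *
    (s - t) = 0 := by decide
  simp only [cubicPolar, cubicDisc]
  push_cast
  have h2 : (2 : ZMod 2) = 0 := rfl
  rw [← this a b c d (x * w) (y * z)]
  linear_combination ((b ^ 2 - 3 * a * c) * x * z + (c ^ 2 - 3 * b * d) * y * w) * h2

theorem four_dvd_cubicDisc (a b c d : ℤ) : 4 ∣ cubicDisc a b c d * (cubicDisc a b c d + 3) := by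
  have : ∀ a b c d : ZMod 4,
    (18 * a * b * c * d + b ^ 2 * c ^ 2 - 4 * a * c ^ 3 - 4 * b ^ 3 * d - 27 * a ^ 2 * d ^ 2) *
    ((18 * a * b * c * d + b ^ 2 * c ^ 2 - 4 * a * c ^ 3 - 4 * b ^ 3 * d - 27 * a ^ 2 * d ^ 2) +
    3) = 0 := by decide
  refine (ZMod.intCast_zmod_eq_zero_iff_dvd _ 4).1 ?_
  simp only [cubicDisc]
  push_cast
  exact this _ _ _ _

theorem cubicPolar_sq (a b c d x y z w : ℤ) :
    cubicPolar a b c d x y z w ^ 2 + 3 * cubicDisc a b c d * (x * w - y * z) ^ 2 =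
      4 * cubicHess a b c d x y * cubicHess a b c d z w := by
  simp only [cubicPolar, cubicDisc, cubicHess]; ring

theorem cubicCov_sq (a b c d x y : ℤ) :
    cubicCov a b c d x y ^ 2 + 27 * cubicDisc a b c d * cubicEval a b c d x y ^ 2 =
      4 * cubicHess a b c d x y ^ 3 := by
  simp only [cubicCov, cubicDisc, cubicHess, cubicEval]; ring

/-- A pair of conjugate linear forms whose cubes diagonalise a binary cubic form. -/
structure Resolvent (a b c d : ℤ) (δ α β α' β' : ℂ) : Prop where
  sq_delta : δ ^ 2 = -3 * cubicDisc a b c d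
  delta : α * β' - α' * β = δ
  hess : ∀ x y : ℤ, (α * x + β * y) * (α' * x + β' * y) = cubicHess a b c d x y
  form : ∀ x y : ℤ, (α * x + β * y) ^ 3 - (α' * x + β' * y) ^ 3 = 3 * δ * cubicEval a b c d x y
  cov : ∀ x y : ℤ, (α * x + β * y) ^ 3 + (α' * x + β' * y) ^ 3 = cubicCov a b c d x y

theorem Resolvent.polar {a b c d : ℤ} {δ α β α' β' : ℂ} (h : Resolvent a b c d δ α β α' β')
    (x y z w : ℤ) : (α * x + β * y) * (α' * z + β' * w) + (α * z + β * w) * (α' * x + β' * y) =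
      cubicPolar a b c d x y z w := by
  have h1 := h.hess (x + z) (y + w)
  have h2 := h.hess x y
  have h3 := h.hess z w
  simp only [cubicPolar, cubicHess] at *
  push_cast at *
  linear_combination h1 - h2 - h3

theorem resolvent_cube {b c d : ℤ} {δ α m : ℂ} (hA : (b ^ 2 - 3 * c : ℂ) ≠ 0)
    (hδ : δ ^ 2 = -3 * cubicDisc 1 b c d)
    (hu : α ^ 3 = ((9 * b * c - 27 * d - 2 * b ^ 3) + 3 * δ) / 2)
    (hm : 2 * (b ^ 2 - 3 * c : ℂ) * m = b * c - 9 * d - δ) (x y : ℤ) :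
    (α * x + m * α * y) ^ 3 =
      (cubicCov 1 b c d x y + 3 * δ * cubicEval 1 b c d x y) / 2 := by
  have e0 : (α * x + m * α * y) ^ 3 = α ^ 3 * (x + m * y) ^ 3 := by ring
  rw [e0, hu]
  have hA2 : (2 * (b ^ 2 - 3 * c : ℂ)) ^ 3 ≠ 0 := pow_ne_zero _ (by simpa using hA)
  refine mul_left_cancel₀ hA2 ?_
  have e : (2 * (b ^ 2 - 3 * c : ℂ)) ^ 3 * ((9 * b * c - 27 * d - 2 * b ^ 3 + 3 * δ) / 2 *
    (x + m * y) ^ 3) = (9 * b * c - 27 * d - 2 * b ^ 3 + 3 * δ) / 2 *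
    (2 * (b ^ 2 - 3 * c) * x + (2 * (b ^ 2 - 3 * c : ℂ) * m) * y) ^ 3 := by ring
  rw [e, hm]
  simp only [cubicDisc] at hδ
  simp only [cubicCov, cubicEval]
  push_cast at *
  linear_combination (-3 / 2 * y ^ 3 * δ ^ 2 +
    1 / 2 * (9 * (2 * (b ^ 2 - 3 * c) * x + (b * c - 9 * d) * y) * y ^ 2 -
      (9 * b * c - 27 * d - 2 * b ^ 3) * y ^ 3) * δ +
    1 / 2 * (3 * (9 * b * c - 27 * d - 2 * b ^ 3) *
      (2 * (b ^ 2 - 3 * c) * x + (b * c - 9 * d) * y) * y ^ 2 -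
      9 * (2 * (b ^ 2 - 3 * c) * x + (b * c - 9 * d) * y) ^ 2 * y) +
    9 / 2 * (18 * b * c * d + b ^ 2 * c ^ 2 - 4 * c ^ 3 - 4 * b ^ 3 * d - 27 * d ^ 2) *
      y ^ 3) * hδ

theorem Resolvent.of_monic {b c d : ℤ} {δ α α' : ℂ} (hA : b ^ 2 - 3 * c ≠ 0)
    (hδ : δ ^ 2 = -3 * cubicDisc 1 b c d) (hm : α * α' = (b ^ 2 - 3 * c : ℤ))
    (hf : α ^ 3 - α' ^ 3 = 3 * δ) (hg : α ^ 3 + α' ^ 3 = (9 * b * c - 27 * d - 2 * b ^ 3 : ℤ)) :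
    Resolvent 1 b c d δ α ((b * c - 9 * d - δ) / (2 * (b ^ 2 - 3 * c : ℤ)) * α) α'
      ((b * c - 9 * d + δ) / (2 * (b ^ 2 - 3 * c : ℤ)) * α') := by
  have hA' : ((b ^ 2 - 3 * c : ℤ) : ℂ) ≠ 0 := by exact_mod_cast hA
  obtain ⟨m, hm1, hm2⟩ : ∃ m : ℂ, m = (b * c - 9 * d - δ) / (2 * (b ^ 2 - 3 * c : ℤ)) ∧
    2 * (b ^ 2 - 3 * c) * m = (b * c - 9 * d - δ) := ⟨_, rfl, by push_cast at *; field_simp⟩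
  obtain ⟨n, hn1, hn2⟩ : ∃ m : ℂ, m = (b * c - 9 * d + δ) / (2 * (b ^ 2 - 3 * c : ℤ)) ∧
    2 * (b ^ 2 - 3 * c) * m = (b * c - 9 * d + δ) := ⟨_, rfl, by push_cast at *; field_simp⟩
  rw [← hm1, ← hn1]
  have hu : α ^ 3 = ((9 * b * c - 27 * d - 2 * b ^ 3) + 3 * δ) / 2 := by
    push_cast at hg; linear_combination (hf + hg) / 2
  have hv : α' ^ 3 = ((9 * b * c - 27 * d - 2 * b ^ 3) - 3 * δ) / 2 := by
    push_cast at hg; linear_combination (hg - hf) / 2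
  have hsum : (b ^ 2 - 3 * c : ℂ) * (m + n) = b * c - 9 * d := by linear_combination (hm2 + hn2) / 2
  have hdif : (b ^ 2 - 3 * c : ℂ) * (n - m) = δ := by linear_combination (hn2 - hm2) / 2
  have hA2 : (b ^ 2 - 3 * c : ℂ) ≠ 0 := by push_cast at hA'; exact hA'
  simp only [cubicDisc] at hδ
  push_cast at hδ hm
  have hmn : (b ^ 2 - 3 * c : ℂ) * (m * n) = c ^ 2 - 3 * b * d := by
    have : (4 * (b ^ 2 - 3 * c : ℂ)) * ((b ^ 2 - 3 * c) * (m * n) - (c ^ 2 - 3 * b * d)) = 0 := by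
      linear_combination (2 * (b ^ 2 - 3 * c : ℂ) * n) * hm2 + (b * c - 9 * d - δ) * hn2 - hδ
    linear_combination (mul_eq_zero.1 this).resolve_left (by simpa using hA2)
  have c1 := resolvent_cube hA2 (by simp only [cubicDisc]; push_cast; exact hδ) hu hm2
  have c2 := resolvent_cube (δ := -δ) hA2
    (by simp only [cubicDisc]; push_cast; rw [neg_sq]; exact hδ)
    (hv.trans (by ring)) (hn2.trans (by ring))
  refine ⟨by simp only [cubicDisc]; push_cast; exact hδ, ?_, fun x y => ?_, fun x y => ?_,
    fun x y => ?_⟩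
  · linear_combination hdif + (n - m) * hm
  · simp only [cubicHess]
    push_cast
    linear_combination (x + m * y) * (x + n * y) * hm + x * y * hsum + y ^ 2 * hmn
  · linear_combination c1 x y - c2 x y
  · linear_combination c1 x y + c2 x y

theorem Resolvent.diagPair {a b c d : ℤ} {δ α β α' β' : ℂ} (h : Resolvent a b c d δ α β α' β')
    {γ D : ℤ} (hγ : 0 < γ) (hodd : Odd γ) (hD : cubicDisc a b c d = γ ^ 2 * D) (hD0 : D ≠ 0)
    (hmod : 4 ∣ D * (D + 3)) {x y z w : ℤ} (hG : γ ∣ cubicCov a b c d x y)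
    (hB : γ ∣ cubicPolar a b c d x y z w)
    (h1 : cubicEval a b c d x y = 1) (h2 : cubicEval a b c d z w = 1)
    (hn1 : ‖(α * x + β * y) - (α' * x + β' * y)‖ ≤ 1 / 2 * ‖α * x + β * y‖)
    (hn2 : ‖(α * z + β * w) - (α' * z + β' * w)‖ ≤ 1 / 2 * ‖α * z + β * w‖)
    (hle : ‖α * x + β * y‖ ≤ ‖α * z + β * w‖) :
    DiagPair D (δ / γ) γ (cubicCov a b c d x y / γ) (x * w - y * z)
      (cubicPolar a b c d x y z w / γ) (α * x + β * y) (α' * x + β' * y)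
      (α * z + β * w) (α' * z + β' * w) := by
  obtain ⟨G, hG⟩ := hG
  obtain ⟨B, hB⟩ := hB
  rw [hG, hB, Int.mul_ediv_cancel_left _ hγ.ne', Int.mul_ediv_cancel_left _ hγ.ne']
  have hγ0 : (γ : ℂ) ≠ 0 := by exact_mod_cast hγ.ne'
  have hγδ : (γ : ℂ) * (δ / γ) = δ := mul_div_cancel₀ _ hγ0
  have hco : IsCoprime (2 : ℤ) γ := by
    rw [Int.isCoprime_iff_gcd_eq_one, Int.gcd_comm]
    exact Int.isCoprime_iff_gcd_eq_one.1 (Int.isCoprime_two_right.2 hodd)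
  have hf1 := h.form x y
  have hf2 := h.form z w
  have hc1 := h.cov x y
  have hp := h.polar x y z w
  rw [h1] at hf1
  rw [h2] at hf2
  rw [hG] at hc1
  rw [hB] at hp
  obtain ⟨t, ht⟩ := hodd
  have hdet : (α * x + β * y) * (α' * z + β' * w) - (α * z + β * w) * (α' * x + β' * y) =
      δ * (x * w - y * z) := by
    linear_combination (x * w - y * z : ℂ) * h.delta
  push_cast at *
  have hsq := h.sq_delta
  rw [hD] at hsq
  push_cast at hsq
  refine ⟨?_, hD0, hmod, by exact_mod_cast hγ, ?_, ?_, ?_, ?_, ?_, ?_, ?_, hn1, hn2, ?_, hle⟩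
  · rw [div_pow, hsq]; field_simp
  · refine hco.dvd_of_dvd_mul_left (y := γ) ?_
    have := two_dvd_cubicCov_sub a b c d x y
    rw [h1, hG, hD] at this
    have e : γ * (G - D) = (γ * G - γ ^ 2 * D * 1) + 2 * (t * γ * D) := by rw [ht]; ring
    rw [e]
    exact dvd_add this (dvd_mul_right _ _)
  · refine hco.dvd_of_dvd_mul_left (y := γ) ?_
    have := two_dvd_cubicPolar_sub a b c d x y z w
    rw [hB, hD] at this
    have e : γ * (B - D * (x * w - y * z)) = (γ * B - γ ^ 2 * D * (x * w - y * z)) +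
      2 * (t * γ * D * (x * w - y * z)) := by rw [ht]; ring
    rw [e]
    exact dvd_add this (dvd_mul_right _ _)
  · push_cast; linear_combination (hf1 + hc1) / 2 - 3 / 2 * hγδ
  · push_cast; linear_combination (hc1 - hf1) / 2 + 3 / 2 * hγδ
  · push_cast; linear_combination hf2 - 3 * hγδ
  · push_cast; linear_combination (hp + hdet) / 2 - (x * w - y * z : ℂ) / 2 * hγδ
  · push_cast; linear_combination (hp - hdet) / 2 + (x * w - y * z : ℂ) / 2 * hγδ
  · rw [norm_pos_iff]
    intro h0
    rw [h0] at hn1 hf1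
    simp only [norm_zero, mul_zero, zero_sub, norm_neg, norm_le_zero_iff] at hn1
    rw [hn1] at hf1
    have hδ : δ = 0 := by linear_combination -hf1 / 3
    have : (γ : ℂ) ^ 2 * D = 0 := by rw [hδ] at hsq; linear_combination hsq / 3
    rcases mul_eq_zero.1 this with h3 | h3
    · exact hγ0 (pow_eq_zero_iff two_ne_zero |>.1 h3)
    · exact hD0 (by exact_mod_cast h3)

theorem Resolvent.norm_sq {a b c d : ℤ} {δ α β : ℂ}
    (h : Resolvent a b c d δ α β (starRingEnd ℂ α) (starRingEnd ℂ β)) (x y : ℤ) :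
    ‖α * x + β * y‖ ^ 2 = cubicHess a b c d x y := by
  have h1 := h.hess x y
  have h2 : starRingEnd ℂ α * x + starRingEnd ℂ β * y = starRingEnd ℂ (α * x + β * y) := by
    simp
  rw [h2, Complex.mul_conj, Complex.normSq_eq_norm_sq] at h1
  exact_mod_cast h1

theorem exists_resolvent_of_disc_pos {b c d : ℤ} (hD : 0 < cubicDisc 1 b c d) :
    ∃ α β : ℂ, Resolvent 1 b c d (Complex.I * (√(3 * cubicDisc 1 b c d) : ℝ)) α β
      (starRingEnd ℂ α) (starRingEnd ℂ β) := by
  have hcov := cubicCov_sq 1 b c d 1 0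
  have hpol := cubicPolar_sq 1 b c d 1 0 0 1
  have hA : b ^ 2 - 3 * c ≠ 0 := by
    intro h0
    simp only [cubicPolar, cubicHess] at hpol
    have : (b * c - 9 * d) ^ 2 + 3 * cubicDisc 1 b c d = 0 := by
      linear_combination hpol + 4 * (c ^ 2 - 3 * b * d) * h0
    nlinarith [sq_nonneg (b * c - 9 * d)]
  have hD0 : (0 : ℝ) ≤ 3 * cubicDisc 1 b c d := by
    have : (0 : ℝ) < cubicDisc 1 b c d := by exact_mod_cast hD
    linarith
  set s : ℝ := √(3 * cubicDisc 1 b c d) with hs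
  have hss : (s : ℂ) ^ 2 = 3 * cubicDisc 1 b c d := by
    have := Real.sq_sqrt hD0
    rw [← hs] at this
    exact_mod_cast this
  obtain ⟨α, hα⟩ := IsAlgClosed.exists_pow_nat_eq
    (((9 * b * c - 27 * d - 2 * b ^ 3 : ℤ) + 3 * (Complex.I * s)) / 2 : ℂ) (n := 3) (by norm_num)
  have hα' : (starRingEnd ℂ α) ^ 3 =
      ((9 * b * c - 27 * d - 2 * b ^ 3 : ℤ) - 3 * (Complex.I * s)) / 2 := by
    rw [← map_pow, hα]
    simp [map_ofNat (starRingEnd ℂ)]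
    ring
  have hδ : (Complex.I * s) ^ 2 = -3 * (cubicDisc 1 b c d : ℂ) := by
    rw [mul_pow, Complex.I_sq, hss]; ring
  have hG : ((9 * b * c - 27 * d - 2 * b ^ 3 : ℤ) : ℂ) ^ 2 + 27 * cubicDisc 1 b c d =
      4 * ((b ^ 2 - 3 * c : ℤ) : ℂ) ^ 3 := by
    have e1 : cubicCov 1 b c d 1 0 = 9 * b * c - 27 * d - 2 * b ^ 3 := by
      simp only [cubicCov]; ring
    have e2 : cubicHess 1 b c d 1 0 = b ^ 2 - 3 * c := by simp only [cubicHess]; ring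
    have e3 : cubicEval 1 b c d 1 0 = 1 := by simp only [cubicEval]; ring
    rw [e1, e2, e3] at hcov
    have := congrArg (Int.cast : ℤ → ℂ) hcov
    push_cast at this ⊢
    linear_combination this
  have hm : α * starRingEnd ℂ α = (b ^ 2 - 3 * c : ℤ) := by
    have h3 : (α * starRingEnd ℂ α) ^ 3 = ((b ^ 2 - 3 * c : ℤ) : ℂ) ^ 3 := by
      rw [mul_pow, hα, hα']
      linear_combination hG / 4 - 9 / 4 * hδ
    rw [Complex.mul_conj] at h3 ⊢
    have h4 : Complex.normSq α ^ 3 = ((b ^ 2 - 3 * c : ℤ) : ℝ) ^ 3 := by exact_mod_cast h3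
    have h5 := (Odd.strictMono_pow (by decide : Odd 3)).injective h4
    rw [h5]; simp
  refine ⟨α, ((b * c - 9 * d - Complex.I * s) / (2 * (b ^ 2 - 3 * c : ℤ)) * α), ?_⟩
  have hβ : starRingEnd ℂ ((b * c - 9 * d - Complex.I * s) / (2 * (b ^ 2 - 3 * c : ℤ)) * α) =
      (b * c - 9 * d + Complex.I * s) / (2 * (b ^ 2 - 3 * c : ℤ)) * starRingEnd ℂ α := by
    simp [map_ofNat (starRingEnd ℂ)]
  rw [hβ]
  exact Resolvent.of_monic hA hδ hm (by rw [hα, hα']; ring) (by rw [hα, hα']; ring)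

theorem exists_resolvent_of_disc_neg {b c d : ℤ} (hD : cubicDisc 1 b c d < 0)
    (hA : b ^ 2 - 3 * c ≠ 0) : ∃ α β α' β' : ℝ,
      Resolvent 1 b c d (√(-3 * cubicDisc 1 b c d) : ℝ) α β α' β' := by
  have hcov := cubicCov_sq 1 b c d 1 0
  have hD0 : (0 : ℝ) ≤ -3 * cubicDisc 1 b c d := by
    have : (cubicDisc 1 b c d : ℝ) < 0 := by exact_mod_cast hD
    linarith
  have hodd : ∀ r : ℝ, ∃ t : ℝ, t ^ 3 = r := by
    intro r
    rcases le_total 0 r with h | h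
    · exact ⟨r ^ ((1 : ℝ) / 3), by rw [← Real.rpow_natCast, ← Real.rpow_mul h]; norm_num⟩
    · refine ⟨-(-r) ^ ((1 : ℝ) / 3), ?_⟩
      rw [Odd.neg_pow (by decide), ← Real.rpow_natCast, ← Real.rpow_mul (by linarith)]
      norm_num
  set s : ℝ := √(-3 * cubicDisc 1 b c d) with hs
  have hδ : s ^ 2 = -3 * (cubicDisc 1 b c d : ℝ) := Real.sq_sqrt hD0
  obtain ⟨α, hα⟩ := hodd (((9 * b * c - 27 * d - 2 * b ^ 3 : ℤ) + 3 * s) / 2)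
  obtain ⟨α', hα'⟩ := hodd (((9 * b * c - 27 * d - 2 * b ^ 3 : ℤ) - 3 * s) / 2)
  have hG : ((9 * b * c - 27 * d - 2 * b ^ 3 : ℤ) : ℝ) ^ 2 + 27 * cubicDisc 1 b c d =
      4 * ((b ^ 2 - 3 * c : ℤ) : ℝ) ^ 3 := by
    have e1 : cubicCov 1 b c d 1 0 = 9 * b * c - 27 * d - 2 * b ^ 3 := by
      simp only [cubicCov]; ring
    have e2 : cubicHess 1 b c d 1 0 = b ^ 2 - 3 * c := by simp only [cubicHess]; ring
    have e3 : cubicEval 1 b c d 1 0 = 1 := by simp only [cubicEval]; ring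
    rw [e1, e2, e3] at hcov
    have := congrArg (Int.cast : ℤ → ℝ) hcov
    push_cast at this ⊢
    linear_combination this
  have hm : α * α' = (b ^ 2 - 3 * c : ℤ) := by
    have h3 : (α * α') ^ 3 = ((b ^ 2 - 3 * c : ℤ) : ℝ) ^ 3 := by
      rw [mul_pow, hα, hα']
      linear_combination hG / 4 - 9 / 4 * hδ
    exact (Odd.strictMono_pow (by decide : Odd 3)).injective h3
  have key := Resolvent.of_monic (δ := s) (α := α) (α' := α') hA (by exact_mod_cast hδ)
    (by exact_mod_cast hm)
    (by have : α ^ 3 - α' ^ 3 = 3 * s := by rw [hα, hα']; ring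
        exact_mod_cast this)
    (by have : α ^ 3 + α' ^ 3 = (9 * b * c - 27 * d - 2 * b ^ 3 : ℤ) := by rw [hα, hα']; ring
        exact_mod_cast this)
  refine ⟨α, (b * c - 9 * d - s) / (2 * (b ^ 2 - 3 * c : ℤ)) * α, α',
    (b * c - 9 * d + s) / (2 * (b ^ 2 - 3 * c : ℤ)) * α', ?_⟩
  push_cast at key ⊢
  exact key

/-- The solutions of the cubic Thue equation `f(x, y) = 1`. -/
def thueSolutions (a b c d : ℤ) : Set (ℤ × ℤ) := {v | cubicEval a b c d v.1 v.2 = 1}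

/-- The coefficient of `x²y` after a linear change of variables. -/
def cubicSnd (a b c d p q r t : ℤ) : ℤ :=
  3 * a * p ^ 2 * q + b * (p ^ 2 * t + 2 * p * q * r) + c * (r ^ 2 * q + 2 * p * r * t) +
    3 * d * r ^ 2 * t

/-- The coefficient of `xy²` after a linear change of variables. -/
def cubicTrd (a b c d p q r t : ℤ) : ℤ :=
  3 * a * p * q ^ 2 + b * (q ^ 2 * r + 2 * p * q * t) + c * (t ^ 2 * p + 2 * q * r * t) +
    3 * d * r * t ^ 2

theorem cubicEval_comp (a b c d p q r t x y : ℤ) :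
    cubicEval (cubicEval a b c d p r) (cubicSnd a b c d p q r t) (cubicTrd a b c d p q r t)
      (cubicEval a b c d q t) x y = cubicEval a b c d (p * x + q * y) (r * x + t * y) := by
  simp only [cubicEval, cubicSnd, cubicTrd]; ring

theorem cubicDisc_comp (a b c d p q r t : ℤ) :
    cubicDisc (cubicEval a b c d p r) (cubicSnd a b c d p q r t) (cubicTrd a b c d p q r t)
      (cubicEval a b c d q t) = (p * t - q * r) ^ 6 * cubicDisc a b c d := by
  simp only [cubicDisc, cubicEval, cubicSnd, cubicTrd]; ring

theorem cubicHess_comp (a b c d p q r t x y : ℤ) :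
    cubicHess (cubicEval a b c d p r) (cubicSnd a b c d p q r t) (cubicTrd a b c d p q r t)
      (cubicEval a b c d q t) x y =
      (p * t - q * r) ^ 2 * cubicHess a b c d (p * x + q * y) (r * x + t * y) := by
  simp only [cubicHess, cubicEval, cubicSnd, cubicTrd]; ring

theorem encard_thueSolutions_le (a b c d : ℤ) {p q r t : ℤ} (hdet : (p * t - q * r) ^ 2 = 1) :
    (thueSolutions a b c d).encard ≤ (thueSolutions (cubicEval a b c d p r)
      (cubicSnd a b c d p q r t) (cubicTrd a b c d p q r t) (cubicEval a b c d q t)).encard := by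
  have key : ∀ x y : ℤ, p * ((p * t - q * r) * (t * x - q * y)) +
      q * ((p * t - q * r) * (p * y - r * x)) = x ∧
      r * ((p * t - q * r) * (t * x - q * y)) + t * ((p * t - q * r) * (p * y - r * x)) = y :=
    fun x y => ⟨by linear_combination x * hdet, by linear_combination y * hdet⟩
  refine Set.encard_le_encard_of_injOn
    (f := fun v => ((p * t - q * r) * (t * v.1 - q * v.2), (p * t - q * r) * (p * v.2 - r * v.1)))
    ?_ ?_
  · rintro ⟨x, y⟩ hv
    simp only [thueSolutions, Set.mem_ofPred_eq] at hv ⊢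
    rw [cubicEval_comp, (key x y).1, (key x y).2, hv]
  · rintro ⟨x, y⟩ - ⟨z, w⟩ - h
    simp only [Prod.mk.injEq] at h
    have h1 := key x y
    have h2 := key z w
    rw [h.1, h.2] at h1
    rw [Prod.mk.injEq, ← h1.1, ← h1.2]
    exact h2

/-- A form representing `1` may be taken to be monic. -/
theorem encard_le_of_monic {a b c d : ℤ} {n : ℕ∞}
    {x y : ℤ} (h : cubicEval a b c d x y = 1)
    (H : ∀ b' c' d', cubicDisc 1 b' c' d' = cubicDisc a b c d →
      b' ^ 2 - 3 * c' = cubicHess a b c d x y →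
      ((∃ u v : ℤ, (u ≠ 0 ∨ v ≠ 0) ∧ cubicEval 1 b' c' d' u v = 0) →
        ∃ u v : ℤ, (u ≠ 0 ∨ v ≠ 0) ∧ cubicEval a b c d u v = 0) →
      (thueSolutions 1 b' c' d').encard ≤ n) : (thueSolutions a b c d).encard ≤ n := by
  have hco : IsCoprime x y := by
    rw [Int.isCoprime_iff_gcd_eq_one]
    have h1 : ((Int.gcd x y : ℕ) : ℤ) ∣ 1 := by
      rw [← h]
      have hx := Int.gcd_dvd_left x y
      have hy := Int.gcd_dvd_right x y
      obtain ⟨u, hu⟩ := hx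
      obtain ⟨v, hv⟩ := hy
      exact ⟨cubicEval a b c d x y * 0 + u * (a * x ^ 2 + b * x * y + c * y ^ 2) +
        v * (d * y ^ 2), by
        simp only [cubicEval]
        linear_combination (a * x ^ 2 + b * x * y + c * y ^ 2) * hu + d * y ^ 2 * hv⟩
    exact Nat.dvd_one.1 (by exact_mod_cast h1)
  obtain ⟨t, q, htq⟩ := hco
  have hdet : (x * t - (-q) * y) = 1 := by linarith
  have h1 := cubicDisc_comp a b c d x (-q) y t
  have h2 := cubicHess_comp a b c d x (-q) y t 1 0
  rw [hdet, h] at h1 h2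
  refine (encard_thueSolutions_le a b c d (p := x) (q := -q) (r := y) (t := t)
    (by rw [hdet]; norm_num)).trans ?_
  rw [h]
  refine H _ _ _ (by linarith) ?_ ?_
  · simp only [mul_one, mul_zero, add_zero, one_pow, one_mul] at h2
    rw [← h2]; simp only [cubicHess]; ring
  · rintro ⟨u, v, huv, h0⟩
    have h3 := cubicEval_comp a b c d x (-q) y t u v
    rw [h, h0] at h3
    refine ⟨_, _, ?_, h3.symm⟩
    by_contra hc
    push Not at hc
    have hu : u = 0 := by linear_combination (-u) * hdet + t * hc.1 - (-q) * hc.2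
    have hv : v = 0 := by linear_combination (-v) * hdet - y * hc.1 + x * hc.2
    omega

/-- A binary cubic form is isotropic if it has a nontrivial integral zero. -/
def CubicIsotropic (a b c d : ℤ) : Prop :=
  ∃ u v : ℤ, (u ≠ 0 ∨ v ≠ 0) ∧ cubicEval a b c d u v = 0

theorem CubicIsotropic.of_comp {a b c d p q r t : ℤ} (hdet : (p * t - q * r) ^ 2 = 1)
    (h : CubicIsotropic (cubicEval a b c d p r) (cubicSnd a b c d p q r t)
      (cubicTrd a b c d p q r t) (cubicEval a b c d q t)) : CubicIsotropic a b c d := by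
  obtain ⟨u, v, huv, h0⟩ := h
  rw [cubicEval_comp] at h0
  refine ⟨_, _, ?_, h0⟩
  by_contra hc
  push Not at hc
  have hu : u = 0 := by
    linear_combination (-u) * hdet + (p * t - q * r) * (t * hc.1 - q * hc.2)
  have hv : v = 0 := by
    linear_combination (-v) * hdet + (p * t - q * r) * (p * hc.2 - r * hc.1)
  omega

theorem exists_primitive {u v : ℤ} (h : u ≠ 0 ∨ v ≠ 0) :
    ∃ g p r q t : ℤ, g ≠ 0 ∧ u = g * p ∧ v = g * r ∧ p * t - q * r = 1 := by
  have hg : 0 < Int.gcd u v := Int.gcd_pos_iff.2 h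
  obtain ⟨p, r, hco, hu, hv⟩ := Int.exists_gcd_one hg
  obtain ⟨t, q, htq⟩ := Int.isCoprime_iff_gcd_eq_one.2 hco
  exact ⟨Int.gcd u v, p, r, -q, t, by exact_mod_cast hg.ne', by rw [mul_comm]; exact hu,
    by rw [mul_comm]; exact hv, by linarith⟩

theorem encard_thueSolutions_le_of_isotropic {a b c d : ℤ} (hD : cubicDisc a b c d ≠ 0)
    (h : CubicIsotropic a b c d) : (thueSolutions a b c d).encard ≤ 4 := by
  obtain ⟨u, v, huv, h0⟩ := h
  obtain ⟨g, p, r, q, t, hg, rfl, rfl, hdet⟩ := exists_primitive huv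
  have hpr : cubicEval a b c d p r = 0 := by
    have : g ^ 3 * cubicEval a b c d p r = 0 := by
      rw [← h0]; simp only [cubicEval]; ring
    exact (mul_eq_zero.1 this).resolve_left (pow_ne_zero _ hg)
  refine (encard_thueSolutions_le a b c d (p := p) (q := q) (r := r) (t := t)
    (by rw [hdet]; norm_num)).trans ?_
  have hD' := cubicDisc_comp a b c d p q r t
  rw [hdet, one_pow, one_mul, hpr] at hD'
  rw [hpr]
  generalize cubicSnd a b c d p q r t = b' at *
  generalize cubicTrd a b c d p q r t = c' at *
  generalize cubicEval a b c d q t = d' at *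
  have hb : b' ≠ 0 := by
    rintro rfl
    exact hD (by rw [← hD']; simp [cubicDisc])
  have quad : ∀ c e : ℤ, ∃ r1 r2 : ℤ, ∀ x : ℤ, b' * x ^ 2 + c * x + e = 0 → x = r1 ∨ x = r2 := by
    intro c e
    by_cases hex : ∃ r, b' * r ^ 2 + c * r + e = 0
    · obtain ⟨r, hr⟩ := hex
      refine ⟨r, -c / b' - r, fun x hx => ?_⟩
      by_cases hxr : x = r
      · exact Or.inl hxr
      · right
        have h1 : (x - r) * (b' * (x + r) + c) = 0 := by linear_combination hx - hr
        have h2 := (mul_eq_zero.1 h1).resolve_left (sub_ne_zero.2 hxr)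
        have h3 : -c = b' * (x + r) := by linarith
        rw [h3, Int.mul_ediv_cancel_left _ hb]; ring
    · push Not at hex
      exact ⟨0, 0, fun x hx => absurd hx (hex x)⟩
  obtain ⟨r1, r2, h12⟩ := quad c' (d' - 1)
  obtain ⟨r3, r4, h34⟩ := quad (-c') (d' + 1)
  have hsub : thueSolutions 0 b' c' d' ⊆
      (({(r1, 1), (r2, 1), (r3, -1), (r4, -1)} : Finset (ℤ × ℤ)) : Set (ℤ × ℤ)) := by
    rintro ⟨x, y⟩ hxy
    simp only [thueSolutions, cubicEval, Set.mem_ofPred_eq] at hxy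
    have hy : y ∣ 1 := ⟨b' * x ^ 2 + c' * x * y + d' * y ^ 2, by linear_combination -hxy⟩
    simp only [Finset.coe_insert, Finset.coe_singleton, Set.mem_insert_iff, Prod.mk.injEq,
      Set.mem_singleton_iff]
    rcases Int.isUnit_iff.1 (isUnit_of_dvd_one hy) with rfl | rfl
    · have := h12 x (by linear_combination hxy)
      tauto
    · have := h34 x (by linear_combination -hxy)
      tauto
  refine (Set.encard_le_encard hsub).trans ?_
  rw [Set.encard_coe_eq_coe_finsetCard]
  exact_mod_cast Finset.card_le_four

theorem CubicIsotropic.of_disc_eq_neg_three {a b c d : ℤ} (hD : cubicDisc a b c d = -3) :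
    CubicIsotropic a b c d := by
  have hH : ∃ u v : ℤ, (u ≠ 0 ∨ v ≠ 0) ∧ cubicHess a b c d u v = 0 := by
    by_cases hA : b ^ 2 - 3 * a * c = 0
    · exact ⟨1, 0, by simp, by simp only [cubicHess]; linarith⟩
    · refine ⟨3 - (b * c - 9 * a * d), 2 * (b ^ 2 - 3 * a * c), Or.inr (by omega), ?_⟩
      simp only [cubicHess, cubicDisc] at *
      linear_combination 3 * (b ^ 2 - 3 * a * c) * hD
  obtain ⟨u, v, huv, h0⟩ := hH
  obtain ⟨g, p, r, q, t, hg, rfl, rfl, hdet⟩ := exists_primitive huv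
  have hpr : cubicHess a b c d p r = 0 := by
    have : g ^ 2 * cubicHess a b c d p r = 0 := by
      rw [← h0]; simp only [cubicHess]; ring
    exact (mul_eq_zero.1 this).resolve_left (pow_ne_zero _ hg)
  refine CubicIsotropic.of_comp (p := p) (q := q) (r := r) (t := t) (by rw [hdet]; norm_num) ?_
  have hD' := cubicDisc_comp a b c d p q r t
  have hH' := cubicHess_comp a b c d p q r t 1 0
  simp only [mul_one, mul_zero, add_zero, hpr] at hH'
  rw [hdet, one_pow, one_mul, hD] at hD'
  generalize cubicEval a b c d p r = a' at *
  generalize cubicSnd a b c d p q r t = b' at *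
  generalize cubicTrd a b c d p q r t = c' at *
  generalize cubicEval a b c d q t = d' at *
  have hb : b' ^ 2 = 3 * (a' * c') := by
    simp only [cubicHess] at hH'; linarith
  have hBsq : (b' * c' - 9 * a' * d') ^ 2 = 3 ^ 2 := by
    simp only [cubicDisc] at hD'
    linear_combination -3 * hD' + 4 * (c' ^ 2 - 3 * b' * d') * hb
  obtain ⟨e, rfl⟩ : 3 ∣ b' := Int.prime_three.dvd_of_dvd_pow ⟨_, hb⟩
  have he : 3 * e ^ 2 = a' * c' := by linarith
  have hunit : e * c' - 3 * a' * d' = 1 ∨ e * c' - 3 * a' * d' = -1 := by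
    rcases sq_eq_sq_iff_eq_or_eq_neg.1 hBsq with h | h
    · left; linarith
    · right; linarith
  by_cases ha0 : a' = 0
  · exact ⟨1, 0, by simp, by simp [cubicEval, ha0]⟩
  have hsq : (e * c' - 3 * a' * d') ^ 2 = 1 := by
    rcases hunit with h | h <;> rw [h] <;> norm_num
  have hdvd : a' ∣ 3 := by
    refine ⟨c' ^ 3 - 18 * e * c' * d' + 27 * a' * d' ^ 2, ?_⟩
    linear_combination -3 * hsq + c' ^ 2 * he
  have ha3 : a' = 3 ∨ a' = -3 := by
    have : a'.natAbs ∣ 3 := by exact_mod_cast Int.natAbs_dvd_natAbs.2 hdvd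
    rcases (Nat.dvd_prime Nat.prime_three).1 this with h | h
    · exfalso
      have h3 : (3 : ℤ) ∣ c' := by
        rcases Int.natAbs_eq a' with h' | h' <;> rw [h, Nat.cast_one] at h'
        · exact ⟨e ^ 2, by rw [h'] at he; linarith⟩
        · exact ⟨-e ^ 2, by rw [h'] at he; linarith⟩
      obtain ⟨f, rfl⟩ := h3
      have h1 : (3 : ℤ) ∣ 1 := ⟨3 * (e * f - a' * d') ^ 2, by linear_combination -hsq⟩
      norm_num at h1
    · omega
  rcases ha3 with rfl | rfl
  · obtain rfl : c' = e ^ 2 := by linarith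
    rcases hunit with h | h
    · exact ⟨1 - e, 3, by simp, by simp only [cubicEval]; linear_combination -3 * h⟩
    · exact ⟨-1 - e, 3, by simp, by simp only [cubicEval]; linear_combination -3 * h⟩
  · obtain rfl : c' = -e ^ 2 := by linarith
    rcases hunit with h | h
    · exact ⟨1 + e, 3, by simp, by simp only [cubicEval]; linear_combination 3 * h⟩
    · exact ⟨-1 + e, 3, by simp, by simp only [cubicEval]; linear_combination 3 * h⟩

/-- Three large, nearly parallel solutions cannot coexist. -/
theorem DiagPair.absurd_of_three {D : ℤ} {δ : ℂ} {G k B G' k' B' : ℤ} {ξ₁ η₁ ξ₂ η₂ ξ₃ η₃ : ℂ}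
    (h : DiagPair D δ (1 : ℤ) G k B ξ₁ η₁ ξ₂ η₂) (h' : DiagPair D δ (1 : ℤ) G' k' B' ξ₂ η₂ ξ₃ η₃)
    (hk : k ≠ 0) (hk' : k' ≠ 0) {p : ℝ} (hp : p = ‖ξ₁‖ ^ 3) (hp1 : 15 * |(D : ℝ)| ≤ p)
    (hp2 : 735 ≤ p) (hp5 : 25300 * |(D : ℝ)| ^ 6 ≤ p ^ 5 ∨
      3205 * |(D : ℝ)| ^ 6 ≤ p ^ 5 ∧ 42 ≤ |(D : ℝ)|) : False := by
  have hd1 : 1 ≤ |(D : ℝ)| := by exact_mod_cast Int.one_le_abs h.disc_ne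
  have hN := h.norm_pos
  have hr := h.ratio_ge (γ := 1) rfl (Or.inl rfl) hk (p := p) (R := ‖ξ₂‖ / ‖ξ₁‖ ^ 2)
    (by rw [hp]; simp) hp1 hp2 (by field_simp)
  have hR : ‖ξ₂‖ ^ 3 = (‖ξ₂‖ / ‖ξ₁‖ ^ 2) ^ 3 * p ^ 2 := by rw [hp]; field_simp
  set R := ‖ξ₂‖ / ‖ξ₁‖ ^ 2
  set d := |(D : ℝ)|
  have hp0 : 0 < p := by linarith
  have hcube : (39 / 100) ^ 3 * p ^ 5 ≤ ‖ξ₂‖ ^ 3 * d ^ 3 := by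
    have : (39 / 100 * p) ^ 3 ≤ (R * d) ^ 3 := by gcongr
    calc (39 / 100) ^ 3 * p ^ 5 = (39 / 100 * p) ^ 3 * p ^ 2 := by ring
      _ ≤ (R * d) ^ 3 * p ^ 2 := by gcongr
      _ = _ := by rw [hR]; ring
  have hlow : ∀ m : ℝ, m * d ^ 6 ≤ (39 / 100) ^ 3 * p ^ 5 → m * d ^ 3 ≤ ‖ξ₂‖ ^ 3 := by
    intro m hm
    have : (m * d ^ 3) * d ^ 3 ≤ ‖ξ₂‖ ^ 3 * d ^ 3 := by
      calc (m * d ^ 3) * d ^ 3 = m * d ^ 6 := by ring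
        _ ≤ _ := hm.trans hcube
    exact le_of_mul_le_mul_right this (by positivity)
  have hd3 : 0 < d ^ 3 := by positivity
  rcases hp5 with h5 | ⟨h5, h42⟩
  · have hb := hlow 1500 (by nlinarith [pow_nonneg hd3.le 2])
    have e1 : d ^ 2 ≤ d ^ 3 := pow_le_pow_right₀ hd1 (by norm_num)
    have e2 : d ^ 5 ≤ d ^ 6 := pow_le_pow_right₀ hd1 (by norm_num)
    refine h'.absurd_of_large (γ := 1) rfl (Or.inl rfl) hk' (p := ‖ξ₂‖ ^ 3) (by simp)
      (by linarith) (by linarith) ?_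
    calc 1500000 * d ^ 5 ≤ (1500 * d ^ 3) ^ 2 := by nlinarith [e2, pow_nonneg hd3.le 2]
      _ ≤ _ := by gcongr
  · have hb := hlow 190 (by nlinarith [pow_nonneg hd3.le 2])
    have e1 : 42 * d ^ 2 ≤ d ^ 3 := by nlinarith [sq_nonneg d]
    have e2 : 42 * d ^ 5 ≤ d ^ 6 := by nlinarith [pow_nonneg (by linarith : 0 ≤ d) 5]
    refine h'.absurd_of_large (γ := 1) rfl (Or.inl rfl) hk' (p := ‖ξ₂‖ ^ 3) (by simp)
      (by linarith [sq_nonneg d]) hb ?_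
    calc 1500000 * d ^ 5 ≤ (190 * d ^ 3) ^ 2 := by
          nlinarith [e2, pow_nonneg (by linarith : 0 ≤ d) 5]
      _ ≤ _ := by gcongr

theorem exists_sorted {α : Type*} (T : Finset α) (f : α → ℝ) {n : ℕ} (h : n ≤ T.card) :
    ∃ g : Fin n → α, Function.Injective g ∧ (∀ i, g i ∈ T) ∧ Monotone (f ∘ g) := by
  set e : Fin n → T := fun i => T.equivFin.symm (Fin.castLE h i)
  have he : Function.Injective e := T.equivFin.symm.injective.comp (Fin.castLE_injective h)
  let u : Fin n → ℝ := fun i => f (e i)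
  refine ⟨fun i => e (Tuple.sort u i), ?_, fun i => (e _).2, ?_⟩
  · exact Subtype.val_injective.comp (he.comp (Tuple.sort u).injective)
  · exact Tuple.monotone_sort u

theorem eq_of_det_eq_zero {a b c d x y z w : ℤ} (h1 : cubicEval a b c d x y = 1)
    (h2 : cubicEval a b c d z w = 1) (h : x * w - y * z = 0) : x = z ∧ y = w := by
  have hxy : x ≠ 0 ∨ y ≠ 0 := by
    by_contra hc
    push Not at hc
    rw [hc.1, hc.2] at h1
    simp [cubicEval] at h1
  obtain ⟨g, p, r, q, t, hg, rfl, rfl, hdet⟩ := exists_primitive hxy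
  have h0 : p * w - r * z = 0 := by
    have : g * (p * w - r * z) = 0 := by linear_combination h
    exact (mul_eq_zero.1 this).resolve_left hg
  have hz : z = (t * z - q * w) * p := by linear_combination -z * hdet + q * h0
  have hw : w = (t * z - q * w) * r := by linear_combination -w * hdet + t * h0
  generalize t * z - q * w = m at hz hw
  subst hz hw
  have e1 : g ^ 3 * cubicEval a b c d p r = 1 := by rw [← h1]; simp only [cubicEval]; ring
  have e2 : m ^ 3 * cubicEval a b c d p r = 1 := by rw [← h2]; simp only [cubicEval]; ring
  have e3 : g ^ 3 = m ^ 3 := by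
    calc g ^ 3 = g ^ 3 * (m ^ 3 * cubicEval a b c d p r) := by rw [e2, mul_one]
      _ = m ^ 3 * (g ^ 3 * cubicEval a b c d p r) := by ring
      _ = m ^ 3 := by rw [e1, mul_one]
  have := (Odd.strictMono_pow (by decide : Odd 3)).injective e3
  subst this
  exact ⟨rfl, rfl⟩

/-- Five points on one branch of `y(3x² + y²) = 3/2` spanning large triangles. -/
theorem hyperbola_chain {c : ℝ} (hc : 1.513 ≤ c) {x y : Fin 5 → ℝ} (hx0 : ∀ i, 0 ≤ x i)
    (hy : ∀ i, y i * (3 * x i ^ 2 + y i ^ 2) = 3 / 2) (hx : Monotone x)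
    (hdet : ∀ i j, i ≠ j → c / 2 ≤ |x j * y i - x i * y j|) : 2.38 * c ^ 3 ≤ x 4 := by
  have hy0 : ∀ i, 0 < y i := by
    intro i
    by_contra hn
    have := hy i
    nlinarith [mul_nonneg (by linarith : 0 ≤ -y i)
      (by positivity : 0 ≤ 3 * x i ^ 2 + y i ^ 2)]
  have mono : ∀ i : Fin 5, ∀ u t : ℝ, 0 ≤ u → 0 ≤ t → u ≤ x i →
      3 / 2 ≤ t * (3 * u ^ 2 + t ^ 2) → y i ≤ t := by
    intro i u t hu ht hux htu
    by_contra hlt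
    push Not at hlt
    have h1 : t * (3 * u ^ 2 + t ^ 2) < y i * (3 * x i ^ 2 + y i ^ 2) := by
      have e1 : 3 * u ^ 2 + t ^ 2 < 3 * x i ^ 2 + y i ^ 2 := by
        have : u ^ 2 ≤ x i ^ 2 := by gcongr
        have : t ^ 2 < y i ^ 2 := by gcongr
        linarith
      have e2 : 0 ≤ 3 * u ^ 2 + t ^ 2 := by positivity
      nlinarith [hy0 i]
    linarith [hy i]
  have anti : ∀ i j, x i ≤ x j → y j ≤ y i := fun i j hij =>
    mono j (x i) (y i) (hx0 i) (hy0 i).le hij (hy i).ge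
  have step : ∀ i j, i < j → c / 2 ≤ x j * y i - x i * y j := by
    intro i j hij
    have h1 := hx hij.le
    have h2 := anti i j h1
    have h3 : 0 ≤ x j * y i - x i * y j := by nlinarith [hx0 i, hx0 j, hy0 i, hy0 j]
    have := hdet i j hij.ne
    rwa [abs_of_nonneg h3] at this
  have s01 := step 0 1 (by decide)
  have s12 := step 1 2 (by decide)
  have s23 := step 2 3 (by decide)
  have s34 := step 3 4 (by decide)
  have y0 := mono 0 0 1.14472 le_rfl (by norm_num) (hx0 0) (by norm_num)
  have x1 : 0.6608 ≤ x 1 := by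
    have := mul_nonneg (hx0 0) (hy0 1).le
    nlinarith [hx0 1]
  have y1 := mono 1 0.6608 0.7815 (by norm_num) (by norm_num) x1 (by norm_num)
  have x2 : 1.23 ≤ x 2 := by
    by_contra hlt
    push Not at hlt
    have hy2 : 0.323 ≤ y 2 := by
      by_contra hlt2
      push Not at hlt2
      have e1 : 3 * x 2 ^ 2 + y 2 ^ 2 ≤ 3 * 1.23 ^ 2 + 0.323 ^ 2 := by
        have : x 2 ^ 2 ≤ 1.23 ^ 2 := by gcongr; exact hx0 2
        have : y 2 ^ 2 ≤ 0.323 ^ 2 := by gcongr; exact (hy0 2).le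
        linarith
      have e2 : y 2 * (3 * x 2 ^ 2 + y 2 ^ 2) ≤ 0.323 * (3 * 1.23 ^ 2 + 0.323 ^ 2) := by
        gcongr
      rw [hy 2] at e2
      norm_num at e2
    have e1 : x 2 * y 1 ≤ 1.23 * 0.7815 := by gcongr; exact (hy0 1).le
    have e2 : 0.6608 * 0.323 ≤ x 1 * y 2 := by gcongr
    linarith
  have y2 := mono 2 1.23 0.3235 (by norm_num) (by norm_num) x2 (by norm_num)
  have x3 : 1.5455 * c ≤ x 3 := by
    have := mul_nonneg (hx0 2) (hy0 3).le
    nlinarith [hx0 3]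
  have hx3 : 0 < x 3 := by linarith
  have y3 : y 3 * (2 * x 3 ^ 2) ≤ 1 := by
    have := hy 3
    nlinarith [pow_pos (hy0 3) 3]
  have x4 : c * x 3 ^ 2 ≤ x 4 := by
    have h1 := mul_nonneg (hx0 3) (hy0 4).le
    have h2 : c / 2 * (2 * x 3 ^ 2) ≤ x 4 * y 3 * (2 * x 3 ^ 2) := by gcongr; linarith
    have h3 : x 4 * (y 3 * (2 * x 3 ^ 2)) ≤ x 4 * 1 := by gcongr; exact hx0 4
    linarith
  calc 2.38 * c ^ 3 ≤ c * (1.5455 * c) ^ 2 := by nlinarith [pow_pos (by linarith : 0 < c) 3]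
    _ ≤ c * x 3 ^ 2 := by gcongr
    _ ≤ _ := x4

/-- At most eight points of `y(3x² + y²) = 3/2` spanning large triangles are small. -/
theorem card_small_le_eight {ι : Type*} {c : ℝ} (hc : 1.513 ≤ c) {x y : ι → ℝ} (T : Finset ι)
    (hy : ∀ i ∈ T, y i * (3 * x i ^ 2 + y i ^ 2) = 3 / 2)
    (hdet : ∀ i ∈ T, ∀ j ∈ T, i ≠ j → c / 2 ≤ |x j * y i - x i * y j|)
    (hsmall : ∀ i ∈ T, |x i| < 2.38 * c ^ 3) : T.card ≤ 8 := by
  have key : ∀ S : Finset ι, S ⊆ T → ∀ e : ℝ, |e| = 1 → (∀ i ∈ S, 0 ≤ e * x i) → S.card ≤ 4 := by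
    intro S hS e he hpos
    by_contra hlt
    push Not at hlt
    obtain ⟨g, hg, hgS, hmono⟩ := exists_sorted S (fun i => e * x i) (n := 5) hlt
    have he2 : e ^ 2 = 1 := by rw [← sq_abs, he, one_pow]
    have h4 := hyperbola_chain hc (x := fun i => e * x (g i)) (y := fun i => y (g i))
      (fun i => hpos _ (hgS i))
      (fun i => by rw [mul_pow, he2, one_mul]; exact hy _ (hS (hgS i))) hmono
      (fun i j hij => by
        have := hdet _ (hS (hgS i)) _ (hS (hgS j)) (hg.ne hij)
        rw [mul_assoc, mul_assoc, ← mul_sub, abs_mul, he, one_mul]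
        exact this)
    have h5 := hsmall _ (hS (hgS 4))
    have h6 : e * x (g 4) ≤ |x (g 4)| := by
      rw [← one_mul |x (g 4)|, ← he, ← abs_mul]; exact le_abs_self _
    linarith
  classical
  have h1 := key (T.filter fun i => 0 ≤ x i) (Finset.filter_subset _ _) 1 (by simp)
    (fun i hi => by simpa using (Finset.mem_filter.1 hi).2)
  have h2 := key (T.filter fun i => ¬ 0 ≤ x i) (Finset.filter_subset _ _) (-1) (by simp)
    (fun i hi => by have := (Finset.mem_filter.1 hi).2; linarith)
  have := Finset.card_filter_add_card_filter_not (s := T) (fun i => 0 ≤ x i)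
  omega

/-- A large point of the hyperbola-like curve is close to its asymptote. -/
theorem large_point {c x y : ℝ} (hc : 1.513 ≤ c) (hy : y * (3 * x ^ 2 + y ^ 2) = 3 / 2)
    (hx : 2.38 * c ^ 3 ≤ |x|) : 0 < y ∧ 4 * y ≤ |x + y| ∧ 2.37 * c ^ 3 ≤ |x + y| := by
  have hc3 : (3.46 : ℝ) ≤ c ^ 3 := by
    calc (3.46 : ℝ) ≤ 1.513 ^ 3 := by norm_num
      _ ≤ _ := by gcongr
  have hy0 : 0 < y := by
    by_contra hn
    nlinarith [mul_nonneg (by linarith : 0 ≤ -y) (by positivity : 0 ≤ 3 * x ^ 2 + y ^ 2)]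
  have hx8 : 8.2 ≤ |x| := by linarith
  have hx2 : 8.2 ^ 2 ≤ x ^ 2 := by rw [← sq_abs x]; gcongr
  have hy1 : y ≤ 0.01 := by
    have h1 : y * (3 * 8.2 ^ 2) ≤ y * (3 * x ^ 2 + y ^ 2) := by
      gcongr; nlinarith
    linarith
  have h2 : |x| ≤ |x + y| + |y| := by
    simpa using abs_sub (x + y) y
  rw [abs_of_pos hy0] at h2
  exact ⟨hy0, by linarith, by linarith⟩

theorem encard_le_of_forall_card_le {α : Type*} {S : Set α} {n : ℕ}
    (h : ∀ T : Finset α, ↑T ⊆ S → T.card ≠ n + 1) : S.encard ≤ n := by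
  by_contra hlt
  push Not at hlt
  have h1 : ((n + 1 : ℕ) : ℕ∞) ≤ S.encard := by
    have := Order.add_one_le_of_lt hlt
    exact_mod_cast this
  obtain ⟨t, ht, hcard⟩ := Set.exists_subset_encard_eq h1
  have hfin : t.Finite := Set.finite_of_encard_eq_coe hcard
  refine h hfin.toFinset (by simpa using ht) ?_
  rw [hfin.encard_eq_coe_toFinset_card] at hcard
  exact_mod_cast hcard

theorem encard_le_of_real_resolvent {a b c d : ℤ} {s α β α' β' : ℝ}
    (h : Resolvent a b c d (s : ℂ) α β α' β') (hD : cubicDisc a b c d ≤ -4) (hs : 0 < s) :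
    (thueSolutions a b c d).encard ≤ 10 := by
  have hs2 : s ^ 2 = -3 * cubicDisc a b c d := by exact_mod_cast h.sq_delta
  have hdelta : α * β' - α' * β = s := by exact_mod_cast h.delta
  have hDr : (cubicDisc a b c d : ℝ) ≤ -4 := by exact_mod_cast hD
  have hs12 : 3.464 ≤ s := by nlinarith
  obtain ⟨e, he0, he3⟩ : ∃ e : ℝ, 0 < e ∧ e ^ 3 = s :=
    ⟨s ^ (1 / 3 : ℝ), by positivity, by
      rw [← Real.rpow_natCast, ← Real.rpow_mul hs.le]; norm_num⟩
  have he : 1.513 ≤ e := by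
    by_contra hlt
    push Not at hlt
    have : e ^ 3 ≤ 1.513 ^ 3 := by gcongr
    norm_num at this
    linarith
  let ξ : ℤ × ℤ → ℝ := fun v => α * v.1 + β * v.2
  let η : ℤ × ℤ → ℝ := fun v => α' * v.1 + β' * v.2
  let x : ℤ × ℤ → ℝ := fun v => (ξ v + η v) / (2 * e)
  let y : ℤ × ℤ → ℝ := fun v => (ξ v - η v) / (2 * e)
  have hξ : ∀ v, ξ v = e * (x v + y v) := fun v => by simp only [x, y]; field_simp; ring
  have hη : ∀ v, η v = e * (x v - y v) := fun v => by simp only [x, y]; field_simp; ring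
  have hform : ∀ v ∈ thueSolutions a b c d, ξ v ^ 3 - η v ^ 3 = 3 * s := by
    intro v hv
    have h1 := h.form v.1 v.2
    have h2 : cubicEval a b c d v.1 v.2 = 1 := hv
    rw [h2] at h1
    simp only [ξ, η]
    have : ((((α * v.1 + β * v.2) ^ 3 - (α' * v.1 + β' * v.2) ^ 3 : ℝ)) : ℂ) = (3 * s : ℝ) := by
      push_cast at h1 ⊢
      linear_combination h1
    exact_mod_cast this
  have hy : ∀ v ∈ thueSolutions a b c d, y v * (3 * x v ^ 2 + y v ^ 2) = 3 / 2 := by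
    intro v hv
    have h1 := hform v hv
    rw [hξ, hη, ← he3] at h1
    have h2 : e ^ 3 * (y v * (3 * x v ^ 2 + y v ^ 2)) = e ^ 3 * (3 / 2) := by linarith
    exact mul_left_cancel₀ (by positivity) h2
  have hdet0 : ∀ v w : ℤ × ℤ, x w * y v - x v * y w =
      e / 2 * ((v.1 * w.2 - v.2 * w.1 : ℤ) : ℝ) := by
    intro v w
    have h1 : ξ v * η w - ξ w * η v = s * (v.1 * w.2 - v.2 * w.1) := by
      rw [← hdelta]; simp only [ξ, η]; ring
    rw [hξ, hη, hξ, hη, ← he3] at h1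
    have h2 : e ^ 2 * (x w * y v - x v * y w) =
        e ^ 2 * (e / 2 * ((v.1 * w.2 - v.2 * w.1 : ℤ) : ℝ)) := by
      push_cast
      linarith
    exact mul_left_cancel₀ (by positivity) h2
  have hk : ∀ v ∈ thueSolutions a b c d, ∀ w ∈ thueSolutions a b c d, v ≠ w →
      v.1 * w.2 - v.2 * w.1 ≠ 0 := by
    intro v hv w hw hvw h0
    obtain ⟨h1, h2⟩ := eq_of_det_eq_zero hv hw h0
    exact hvw (Prod.ext h1 h2)
  have hdet : ∀ v ∈ thueSolutions a b c d, ∀ w ∈ thueSolutions a b c d, v ≠ w →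
      e / 2 ≤ |x w * y v - x v * y w| := by
    intro v hv w hw hvw
    have h1 : (1 : ℝ) ≤ |((v.1 * w.2 - v.2 * w.1 : ℤ) : ℝ)| := by
      exact_mod_cast Int.one_le_abs (hk v hv w hw hvw)
    rw [hdet0, abs_mul, abs_of_pos (by positivity : 0 < e / 2)]
    exact le_mul_of_one_le_right (by positivity) h1
  refine encard_le_of_forall_card_le (n := 10) fun T hT hcard => ?_
  have h8 := card_small_le_eight he (x := x) (y := y)
    (T.filter fun v => |x v| < 2.38 * e ^ 3)
    (fun i hi => hy i (hT (Finset.mem_filter.1 hi).1))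
    (fun i hi j hj => hdet i (hT (Finset.mem_filter.1 hi).1) j (hT (Finset.mem_filter.1 hj).1))
    (fun i hi => (Finset.mem_filter.1 hi).2)
  have h3 := Finset.card_filter_add_card_filter_not (s := T) (fun v => |x v| < 2.38 * e ^ 3)
  obtain ⟨g, hg, hgT, hmono⟩ := exists_sorted (T.filter fun v => ¬ |x v| < 2.38 * e ^ 3)
    (fun v => |ξ v|) (n := 3) (by omega)
  have hsol : ∀ i, g i ∈ thueSolutions a b c d := fun i => hT (Finset.mem_filter.1 (hgT i)).1
  have hlarge : ∀ i, 0 < y (g i) ∧ 4 * y (g i) ≤ |x (g i) + y (g i)| ∧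
      2.37 * e ^ 3 ≤ |x (g i) + y (g i)| := fun i =>
    large_point he (hy _ (hsol i)) (not_lt.1 (Finset.mem_filter.1 (hgT i)).2)
  have hcξ : ∀ v : ℤ × ℤ, ((α : ℂ) * v.1 + β * v.2) = (ξ v : ℝ) := fun v => by
    simp only [ξ]; push_cast; rfl
  have hcη : ∀ v : ℤ × ℤ, ((α' : ℂ) * v.1 + β' * v.2) = (η v : ℝ) := fun v => by
    simp only [η]; push_cast; rfl
  have hnorm : ∀ v : ℤ × ℤ, ‖((α : ℂ) * v.1 + β * v.2)‖ = |ξ v| := fun v => by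
    rw [hcξ, Complex.norm_real, Real.norm_eq_abs]
  have hnear : ∀ i, ‖((α : ℂ) * (g i).1 + β * (g i).2) - (α' * (g i).1 + β' * (g i).2)‖ ≤
      1 / 2 * ‖(α : ℂ) * (g i).1 + β * (g i).2‖ := by
    intro i
    rw [hnorm, hcξ, hcη, ← Complex.ofReal_sub, Complex.norm_real, Real.norm_eq_abs, hξ, hη]
    obtain ⟨h1, h2, -⟩ := hlarge i
    rw [abs_mul, abs_of_pos he0, show e * (x (g i) + y (g i)) - e * (x (g i) - y (g i)) =
      2 * e * y (g i) by ring, abs_of_pos (by positivity)]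
    nlinarith
  have hpair : ∀ i j, i ≤ j → DiagPair (cubicDisc a b c d) ((s : ℂ) / ((1 : ℤ) : ℂ)) (1 : ℤ) _ _ _
      _ _ _ _ := fun i j hij =>
    h.diagPair one_pos odd_one (by ring) (by omega) (four_dvd_cubicDisc a b c d) (one_dvd _)
      (one_dvd _) (hsol i) (hsol j) (hnear i) (hnear j) (by
        rw [hnorm, hnorm]; exact hmono hij)
  have hD0 : |(cubicDisc a b c d : ℝ)| = s ^ 2 / 3 := by
    rw [abs_of_neg (by linarith)]; linarith
  have hp : 119 * |(cubicDisc a b c d : ℝ)| ^ 2 ≤ |ξ (g 0)| ^ 3 := by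
    rw [hξ, abs_mul, abs_of_pos he0, hD0, ← he3]
    calc 119 * ((e ^ 3) ^ 2 / 3) ^ 2 ≤ (e * (2.37 * e ^ 3)) ^ 3 := by
          nlinarith [pow_pos he0 12]
      _ ≤ _ := by gcongr; exact (hlarge 0).2.2
  have hd4 : 4 ≤ |(cubicDisc a b c d : ℝ)| := by rw [abs_of_neg (by linarith)]; linarith
  have k01 := hk _ (hsol 0) _ (hsol 1) (hg.ne (by decide))
  have k12 := hk _ (hsol 1) _ (hsol 2) (hg.ne (by decide))
  refine DiagPair.absurd_of_three (hpair 0 1 (by decide)) (hpair 1 2 (by decide)) k01 k12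
    (p := |ξ (g 0)| ^ 3) (by rw [hnorm]) ?_ ?_ (Or.inl ?_)
  · nlinarith
  · nlinarith
  · generalize |(cubicDisc a b c d : ℝ)| = t at *
    calc 25300 * t ^ 6 ≤ (119 * t ^ 2) ^ 5 := by
          have : t ^ 6 ≤ t ^ 10 := pow_le_pow_right₀ (by linarith) (by norm_num)
          nlinarith [pow_nonneg (by linarith : 0 ≤ t) 6]
      _ ≤ _ := by gcongr

theorem cubicHess_three_zeros {a b c d x₁ y₁ x₂ y₂ x₃ y₃ : ℤ}
    (h1 : cubicHess a b c d x₁ y₁ = 0) (h2 : cubicHess a b c d x₂ y₂ = 0)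
    (h3 : cubicHess a b c d x₃ y₃ = 0) (h12 : x₁ * y₂ - y₁ * x₂ ≠ 0)
    (h13 : x₁ * y₃ - y₁ * x₃ ≠ 0) (h23 : x₂ * y₃ - y₂ * x₃ ≠ 0) : cubicDisc a b c d = 0 := by
  have hne := mul_ne_zero (mul_ne_zero h12 h13) h23
  simp only [cubicHess] at h1 h2 h3
  have hA : b ^ 2 - 3 * a * c = 0 := by
    refine mul_left_cancel₀ hne ?_
    linear_combination y₂ * y₃ * (x₂ * y₃ - y₂ * x₃) * h1 - y₁ * y₃ * (x₁ * y₃ - y₁ * x₃) * h2 +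
      y₁ * y₂ * (x₁ * y₂ - y₁ * x₂) * h3
  have hB : b * c - 9 * a * d = 0 := by
    refine mul_left_cancel₀ hne ?_
    linear_combination -(x₂ * y₃ - y₂ * x₃) * (x₂ * y₃ + y₂ * x₃) * h1 +
      (x₁ * y₃ - y₁ * x₃) * (x₁ * y₃ + y₁ * x₃) * h2 -
      (x₁ * y₂ - y₁ * x₂) * (x₁ * y₂ + y₁ * x₂) * h3
  have : 3 * cubicDisc a b c d = 0 := by
    simp only [cubicDisc]
    linear_combination 4 * (c ^ 2 - 3 * b * d) * hA - (b * c - 9 * a * d) * hB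
  omega

theorem encard_thueSolutions_le_of_disc_neg {a b c d : ℤ} (hD : cubicDisc a b c d < 0)
    (hiso : ¬ CubicIsotropic a b c d) : (thueSolutions a b c d).encard ≤ 10 := by
  have hD4 : cubicDisc a b c d ≤ -4 := by
    have h3 : cubicDisc a b c d ≠ -3 := fun h => hiso (CubicIsotropic.of_disc_eq_neg_three h)
    have h4 := four_dvd_cubicDisc a b c d
    by_contra hlt
    have : cubicDisc a b c d = -1 ∨ cubicDisc a b c d = -2 := by omega
    rcases this with h | h <;> rw [h] at h4 <;> norm_num at h4
  by_cases hH : ∃ v ∈ thueSolutions a b c d, cubicHess a b c d v.1 v.2 ≠ 0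
  · obtain ⟨v, hv, hHv⟩ := hH
    refine encard_le_of_monic hv fun b' c' d' hdisc hA _ => ?_
    rw [← hdisc] at hD hD4
    obtain ⟨α, β, α', β', h⟩ := exists_resolvent_of_disc_neg hD (by rw [hA]; exact hHv)
    refine encard_le_of_real_resolvent h hD4 (Real.sqrt_pos.2 ?_)
    have : (cubicDisc 1 b' c' d' : ℝ) < 0 := by exact_mod_cast hD
    linarith
  · push Not at hH
    refine encard_le_of_forall_card_le (n := 10) fun T hT hcard => ?_
    obtain ⟨g, hg, hgT, -⟩ := exists_sorted T (fun _ => 0) (n := 3) (by omega)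
    have hsol : ∀ i, g i ∈ thueSolutions a b c d := fun i => hT (hgT i)
    have hk : ∀ i j, i ≠ j → (g i).1 * (g j).2 - (g i).2 * (g j).1 ≠ 0 := by
      intro i j hij h0
      obtain ⟨h1, h2⟩ := eq_of_det_eq_zero (hsol i) (hsol j) h0
      exact hg.ne hij (Prod.ext h1 h2)
    exact hD.ne (cubicHess_three_zeros (hH _ (hsol 0)) (hH _ (hsol 1)) (hH _ (hsol 2))
      (hk 0 1 (by decide)) (hk 0 2 (by decide)) (hk 1 2 (by decide)))

/-- The numerical test behind `size_of_adjacent`. -/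
def adjacentTest (b c : ℤ) : Bool :=
  let D := 18 * b * c + b * b * c * c - 4 * c * c * c - 4 * b * b * b - 27
  let h := b * b - 3 * c
  let k := c * c - 3 * b
  let m := b * c - 9
  decide (D < 82) || decide (3333 < D) || decide (b = c) || decide (b + c = -2) ||
    decide (h < 0) || decide (k < h) || decide (4 * h * h < 3 * D) ||
    (decide (169 ≤ D) && decide (m * m < 2 * D)) ||
    (decide (257 ≤ D) && decide (2 * m * m < 9 * D)) ||
    (decide (225 * D ^ 2 ≤ k ^ 3) && decide (3205 ^ 2 * D ^ 12 ≤ k ^ 15))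

theorem adjacentTest_box :
    ∀ i < 124, ∀ j < 124, adjacentTest ((i : ℕ) - 60 : ℤ) ((j : ℕ) - 60 : ℤ) = true := by
  decide +kernel

/-- Two adjacent solutions in one sector: the second Hessian value is large. -/
theorem size_of_adjacent {b c D h k m : ℤ} (eD : D = cubicDisc 1 b c 1) (eh : h = b ^ 2 - 3 * c)
    (ek : k = c ^ 2 - 3 * b) (em : m = b * c - 9) (hD1 : 82 ≤ D) (hD2 : D ≤ 3333) (hbc : b ≠ c)
    (hbc' : b + c ≠ -2) (h0 : 0 ≤ h) (hk : h ≤ k) (hh : 3 * D ≤ 4 * h ^ 2)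
    (h169 : 169 ≤ D → 2 * D ≤ m ^ 2) (h257 : 257 ≤ D → 9 * D ≤ 2 * m ^ 2) :
    225 * D ^ 2 ≤ k ^ 3 ∧ 3205 ^ 2 * D ^ 12 ≤ k ^ 15 := by
  have hD0 : 0 ≤ D := by omega
  by_cases hbig : k ≤ 1930
  · have hsum : (2 * b - 3) ^ 2 + (2 * c - 3) ^ 2 ≤ 15458 := by
      have : h + k ≤ 3860 := by omega
      rw [eh, ek] at this
      linarith
    have hb := abs_lt.1 (abs_lt_of_sq_lt_sq (a := 2 * b - 3) (b := 125)
      (by linarith [sq_nonneg (2 * c - 3)]) (by norm_num))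
    have hc := abs_lt.1 (abs_lt_of_sq_lt_sq (a := 2 * c - 3) (b := 125)
      (by linarith [sq_nonneg (2 * b - 3)]) (by norm_num))
    have key := adjacentTest_box (b + 60).toNat (by omega) (c + 60).toNat (by omega)
    rw [Int.toNat_of_nonneg (by omega), Int.toNat_of_nonneg (by omega), add_sub_cancel_right,
      add_sub_cancel_right] at key
    have eD' : 18 * b * c + b * b * c * c - 4 * c * c * c - 4 * b * b * b - 27 = D := by
      rw [eD]; simp only [cubicDisc]; ring
    have eh' : b * b - 3 * c = h := by rw [eh]; ring
    have ek' : c * c - 3 * b = k := by rw [ek]; ring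
    simp only [adjacentTest, eD', eh', ek', ← em, Bool.or_eq_true, Bool.and_eq_true,
      decide_eq_true_eq] at key
    rcases key with (((((((((key | key) | key) | key) | key) | key) | key) | key) | key) | key)
    · omega
    · omega
    · exact absurd key hbc
    · exact absurd key hbc'
    · omega
    · omega
    · linarith
    · linarith [h169 key.1]
    · linarith [h257 key.1]
    · exact key
  · have hk2 : 1931 ≤ k := by omega
    constructor
    · calc 225 * D ^ 2 ≤ 225 * 3333 ^ 2 := by gcongr
        _ ≤ 1931 ^ 3 := by norm_num
        _ ≤ k ^ 3 := by gcongr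
    · calc 3205 ^ 2 * D ^ 12 ≤ 3205 ^ 2 * 3333 ^ 12 := by gcongr
        _ ≤ 1931 ^ 15 := by norm_num
        _ ≤ k ^ 15 := by gcongr

/-- A real point on `y(3x² - y²) = 3s/2` lying in the sector `|y| ≤ |x|/√3`. -/
structure SectorPoint (s x y : ℝ) : Prop where
  curve : y * (3 * x ^ 2 - y ^ 2) = 3 / 2 * s
  sector : 3 * y ^ 2 ≤ x ^ 2

namespace SectorPoint

variable {s x y x' y' : ℝ}

theorem pos (h : SectorPoint s x y) (hs : 0 < s) : 0 < y := by
  by_contra hn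
  have h1 : 0 ≤ 3 * x ^ 2 - y ^ 2 := by nlinarith [h.sector, sq_nonneg y]
  nlinarith [h.curve, mul_nonneg (by linarith : 0 ≤ -y) h1]

theorem cube_le (h : SectorPoint s x y) (hs : 0 < s) : y ^ 3 ≤ 0.1875 * s := by
  nlinarith [h.curve, mul_le_mul_of_nonneg_left h.sector (h.pos hs).le]

theorem sq_mul_le (h : SectorPoint s x y) (hs : 0 < s) : x ^ 2 * y ≤ 0.5625 * s := by
  nlinarith [h.curve, h.cube_le hs]

theorem mul_norm_le (h : SectorPoint s x y) (hs : 0 < s) : y * (x ^ 2 + y ^ 2) ≤ 3 / 4 * s := by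
  nlinarith [h.curve, mul_le_mul_of_nonneg_left h.sector (h.pos hs).le]

theorem snd_le (h : SectorPoint s x y) (hs : 0 < s) (hn : s / 2 ≤ x ^ 2 + y ^ 2) : y ≤ 1.5 := by
  have hy := h.pos hs
  have h1 := h.cube_le hs
  have h2 : 1.5 * s * y - 4 * y ^ 3 ≤ 3 / 2 * s := by nlinarith [h.curve]
  have h3 : s * y ≤ s * 1.5 := by linarith
  exact le_of_mul_le_mul_left h3 hs

theorem snd_le_of_large (h : SectorPoint s x y) (hs : 100 ≤ s)
    (hn : s / 2 ≤ x ^ 2 + y ^ 2) : y ≤ 1.03 := by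
  have hs0 : 0 < s := by linarith
  have hy := h.pos hs0
  have h2 : 1.5 * s * y - 4 * y ^ 3 ≤ 3 / 2 * s := by nlinarith [h.curve]
  have step : ∀ t : ℝ, y ≤ t → y ≤ 1 + 4 * t ^ 3 / 150 := by
    intro t ht
    have h4 : y ^ 3 ≤ t ^ 3 := by gcongr
    have h5 : 0 ≤ t ^ 3 := by have := hy.le.trans ht; positivity
    by_contra hlt
    push Not at hlt
    nlinarith
  have h3 := step _ (step _ (step _ (h.snd_le hs0 hn)))
  norm_num at h3
  linarith

theorem anti (h : SectorPoint s x y) (h' : SectorPoint s x' y') (hs : 0 < s)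
    (hn : x ^ 2 + y ^ 2 ≤ x' ^ 2 + y' ^ 2) : y' ≤ y ∧ |x| ≤ |x'| := by
  have hy := h.pos hs
  have hy' := h'.pos hs
  have h1 : y' ≤ y := by
    by_contra hlt
    push Not at hlt
    have e1 : y * (3 * (x ^ 2 + y ^ 2)) ≤ y * (3 * (x' ^ 2 + y' ^ 2)) := by gcongr
    have e2 : 0 < 3 * (x' ^ 2 + y' ^ 2) - 4 * (y ^ 2 + y * y' + y' ^ 2) := by
      nlinarith [h'.sector]
    nlinarith [h.curve, h'.curve, mul_pos (sub_pos.2 hlt) e2]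
  refine ⟨h1, sq_le_sq.1 ?_⟩
  have : y' ^ 2 ≤ y ^ 2 := by gcongr
  linarith

end SectorPoint

/-- The shared estimates for two points of a sector. -/
structure SectorPair (s x y x' y' κ : ℝ) : Prop where
  fst : SectorPoint s x y
  snd : SectorPoint s x' y'
  norm_ge : s / 2 ≤ x ^ 2 + y ^ 2
  norm_le : x ^ 2 + y ^ 2 ≤ x' ^ 2 + y' ^ 2
  det : κ * (s / 2) ≤ |x' * y - x * y'|

namespace SectorPair

variable {s x y x' y' κ : ℝ}

theorem det_le (h : SectorPair s x y x' y' κ) (hs : 0 < s) :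
    κ * (s / 2) ≤ |x'| * y + |x| * y' := by
  have h1 := abs_sub (x' * y) (x * y')
  rw [abs_mul, abs_mul, abs_of_pos (h.fst.pos hs), abs_of_pos (h.snd.pos hs)] at h1
  exact h.det.trans h1

theorem fst_ge (h : SectorPair s x y x' y' κ) : 0.375 * s ≤ |x'| ^ 2 := by
  rw [sq_abs]
  nlinarith [h.snd.sector, h.norm_ge, h.norm_le]

theorem cross_mul_le (h : SectorPair s x y x' y' κ) (hs : 0 < s) :
    (|x| * y') * |x'| ≤ 0.5625 * s := by
  have h1 := (h.fst.anti h.snd hs h.norm_le).2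
  calc (|x| * y') * |x'| ≤ (|x'| * y') * |x'| := by gcongr; exact (h.snd.pos hs).le
    _ = x' ^ 2 * y' := by rw [← sq_abs x']; ring
    _ ≤ _ := h.snd.sq_mul_le hs

theorem cross_mul_sq_le (h : SectorPair s x y x' y' κ) (hs : 0 < s) :
    (|x| * y') * (|x'| * y) ^ 2 ≤ 0.1827 * s ^ 2 := by
  have hy := h.fst.pos hs
  have hy' := h.snd.pos hs
  refine abs_le_of_sq_le_sq' ?_ (by positivity) |>.2
  have h1 := h.fst.sq_mul_le hs
  have h2 := h.snd.sq_mul_le hs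
  have h3 := h.fst.cube_le hs
  calc ((|x| * y') * (|x'| * y) ^ 2) ^ 2 = (x' ^ 2 * y') ^ 2 * (x ^ 2 * y) * y ^ 3 := by
        rw [← sq_abs x', ← sq_abs x]; ring
    _ ≤ (0.5625 * s) ^ 2 * (0.5625 * s) * (0.1875 * s) := by gcongr
    _ ≤ _ := by nlinarith [pow_pos hs 4]

/-- One bootstrap step: a lower bound for the second abscissa improves the cross term. -/
theorem mul_ge_of_fst_ge (h : SectorPair s x y x' y' κ) (hs : 0 < s) {t q : ℝ} (ht : t ≤ |x'|)
    (ht0 : 0 < t) (hq : 0.5625 ≤ q * t) : (κ / 2 - q) * s ≤ |x'| * y := by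
  have h1 := h.det_le hs
  have h2 := h.cross_mul_le hs
  have hm : 0 ≤ |x| * y' := mul_nonneg (abs_nonneg _) (h.snd.pos hs).le
  have h3 : (|x| * y') * t ≤ (q * s) * t := by nlinarith
  have h4 := le_of_mul_le_mul_right h3 ht0
  linarith

/-- The other bootstrap step, using the absolute bound on the smaller cross term. -/
theorem mul_ge_of_mul_ge (h : SectorPair s x y x' y' κ) (hs : 0 < s) {t q : ℝ}
    (ht : t * s ≤ |x'| * y) (ht0 : 0 < t) (hq : 0.1827 ≤ q * s * t ^ 2) :
    (κ / 2 - q) * s ≤ |x'| * y := by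
  have h1 := h.det_le hs
  have h2 := h.cross_mul_sq_le hs
  have hm : 0 ≤ |x| * y' := mul_nonneg (abs_nonneg _) (h.snd.pos hs).le
  have h3 : (|x| * y') * (t * s) ^ 2 ≤ (q * s) * (t * s) ^ 2 := by
    calc (|x| * y') * (t * s) ^ 2 ≤ (|x| * y') * (|x'| * y) ^ 2 := by gcongr
      _ ≤ 0.1827 * s ^ 2 := h2
      _ ≤ (q * s * t ^ 2) * s ^ 2 := by gcongr
      _ = _ := by ring
  have h4 := le_of_mul_le_mul_right h3 (by positivity)
  linarith

theorem size_of_two_le (h : SectorPair s x y x' y' 2) (hs : 15.684 ≤ s) :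
    5 * s ^ 2 ≤ |x'| ^ 3 ∧ 4.397 * s ^ 12 ≤ (|x'| ^ 3) ^ 5 := by
  have hs0 : 0 < s := by linarith
  have h1 : 2.42 ≤ |x'| := by
    refine abs_le_of_sq_le_sq' ?_ (abs_nonneg _) |>.2
    nlinarith [h.fst_ge]
  have h2 := h.mul_ge_of_fst_ge hs0 (q := 0.2325) h1 (by norm_num) (by norm_num)
  have h3 := h.mul_ge_of_mul_ge hs0 (q := 0.02) (t := 0.7675) (by linarith) (by norm_num)
    (by nlinarith)
  have hy := h.fst.pos hs0
  have h4 : (0.98 * s) ^ 3 ≤ |x'| ^ 3 * y ^ 3 := by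
    rw [← mul_pow]; exact pow_le_pow_left₀ (by positivity) (by linarith) 3
  have h5 := h.fst.cube_le hs0
  have h6 : y ^ 3 ≤ 1.5 ^ 3 := by gcongr; exact h.fst.snd_le hs0 h.norm_ge
  have hx : 0 ≤ |x'| ^ 3 := by positivity
  have h7 : 5 * s ^ 2 ≤ |x'| ^ 3 := by
    have : (5 * s ^ 2) * s ≤ |x'| ^ 3 * s := by nlinarith [pow_pos hs0 3]
    exact le_of_mul_le_mul_right this hs0
  have h8 : 0.278 * s ^ 3 ≤ |x'| ^ 3 := by nlinarith [pow_pos hs0 3]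
  refine ⟨h7, ?_⟩
  calc 4.397 * s ^ 12 ≤ (5 * s ^ 2) ^ 2 * (0.278 * s ^ 3) ^ 3 := by
        nlinarith [pow_pos hs0 12]
    _ ≤ (|x'| ^ 3) ^ 2 * (|x'| ^ 3) ^ 3 := by gcongr
    _ = _ := by ring

theorem size_of_large (h : SectorPair s x y x' y' 1) (hs : 100 ≤ s) :
    5 * s ^ 2 ≤ |x'| ^ 3 ∧ 4.397 * s ^ 12 ≤ (|x'| ^ 3) ^ 5 := by
  have hs0 : 0 < s := by linarith
  have h1 : 6.12 ≤ |x'| := by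
    refine abs_le_of_sq_le_sq' ?_ (abs_nonneg _) |>.2
    nlinarith [h.fst_ge]
  have h2 := h.mul_ge_of_fst_ge hs0 (q := 0.092) h1 (by norm_num) (by norm_num)
  have h3 := h.mul_ge_of_mul_ge hs0 (q := 0.011) (t := 0.408) (by linarith) (by norm_num)
    (by nlinarith)
  have hy := h.fst.pos hs0
  have h6 := h.fst.snd_le_of_large hs h.norm_ge
  have h7 : 0.474 * s ≤ |x'| := by nlinarith [abs_nonneg x']
  have h8 : 0.1064 * s ^ 3 ≤ |x'| ^ 3 := by
    calc 0.1064 * s ^ 3 ≤ (0.474 * s) ^ 3 := by nlinarith [pow_pos hs0 3]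
      _ ≤ _ := by gcongr
  refine ⟨by nlinarith [pow_pos hs0 2], ?_⟩
  have h9 : (100 : ℝ) ^ 3 ≤ s ^ 3 := by gcongr
  calc 4.397 * s ^ 12 ≤ (0.1064 * s ^ 3) ^ 5 := by nlinarith [pow_pos hs0 12]
    _ ≤ _ := by gcongr

theorem norm_ge_of_sq_ge (h : SectorPair s x y x' y' 1) {r t q : ℝ} (ht0 : 0 < t)
    (hs0 : 0 < s) (ht : t ^ 2 ≤ 0.375 * s) (hq : 0.5625 ≤ q * t) (hq1 : q < 1 / 2)
    (hr : r * 1.5 ^ 2 ≤ (1 / 2 - q) ^ 2 * s) : r * s ≤ x' ^ 2 + y' ^ 2 := by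
  have h1 : t ≤ |x'| := abs_le_of_sq_le_sq' (ht.trans h.fst_ge) (abs_nonneg _) |>.2
  have h2 := h.mul_ge_of_fst_ge hs0 h1 ht0 hq
  have h3 : |x'| * y ≤ |x'| * 1.5 := by gcongr; exact h.fst.snd_le hs0 h.norm_ge
  have h4 : ((1 / 2 - q) * s) ^ 2 ≤ (|x'| * 1.5) ^ 2 := by
    have : 0 ≤ (1 / 2 - q) * s := mul_nonneg (by linarith) hs0.le
    exact pow_le_pow_left₀ this (by linarith) 2
  rw [mul_pow |x'|, sq_abs] at h4
  nlinarith [sq_nonneg y']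

end SectorPair

/-- The complex linear form `αx + βy` at an integral point. -/
noncomputable def linForm (α β : ℂ) (v : ℤ × ℤ) : ℂ := α * v.1 + β * v.2

/-- The point lies in the sector of half-angle `π/6` about the real axis. -/
def InSector (α β : ℂ) (v : ℤ × ℤ) : Prop :=
  3 * (linForm α β v).im ^ 2 ≤ (linForm α β v).re ^ 2

theorem conj_linForm (α β : ℂ) (v : ℤ × ℤ) :
    starRingEnd ℂ α * v.1 + starRingEnd ℂ β * v.2 = starRingEnd ℂ (linForm α β v) := by
  simp [linForm]

theorem linForm_smul (ω α β : ℂ) (v : ℤ × ℤ) :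
    linForm (ω * α) (ω * β) v = ω * linForm α β v := by
  simp only [linForm]; ring

namespace Resolvent

variable {a b c d : ℤ} {s : ℝ} {α β : ℂ}

theorem rotate {δ : ℂ} (h : Resolvent a b c d δ α β (starRingEnd ℂ α) (starRingEnd ℂ β)) {ω : ℂ}
    (hω : ω ^ 3 = 1) : Resolvent a b c d δ (ω * α) (ω * β) (starRingEnd ℂ (ω * α))
      (starRingEnd ℂ (ω * β)) := by
  have hn : ‖ω‖ = 1 := by
    have : ‖ω‖ ^ 3 = 1 := by rw [← norm_pow, hω, norm_one]
    exact (pow_eq_one_iff_of_nonneg (norm_nonneg _) (by norm_num)).1 this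
  have h1 : ω * starRingEnd ℂ ω = 1 := by
    rw [Complex.mul_conj, Complex.normSq_eq_norm_sq, hn]; simp
  have h3 : starRingEnd ℂ ω ^ 3 = 1 := by rw [← map_pow, hω, map_one]
  rw [map_mul, map_mul]
  refine ⟨h.sq_delta, ?_, fun x y => ?_, fun x y => ?_, fun x y => ?_⟩
  · rw [← h.delta]
    linear_combination (α * starRingEnd ℂ β - starRingEnd ℂ α * β) * h1
  · rw [← h.hess x y]
    linear_combination (α * x + β * y) * (starRingEnd ℂ α * x + starRingEnd ℂ β * y) * h1
  · rw [← h.form x y]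
    linear_combination (α * x + β * y) ^ 3 * hω -
      (starRingEnd ℂ α * x + starRingEnd ℂ β * y) ^ 3 * h3
  · rw [← h.cov x y]
    linear_combination (α * x + β * y) ^ 3 * hω +
      (starRingEnd ℂ α * x + starRingEnd ℂ β * y) ^ 3 * h3

theorem curve (h : Resolvent a b c d (Complex.I * s) α β (starRingEnd ℂ α) (starRingEnd ℂ β))
    {v : ℤ × ℤ} (hv : v ∈ thueSolutions a b c d) :
    (linForm α β v).im * (3 * (linForm α β v).re ^ 2 - (linForm α β v).im ^ 2) = 3 / 2 * s := by
  have h1 := h.form v.1 v.2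
  have h2 : cubicEval a b c d v.1 v.2 = 1 := hv
  rw [h2, conj_linForm] at h1
  change linForm α β v ^ 3 - _ = _ at h1
  generalize linForm α β v = z at h1
  have h3 := congrArg Complex.im h1
  simp [pow_succ] at h3
  linarith

theorem det_eq (h : Resolvent a b c d (Complex.I * s) α β (starRingEnd ℂ α) (starRingEnd ℂ β))
    (v w : ℤ × ℤ) : (linForm α β w).re * (linForm α β v).im -
      (linForm α β v).re * (linForm α β w).im = s / 2 * ((v.1 * w.2 - v.2 * w.1 : ℤ) : ℝ) := by
  have h1 : linForm α β v * starRingEnd ℂ (linForm α β w) -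
      linForm α β w * starRingEnd ℂ (linForm α β v) =
      Complex.I * s * ((v.1 * w.2 - v.2 * w.1 : ℝ) : ℂ) := by
    rw [← h.delta, ← conj_linForm, ← conj_linForm]
    simp only [linForm]
    push_cast
    ring
  generalize linForm α β v = z at *
  generalize linForm α β w = t at *
  have h3 := congrArg Complex.im h1
  simp only [Complex.sub_im, Complex.mul_im, Complex.conj_re, Complex.conj_im, Complex.I_re,
    Complex.I_im, Complex.ofReal_re, Complex.ofReal_im, Complex.mul_re] at h3
  push_cast
  linarith

theorem re_sq_add_im_sq
    (h : Resolvent a b c d (Complex.I * s) α β (starRingEnd ℂ α) (starRingEnd ℂ β))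
    (v : ℤ × ℤ) : (linForm α β v).re ^ 2 + (linForm α β v).im ^ 2 = cubicHess a b c d v.1 v.2 := by
  rw [← h.norm_sq v.1 v.2]
  change _ = ‖linForm α β v‖ ^ 2
  rw [← Complex.normSq_eq_norm_sq, Complex.normSq_apply]; ring

theorem sectorPoint
    (h : Resolvent a b c d (Complex.I * s) α β (starRingEnd ℂ α) (starRingEnd ℂ β))
    {v : ℤ × ℤ} (hv : v ∈ thueSolutions a b c d) (hv' : InSector α β v) :
    SectorPoint s (linForm α β v).re (linForm α β v).im := ⟨h.curve hv, hv'⟩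

theorem sectorPair
    (h : Resolvent a b c d (Complex.I * s) α β (starRingEnd ℂ α) (starRingEnd ℂ β)) (hs : 0 < s)
    {v w : ℤ × ℤ} (hv : v ∈ thueSolutions a b c d) (hv' : InSector α β v)
    (hw : w ∈ thueSolutions a b c d) (hw' : InSector α β w)
    (hn : s / 2 ≤ cubicHess a b c d v.1 v.2)
    (hle : cubicHess a b c d v.1 v.2 ≤ cubicHess a b c d w.1 w.2) {κ : ℝ}
    (hκ : κ ≤ |((v.1 * w.2 - v.2 * w.1 : ℤ) : ℝ)|) :
    SectorPair s (linForm α β v).re (linForm α β v).im (linForm α β w).re (linForm α β w).im κ where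
  fst := h.sectorPoint hv hv'
  snd := h.sectorPoint hw hw'
  norm_ge := by rwa [h.re_sq_add_im_sq]
  norm_le := by rw [h.re_sq_add_im_sq, h.re_sq_add_im_sq]; exact_mod_cast hle
  det := by
    rw [h.det_eq, abs_mul, abs_of_pos (by positivity : 0 < s / 2), mul_comm]
    gcongr

theorem near
    (h : Resolvent a b c d (Complex.I * s) α β (starRingEnd ℂ α) (starRingEnd ℂ β)) (hs : 0 < s)
    {v : ℤ × ℤ} (hv : v ∈ thueSolutions a b c d) (hv' : InSector α β v)
    (hH : 9 * s ^ 2 ≤ (cubicHess a b c d v.1 v.2 : ℝ) ^ 3) :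
    ‖(α * v.1 + β * v.2) - (starRingEnd ℂ α * v.1 + starRingEnd ℂ β * v.2)‖ ≤
      1 / 2 * ‖α * v.1 + β * v.2‖ := by
  have hp := h.sectorPoint hv hv'
  have hy := hp.pos hs
  have h1 := hp.mul_norm_le hs
  have h2 := h.norm_sq v.1 v.2
  rw [h.re_sq_add_im_sq] at h1
  rw [conj_linForm]
  change ‖linForm α β v - _‖ ≤ 1 / 2 * ‖linForm α β v‖
  change ‖linForm α β v‖ ^ 2 = _ at h2
  have h3 : ‖linForm α β v - starRingEnd ℂ (linForm α β v)‖ = 2 * (linForm α β v).im := by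
    rw [Complex.sub_conj, norm_mul, Complex.norm_I, Complex.norm_real, mul_one, Real.norm_eq_abs,
      abs_of_pos (by positivity)]
  have hN := norm_nonneg (linForm α β v)
  rw [h3]
  generalize (linForm α β v).im = y at *
  generalize ‖linForm α β v‖ = N at *
  generalize (cubicHess a b c d v.1 v.2 : ℝ) = H at *
  have hH0 : 0 < H := by
    by_contra hn
    have : H ^ 3 ≤ 0 := Odd.pow_nonpos (by decide) (by linarith)
    nlinarith [pow_pos hs 2]
  have h4 : (4 * y) ^ 2 ≤ N ^ 2 := by
    rw [h2]
    have e1 : (y * H) ^ 2 ≤ (3 / 4 * s) ^ 2 := by gcongr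
    have e2 : (4 * y) ^ 2 * H ^ 2 ≤ H * H ^ 2 := by nlinarith
    exact le_of_mul_le_mul_right e2 (by positivity)
  have := abs_le_of_sq_le_sq' h4 hN |>.2
  linarith

end Resolvent

/-- Every integral point lies in one of three rotated sectors. -/
theorem exists_inSector (α β : ℂ) :
    ∃ ω : Fin 3 → ℂ, (∀ i, ω i ^ 3 = 1) ∧ ∀ v, ∃ i, InSector (ω i * α) (ω i * β) v := by
  have h3 : (√3 : ℝ) ^ 2 = 3 := Real.sq_sqrt (by norm_num)
  have hcube : ∀ x y : ℝ, (⟨x, y⟩ : ℂ) ^ 3 = ⟨x ^ 3 - 3 * x * y ^ 2, 3 * x ^ 2 * y - y ^ 3⟩ := by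
    intro x y
    apply Complex.ext <;> simp [pow_succ] <;> ring
  have hω : (⟨-1 / 2, √3 / 2⟩ : ℂ) ^ 3 = 1 ∧ (⟨-1 / 2, -√3 / 2⟩ : ℂ) ^ 3 = 1 := by
    rw [hcube, hcube]
    refine ⟨Complex.ext ?_ ?_, Complex.ext ?_ ?_⟩
    · simp only [Complex.one_re]; linear_combination 3 / 8 * h3
    · simp only [Complex.one_im]; linear_combination -(√3 / 8) * h3
    · simp only [Complex.one_re]; linear_combination 3 / 8 * h3
    · simp only [Complex.one_im]; linear_combination (√3 / 8) * h3
  refine ⟨![1, ⟨-1 / 2, √3 / 2⟩, ⟨-1 / 2, -√3 / 2⟩], fun i => ?_, fun v => ?_⟩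
  · fin_cases i
    · simp
    · exact hω.1
    · exact hω.2
  · by_contra hn
    push Not at hn
    have h0 := hn 0
    have h1 := hn 1
    have h2 := hn 2
    simp only [InSector, linForm_smul] at h0 h1 h2
    generalize linForm α β v = z at *
    obtain ⟨x, y⟩ := z
    simp at h0 h1 h2
    have e1 : 0 < x ^ 2 - √3 * x * y := by nlinarith
    have e2 : 0 < x ^ 2 + √3 * x * y := by nlinarith
    have e3 : (x ^ 2 - √3 * x * y) * (x ^ 2 + √3 * x * y) = x ^ 2 * (x ^ 2 - 3 * y ^ 2) := by
      linear_combination -(x ^ 2 * y ^ 2) * h3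
    have e4 := mul_pos e1 e2
    rw [e3] at e4
    nlinarith [sq_nonneg x]

namespace Resolvent

variable {a b c d : ℤ} {s : ℝ} {α β : ℂ}

theorem sq_eq (h : Resolvent a b c d (Complex.I * s) α β (starRingEnd ℂ α) (starRingEnd ℂ β)) :
    s ^ 2 = 3 * cubicDisc a b c d := by
  have h1 := h.sq_delta
  rw [mul_pow, Complex.I_sq] at h1
  have h2 : (s : ℂ) ^ 2 = 3 * cubicDisc a b c d := by linear_combination -h1
  exact_mod_cast h2

theorem norm_linForm_sq
    (h : Resolvent a b c d (Complex.I * s) α β (starRingEnd ℂ α) (starRingEnd ℂ β))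
    (v : ℤ × ℤ) : ‖linForm α β v‖ ^ 2 = cubicHess a b c d v.1 v.2 := h.norm_sq v.1 v.2

/-- Adjacent solutions in one sector, for forms of moderate discriminant. -/
theorem hess_ge_of_adjacent
    (h : Resolvent a b c d (Complex.I * s) α β (starRingEnd ℂ α) (starRingEnd ℂ β)) (hs : 0 < s)
    (hD : 82 ≤ cubicDisc a b c d) (hD' : cubicDisc a b c d ≤ 3333)
    (hiso : ¬ CubicIsotropic a b c d) {v w : ℤ × ℤ}
    (hv : v ∈ thueSolutions a b c d) (hw : w ∈ thueSolutions a b c d)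
    (hn : s / 2 ≤ cubicHess a b c d v.1 v.2)
    (hle : cubicHess a b c d v.1 v.2 ≤ cubicHess a b c d w.1 w.2)
    (hp : SectorPair s (linForm α β v).re (linForm α β v).im (linForm α β w).re
      (linForm α β w).im 1) (hdet : (v.1 * w.2 - w.1 * v.2) ^ 2 = 1) :
    225 * cubicDisc a b c d ^ 2 ≤ cubicHess a b c d w.1 w.2 ^ 3 ∧
      3205 ^ 2 * cubicDisc a b c d ^ 12 ≤ cubicHess a b c d w.1 w.2 ^ 15 := by
  have hs2 := h.sq_eq
  have eD := cubicDisc_comp a b c d v.1 w.1 v.2 w.2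
  have eH := cubicHess_comp a b c d v.1 w.1 v.2 w.2 1 0
  have eK := cubicHess_comp a b c d v.1 w.1 v.2 w.2 0 1
  have e6 : (v.1 * w.2 - w.1 * v.2) ^ 6 = 1 := by
    rw [show (v.1 * w.2 - w.1 * v.2) ^ 6 = ((v.1 * w.2 - w.1 * v.2) ^ 2) ^ 3 by ring, hdet, one_pow]
  have hiso' := fun hi => hiso (CubicIsotropic.of_comp hdet hi)
  have hv1 : cubicEval a b c d v.1 v.2 = 1 := hv
  have hw1 : cubicEval a b c d w.1 w.2 = 1 := hw
  rw [hv1, hw1] at eD eH eK hiso'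
  rw [hdet] at eH eK
  rw [e6, one_mul] at eD
  generalize cubicSnd a b c d v.1 w.1 v.2 w.2 = b' at *
  generalize cubicTrd a b c d v.1 w.1 v.2 w.2 = c' at *
  have eH' : cubicHess a b c d v.1 v.2 = b' ^ 2 - 3 * c' := by
    simp only [mul_one, mul_zero, add_zero, one_mul] at eH
    rw [← eH]; simp only [cubicHess]; ring
  have eK' : cubicHess a b c d w.1 w.2 = c' ^ 2 - 3 * b' := by
    simp only [mul_one, mul_zero, zero_add, one_mul] at eK
    rw [← eK]; simp only [cubicHess]; ring
  have hpk := h.re_sq_add_im_sq w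
  have hm : (b' * c' - 9) ^ 2 = 4 * cubicHess a b c d v.1 v.2 * cubicHess a b c d w.1 w.2 -
      3 * cubicDisc a b c d := by
    rw [eH', eK', ← eD]; simp only [cubicDisc]; ring
  have hmr : (((b' * c' - 9) ^ 2 : ℤ) : ℝ) = 4 * cubicHess a b c d v.1 v.2 *
      cubicHess a b c d w.1 w.2 - 3 * cubicDisc a b c d := by exact_mod_cast hm
  generalize cubicHess a b c d v.1 v.2 = H at *
  generalize cubicHess a b c d w.1 w.2 = K at *
  generalize cubicDisc a b c d = D at *
  refine size_of_adjacent eD.symm eH' eK' rfl hD hD' ?_ ?_ ?_ hle ?_ ?_ ?_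
  · rintro rfl
    exact hiso' ⟨1, -1, by simp, by simp only [cubicEval]; ring⟩
  · intro hbc
    exact hiso' ⟨1, 1, by simp, by simp only [cubicEval]; linarith⟩
  · have : (0 : ℝ) ≤ H := by linarith
    exact_mod_cast this
  · have : (3 * D : ℝ) ≤ 4 * H ^ 2 := by nlinarith
    exact_mod_cast this
  · intro h169
    have hr : (169 : ℝ) ≤ D := by exact_mod_cast h169
    have hs1 : 22.5 ≤ s := by nlinarith
    have := hp.norm_ge_of_sq_ge (r := 0.84) (t := 2.9) (q := 0.194) (by norm_num) hs
      (by linarith) (by norm_num) (by norm_num) (by linarith)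
    rw [hpk] at this
    have : (2 * D : ℝ) ≤ ((b' * c' - 9) ^ 2 : ℤ) := by rw [hmr]; nlinarith
    exact_mod_cast this
  · intro h257
    have hr : (257 : ℝ) ≤ D := by exact_mod_cast h257
    have hs1 : 27.76 ≤ s := by nlinarith
    have := hp.norm_ge_of_sq_ge (r := 1.25) (t := 3.22) (q := 0.175) (by norm_num) hs
      (by linarith) (by norm_num) (by norm_num) (by linarith)
    rw [hpk] at this
    have : (9 * D : ℝ) ≤ 2 * ((b' * c' - 9) ^ 2 : ℤ) := by rw [hmr]; nlinarith
    exact_mod_cast this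

theorem size_of_second
    (h : Resolvent a b c d (Complex.I * s) α β (starRingEnd ℂ α) (starRingEnd ℂ β)) (hs : 0 < s)
    (hD : 82 ≤ cubicDisc a b c d) (hiso : ¬ CubicIsotropic a b c d) {v w : ℤ × ℤ} (hvw : v ≠ w)
    (hv : v ∈ thueSolutions a b c d) (hv' : InSector α β v)
    (hw : w ∈ thueSolutions a b c d) (hw' : InSector α β w)
    (hn : s / 2 ≤ cubicHess a b c d v.1 v.2)
    (hle : cubicHess a b c d v.1 v.2 ≤ cubicHess a b c d w.1 w.2) :
    15 * (cubicDisc a b c d : ℝ) ≤ ‖linForm α β w‖ ^ 3 ∧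
      3205 * (cubicDisc a b c d : ℝ) ^ 6 ≤ (‖linForm α β w‖ ^ 3) ^ 5 := by
  have hs2 := h.sq_eq
  have hDr : (82 : ℝ) ≤ cubicDisc a b c d := by exact_mod_cast hD
  have hs1 : 15.684 ≤ s := by nlinarith
  have hk0 : v.1 * w.2 - v.2 * w.1 ≠ 0 := by
    intro h0
    obtain ⟨h1, h2⟩ := eq_of_det_eq_zero hv hw h0
    exact hvw (Prod.ext h1 h2)
  have fin : 5 * s ^ 2 ≤ |(linForm α β w).re| ^ 3 ∧
      4.397 * s ^ 12 ≤ (|(linForm α β w).re| ^ 3) ^ 5 →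
      15 * (cubicDisc a b c d : ℝ) ≤ ‖linForm α β w‖ ^ 3 ∧
      3205 * (cubicDisc a b c d : ℝ) ^ 6 ≤ (‖linForm α β w‖ ^ 3) ^ 5 := by
    rintro ⟨h1, h2⟩
    have h3 : |(linForm α β w).re| ^ 3 ≤ ‖linForm α β w‖ ^ 3 := by
      gcongr; exact Complex.abs_re_le_norm _
    have h4 : (|(linForm α β w).re| ^ 3) ^ 5 ≤ (‖linForm α β w‖ ^ 3) ^ 5 := by gcongr
    refine ⟨by linarith, le_trans ?_ h4⟩
    refine le_trans ?_ h2
    rw [show s ^ 12 = (s ^ 2) ^ 6 by ring, hs2, mul_pow]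
    have : 0 ≤ (cubicDisc a b c d : ℝ) ^ 6 := by positivity
    linarith
  by_cases hk : (v.1 * w.2 - v.2 * w.1) ^ 2 = 1
  · have habs : (1 : ℝ) ≤ |((v.1 * w.2 - v.2 * w.1 : ℤ) : ℝ)| := by
      exact_mod_cast Int.one_le_abs hk0
    have hp := h.sectorPair hs hv hv' hw hw' hn hle habs
    by_cases hsl : 100 ≤ s
    · exact fin (hp.size_of_large hsl)
    · have hD' : cubicDisc a b c d ≤ 3333 := by
        have : (cubicDisc a b c d : ℝ) < 3334 := by nlinarith
        have : cubicDisc a b c d < 3334 := by exact_mod_cast this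
        omega
      obtain ⟨h1, h2⟩ := h.hess_ge_of_adjacent hs hD hD' hiso hv hw hn hle hp
        (by rw [← hk]; ring)
      have e1 : 225 * (cubicDisc a b c d : ℝ) ^ 2 ≤ (cubicHess a b c d w.1 w.2 : ℝ) ^ 3 := by
        exact_mod_cast h1
      have e2 : 3205 ^ 2 * (cubicDisc a b c d : ℝ) ^ 12 ≤ (cubicHess a b c d w.1 w.2 : ℝ) ^ 15 := by
        exact_mod_cast h2
      rw [← h.norm_linForm_sq w] at e1 e2
      constructor
      · refine abs_le_of_sq_le_sq' (le_trans (le_of_eq ?_) (e1.trans (le_of_eq ?_)))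
          (by positivity) |>.2 <;> ring
      · refine abs_le_of_sq_le_sq' (le_trans (le_of_eq ?_) (e2.trans (le_of_eq ?_)))
          (by positivity) |>.2 <;> ring
  · have habs : (2 : ℝ) ≤ |((v.1 * w.2 - v.2 * w.1 : ℤ) : ℝ)| := by
      have h1 := Int.one_le_abs hk0
      have h2 : |v.1 * w.2 - v.2 * w.1| ≠ 1 := fun h1 => hk (by rw [← sq_abs, h1, one_pow])
      have : 2 ≤ |v.1 * w.2 - v.2 * w.1| := by omega
      exact_mod_cast this
    exact fin ((h.sectorPair hs hv hv' hw hw' hn hle habs).size_of_two_le hs1)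

theorem diagPair_of_inSector
    (h : Resolvent a b c d (Complex.I * s) α β (starRingEnd ℂ α) (starRingEnd ℂ β)) (hs : 0 < s)
    {γ D : ℤ} (hγ : 0 < γ) (hodd : Odd γ) (hD : cubicDisc a b c d = γ ^ 2 * D) (hD0 : D ≠ 0)
    (hmod : 4 ∣ D * (D + 3)) {v w : ℤ × ℤ} (hG : γ ∣ cubicCov a b c d v.1 v.2)
    (hB : γ ∣ cubicPolar a b c d v.1 v.2 w.1 w.2)
    (hv : v ∈ thueSolutions a b c d) (hv' : InSector α β v)
    (hw : w ∈ thueSolutions a b c d) (hw' : InSector α β w)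
    (hn : 9 * s ^ 2 ≤ (cubicHess a b c d v.1 v.2 : ℝ) ^ 3)
    (hle : cubicHess a b c d v.1 v.2 ≤ cubicHess a b c d w.1 w.2) :
    DiagPair D (Complex.I * s / γ) γ (cubicCov a b c d v.1 v.2 / γ) (v.1 * w.2 - v.2 * w.1)
      (cubicPolar a b c d v.1 v.2 w.1 w.2 / γ) (linForm α β v) (starRingEnd ℂ (linForm α β v))
      (linForm α β w) (starRingEnd ℂ (linForm α β w)) := by
  rw [← conj_linForm, ← conj_linForm]
  have hle' : (cubicHess a b c d v.1 v.2 : ℝ) ≤ cubicHess a b c d w.1 w.2 := by exact_mod_cast hle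
  refine h.diagPair hγ hodd hD hD0 hmod hG hB hv hw (h.near hs hv hv' hn) (h.near hs hw hw' ?_) ?_
  · exact hn.trans ((Odd.strictMono_pow (by decide : Odd 3)).monotone hle')
  · refine abs_le_of_sq_le_sq' ?_ (norm_nonneg _) |>.2
    rw [h.norm_sq, h.norm_sq]
    exact hle'

theorem absurd_of_four
    (h : Resolvent a b c d (Complex.I * s) α β (starRingEnd ℂ α) (starRingEnd ℂ β)) (hs : 0 < s)
    (hD : 82 ≤ cubicDisc a b c d) (hiso : ¬ CubicIsotropic a b c d) {g : Fin 4 → ℤ × ℤ}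
    (hg : Function.Injective g) (hsol : ∀ i, g i ∈ thueSolutions a b c d)
    (hsec : ∀ i, InSector α β (g i)) (hn : s / 2 ≤ cubicHess a b c d (g 0).1 (g 0).2)
    (hmono : Monotone fun i => cubicHess a b c d (g i).1 (g i).2) : False := by
  have hDr : (82 : ℝ) ≤ cubicDisc a b c d := by exact_mod_cast hD
  have hs2 := h.sq_eq
  obtain ⟨h15, h5⟩ := h.size_of_second hs hD hiso (hg.ne (by decide : (0 : Fin 4) ≠ 1)) (hsol 0)
    (hsec 0) (hsol 1) (hsec 1) hn (hmono (by decide))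
  have hk : ∀ i j, i ≠ j → (g i).1 * (g j).2 - (g i).2 * (g j).1 ≠ 0 := by
    intro i j hij h0
    obtain ⟨h1, h2⟩ := eq_of_det_eq_zero (hsol i) (hsol j) h0
    exact hg.ne hij (Prod.ext h1 h2)
  have hH : 225 * (cubicDisc a b c d : ℝ) ^ 2 ≤
      (cubicHess a b c d (g 1).1 (g 1).2 : ℝ) ^ 3 := by
    rw [← h.norm_linForm_sq (g 1)]
    calc 225 * (cubicDisc a b c d : ℝ) ^ 2 = (15 * (cubicDisc a b c d : ℝ)) ^ 2 := by ring
      _ ≤ (‖linForm α β (g 1)‖ ^ 3) ^ 2 := by gcongr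
      _ = _ := by ring
  have hnear : ∀ i : Fin 4, 1 ≤ i → 9 * s ^ 2 ≤
      (cubicHess a b c d (g i).1 (g i).2 : ℝ) ^ 3 := by
    intro i hi
    have h1 : (cubicHess a b c d (g 1).1 (g 1).2 : ℝ) ≤ cubicHess a b c d (g i).1 (g i).2 := by
      exact_mod_cast hmono hi
    refine le_trans ?_ ((Odd.strictMono_pow (by decide : Odd 3)).monotone h1)
    refine le_trans ?_ hH
    nlinarith
  have hpair := fun (i j : Fin 4) (hi : 1 ≤ i) (hij : i ≤ j) =>
    h.diagPair_of_inSector hs one_pos odd_one (D := cubicDisc a b c d) (by ring) (by omega)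
      (four_dvd_cubicDisc a b c d) (one_dvd _) (one_dvd _) (hsol i) (hsec i) (hsol j) (hsec j)
      (hnear i hi) (hmono hij)
  have habs : |(cubicDisc a b c d : ℝ)| = cubicDisc a b c d := abs_of_nonneg (by linarith)
  refine DiagPair.absurd_of_three (hpair 1 2 le_rfl (by decide)) (hpair 2 3 (by decide) (by decide))
    (hk 1 2 (by decide)) (hk 2 3 (by decide)) rfl (by rwa [habs]) (by linarith)
    (Or.inr ⟨by rwa [habs], by rw [habs]; linarith⟩)

theorem encard_le_of_large_disc
    (h : Resolvent a b c d (Complex.I * s) α β (starRingEnd ℂ α) (starRingEnd ℂ β)) (hs : 0 < s)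
    (hD : 82 ≤ cubicDisc a b c d) (hiso : ¬ CubicIsotropic a b c d) :
    (thueSolutions a b c d).encard ≤ 10 := by
  refine encard_le_of_forall_card_le (n := 10) fun T hT hcard => ?_
  classical
  let f : ℤ × ℤ → ℝ := fun v => cubicHess a b c d v.1 v.2
  obtain ⟨v₀, hv₀, hmin⟩ := T.exists_min_image f (Finset.card_pos.1 (by omega))
  have hs2 := h.sq_eq
  have hn : ∀ v ∈ T.erase v₀, s / 2 ≤ f v := by
    intro v hv
    obtain ⟨hne, hvT⟩ := Finset.mem_erase.1 hv
    have h1 := cubicPolar_sq a b c d v₀.1 v₀.2 v.1 v.2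
    have h0 : 0 ≤ f v₀ := by
      simp only [f]; rw [← h.norm_linForm_sq]; positivity
    have hk0 : v₀.1 * v.2 - v₀.2 * v.1 ≠ 0 := by
      intro h0
      obtain ⟨h1, h2⟩ := eq_of_det_eq_zero (hT hv₀) (hT hvT) h0
      exact hne (Prod.ext h1.symm h2.symm)
    have hk1 : 1 ≤ (v₀.1 * v.2 - v₀.2 * v.1) ^ 2 := by
      have := Int.one_le_abs hk0
      rw [← sq_abs]; nlinarith
    have h2 : 3 * cubicDisc a b c d ≤
        4 * cubicHess a b c d v₀.1 v₀.2 * cubicHess a b c d v.1 v.2 := by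
      rw [← h1]
      nlinarith [sq_nonneg (cubicPolar a b c d v₀.1 v₀.2 v.1 v.2)]
    have h3 : 3 * (cubicDisc a b c d : ℝ) ≤ 4 * f v₀ * f v := by
      simp only [f]; exact_mod_cast h2
    have h4 := hmin v hvT
    refine abs_le_of_sq_le_sq' ?_ (h0.trans h4) |>.2
    nlinarith
  obtain ⟨ω, hω, hsec⟩ := exists_inSector α β
  choose i hi using hsec
  have hcard' : (T.erase v₀).card = 10 := by rw [Finset.card_erase_of_mem hv₀, hcard]
  obtain ⟨j, -, hj⟩ := Finset.exists_lt_card_fiber_of_mul_lt_card_of_maps_to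
    (s := T.erase v₀) (t := (Finset.univ : Finset (Fin 3))) (f := i) (n := 3)
    (fun _ _ => Finset.mem_univ _) (by rw [hcard']; decide)
  obtain ⟨g, hg, hgT, hmono⟩ := exists_sorted _ f (n := 4) hj
  have hgT' : ∀ k, g k ∈ T.erase v₀ ∧ i (g k) = j := fun k => Finset.mem_filter.1 (hgT k)
  refine (h.rotate (hω j)).absurd_of_four hs hD hiso hg
    (fun k => hT (Finset.mem_of_mem_erase (hgT' k).1)) (fun k => ?_) (hn _ (hgT' 0).1)
    (fun k l hkl => ?_)
  · have := hi (g k)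
    rwa [(hgT' k).2] at this
  · have := hmono hkl
    simp only [Function.comp, f] at this
    exact_mod_cast this

end Resolvent

theorem encard_thueSolutions_le_of_disc_ge {a b c d : ℤ} (hD : 82 ≤ cubicDisc a b c d)
    (hiso : ¬ CubicIsotropic a b c d) : (thueSolutions a b c d).encard ≤ 10 := by
  rcases (thueSolutions a b c d).eq_empty_or_nonempty with h0 | ⟨v, hv⟩
  · simp [h0]
  · refine encard_le_of_monic hv fun b' c' d' hdisc _ hiso' => ?_
    rw [← hdisc] at hD
    obtain ⟨α, β, h⟩ := exists_resolvent_of_disc_pos (b := b') (c := c') (d := d') (by omega)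
    refine h.encard_le_of_large_disc (Real.sqrt_pos.2 ?_) hD fun hi => hiso (hiso' hi)
    have : (82 : ℝ) ≤ cubicDisc 1 b' c' d' := by exact_mod_cast hD
    linarith

/-- Forms whose Hessian is a multiple of `x² ± xy + y²`: two large solutions never share a
sector. -/
theorem Resolvent.absurd_of_two {b c d γ h₀ : ℤ} {s : ℝ} {α β : ℂ}
    (h : Resolvent 1 b c d (Complex.I * s) α β (starRingEnd ℂ α) (starRingEnd ℂ β)) (hs : 0 < s)
    (hγ : γ = 7 ∨ γ = 9) (hA : b ^ 2 - 3 * c = γ) (hB : (b * c - 9 * d) ^ 2 = γ ^ 2)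
    (hC : c ^ 2 - 3 * b * d = γ) (hh : 1500000 * γ ^ 2 ≤ h₀ ^ 3) {v w : ℤ × ℤ} (hvw : v ≠ w)
    (hv : v ∈ thueSolutions 1 b c d) (hv' : InSector α β v) (hw : w ∈ thueSolutions 1 b c d)
    (hw' : InSector α β w) (hn : h₀ ≤ cubicHess 1 b c d v.1 v.2)
    (hle : cubicHess 1 b c d v.1 v.2 ≤ cubicHess 1 b c d w.1 w.2) : False := by
  have hγ0 : 0 < γ := by omega
  have hD : cubicDisc 1 b c d = γ ^ 2 := by
    have : 3 * cubicDisc 1 b c d = 3 * γ ^ 2 := by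
      simp only [cubicDisc]
      linear_combination 4 * (c ^ 2 - 3 * b * d) * hA + 4 * γ * hC - hB
    linarith
  have hdB : γ ∣ b * c - 9 * d := by
    rw [← Int.pow_dvd_pow_iff (n := 2) (by norm_num), hB]
  have hH : γ ∣ cubicHess 1 b c d v.1 v.2 := by
    obtain ⟨e, he⟩ := hdB
    refine ⟨v.1 ^ 2 + e * v.1 * v.2 + v.2 ^ 2, ?_⟩
    simp only [cubicHess]
    linear_combination v.1 ^ 2 * hA + v.1 * v.2 * he + v.2 ^ 2 * hC
  have hpol : γ ∣ cubicPolar 1 b c d v.1 v.2 w.1 w.2 := by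
    obtain ⟨e, he⟩ := hdB
    refine ⟨2 * v.1 * w.1 + e * (v.1 * w.2 + v.2 * w.1) + 2 * v.2 * w.2, ?_⟩
    simp only [cubicPolar]
    linear_combination 2 * v.1 * w.1 * hA + (v.1 * w.2 + v.2 * w.1) * he + 2 * v.2 * w.2 * hC
  have hcov : γ ∣ cubicCov 1 b c d v.1 v.2 := by
    rw [← Int.pow_dvd_pow_iff (n := 2) (by norm_num)]
    obtain ⟨e, he⟩ := hH
    have h1 := cubicCov_sq 1 b c d v.1 v.2
    rw [hD, he] at h1
    exact ⟨4 * γ * e ^ 3 - 27 * cubicEval 1 b c d v.1 v.2 ^ 2, by linear_combination h1⟩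
  have hcube : 1500000 * γ ^ 2 ≤ cubicHess 1 b c d v.1 v.2 ^ 3 :=
    hh.trans ((Odd.strictMono_pow (by decide : Odd 3)).monotone hn)
  have hcubeR : 1500000 * (γ : ℝ) ^ 2 ≤ (cubicHess 1 b c d v.1 v.2 : ℝ) ^ 3 := by
    exact_mod_cast hcube
  have hγR : (0 : ℝ) < γ := by exact_mod_cast hγ0
  have hs2 := h.sq_eq
  rw [hD] at hs2
  push_cast at hs2
  have hpair := h.diagPair_of_inSector hs hγ0
    (by rcases hγ with rfl | rfl <;> decide) (D := 1) (by rw [hD]; ring) one_ne_zero (by norm_num)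
    hcov hpol hv hv' hw hw' (by nlinarith [sq_nonneg (γ : ℝ)]) hle
  have hk : v.1 * w.2 - v.2 * w.1 ≠ 0 := by
    intro h0
    obtain ⟨h1, h2⟩ := eq_of_det_eq_zero hv hw h0
    exact hvw (Prod.ext h1 h2)
  have hp2 : 1500000 ≤ (‖linForm α β v‖ ^ 3 / γ) ^ 2 := by
    rw [div_pow, le_div_iff₀ (by positivity)]
    refine hcubeR.trans (le_of_eq ?_)
    rw [← h.norm_linForm_sq v]; ring
  have hp1 : 1200 ≤ ‖linForm α β v‖ ^ 3 / γ :=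
    abs_le_of_sq_le_sq' (by linarith) (by positivity) |>.2
  refine hpair.absurd_of_large (γ := γ) rfl (Or.inr (by omega)) hk
    (p := ‖linForm α β v‖ ^ 3 / γ) (by field_simp) ?_ ?_ ?_ <;> simp <;> linarith

theorem encard_thueSolutions_le_of_hess {b c d γ h₀ : ℤ} (hγ : γ = 7 ∨ γ = 9)
    (hA : b ^ 2 - 3 * c = γ) (hB : (b * c - 9 * d) ^ 2 = γ ^ 2) (hC : c ^ 2 - 3 * b * d = γ)
    (hh : 1500000 * γ ^ 2 ≤ h₀ ^ 3) (hh' : 4 * h₀ ≤ 243 * γ)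
    (hsmall : ((Finset.Icc (-8 : ℤ) 8 ×ˢ Finset.Icc (-8 : ℤ) 8).filter fun v =>
      cubicEval 1 b c d v.1 v.2 = 1 ∧ cubicHess 1 b c d v.1 v.2 < h₀).card ≤ 6) :
    (thueSolutions 1 b c d).encard ≤ 10 := by
  have hD : 3 * cubicDisc 1 b c d = 3 * γ ^ 2 := by
    simp only [cubicDisc]
    linear_combination 4 * (c ^ 2 - 3 * b * d) * hA + 4 * γ * hC - hB
  have hDpos : 0 < cubicDisc 1 b c d := by
    rcases hγ with rfl | rfl <;> omega
  obtain ⟨α, β, h⟩ := exists_resolvent_of_disc_pos hDpos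
  refine encard_le_of_forall_card_le (n := 10) fun T hT hcard => ?_
  classical
  let p : ℤ × ℤ → Prop := fun v => cubicHess 1 b c d v.1 v.2 < h₀
  have hlt : (T.filter p).card ≤ 6 := by
    refine (Finset.card_le_card fun v hv => ?_).trans hsmall
    obtain ⟨hvT, hvp⟩ := Finset.mem_filter.1 hv
    have e : 4 * cubicHess 1 b c d v.1 v.2 = 3 * γ * v.1 ^ 2 +
        (4 * γ * (v.1 ^ 2 + v.2 ^ 2) - 3 * γ * v.1 ^ 2 +
          4 * (b * c - 9 * d) * v.1 * v.2) := by
      simp only [cubicHess]; linear_combination 4 * v.1 ^ 2 * hA + 4 * v.2 ^ 2 * hC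
    have hbd : v.1 ^ 2 < 81 ∧ v.2 ^ 2 < 81 := by
      simp only [p] at hvp
      rcases sq_eq_sq_iff_eq_or_eq_neg.1 hB with h1 | h1 <;> rw [h1] at e <;>
        rcases hγ with rfl | rfl <;> constructor <;>
        nlinarith [sq_nonneg (v.1 + 2 * v.2), sq_nonneg (v.1 - 2 * v.2),
          sq_nonneg (2 * v.1 + v.2), sq_nonneg (2 * v.1 - v.2)]
    have hx := abs_lt.1 (abs_lt_of_sq_lt_sq (a := v.1) (b := 9) (by linarith [hbd.1]) (by norm_num))
    have hy := abs_lt.1 (abs_lt_of_sq_lt_sq (a := v.2) (b := 9) (by linarith [hbd.2]) (by norm_num))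
    simp only [Finset.mem_filter, Finset.mem_product, Finset.mem_Icc]
    exact ⟨by omega, hT hvT, hvp⟩
  have hge : 5 ≤ (T.filter fun v => ¬ p v).card := by
    have := Finset.card_filter_add_card_filter_not (s := T) p
    omega
  obtain ⟨ω, hω, hsec⟩ := exists_inSector α β
  choose i hi using hsec
  obtain ⟨v, hv, w, hw, hvw, hij⟩ := Finset.exists_ne_map_eq_of_card_lt_of_maps_to
    (s := T.filter fun v => ¬ p v) (t := (Finset.univ : Finset (Fin 3))) (f := i)
    (by rw [Finset.card_univ, Fintype.card_fin]; omega) (fun _ _ => Finset.mem_univ _)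
  have hs : (0 : ℝ) < √(3 * cubicDisc 1 b c d) := Real.sqrt_pos.2 (by
    have : (0 : ℝ) < cubicDisc 1 b c d := by exact_mod_cast hDpos
    linarith)
  obtain ⟨hvT, hvp⟩ := Finset.mem_filter.1 hv
  obtain ⟨hwT, hwp⟩ := Finset.mem_filter.1 hw
  simp only [p, not_lt] at hvp hwp
  have hiw := hi w
  rw [← hij] at hiw
  rcases le_total (cubicHess 1 b c d v.1 v.2) (cubicHess 1 b c d w.1 w.2) with hle | hle
  · exact (h.rotate (hω (i v))).absurd_of_two hs hγ hA hB hC hh hvw (hT hvT) (hi v) (hT hwT)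
      hiw hvp hle
  · exact (h.rotate (hω (i v))).absurd_of_two hs hγ hA hB hC hh hvw.symm (hT hwT) hiw (hT hvT)
      (hi v) hwp hle

theorem encard_thueSolutions_le_of_hess_eq {b c d γ : ℤ} (hγ : γ = 7 ∨ γ = 9)
    (hA : b ^ 2 - 3 * c = γ) (hB : (b * c - 9 * d) ^ 2 = γ ^ 2) (hC : c ^ 2 - 3 * b * d = γ) :
    (thueSolutions 1 b c d).encard ≤ 10 := by
  have hsq : (3 * (b * c - 9 * d) - 2 * (b ^ 2 - 3 * c) * b) ^ 2 +
      9 * (4 * (b ^ 2 - 3 * c) * (c ^ 2 - 3 * b * d) - (b * c - 9 * d) ^ 2) =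
      4 * (b ^ 2 - 3 * c) ^ 3 := by ring
  rw [hA, hB, hC] at hsq
  rcases hγ with rfl | rfl
  · rcases sq_eq_sq_iff_eq_or_eq_neg.1 hB with h | h <;> rw [h] at hsq
    · have : (b - 1) * (b - 2) = 0 := by linarith
      rcases mul_eq_zero.1 this with hb | hb
      · obtain ⟨rfl, rfl, rfl⟩ : b = 1 ∧ c = -2 ∧ d = -1 := by
          obtain rfl : b = 1 := by linarith
          omega
        exact encard_thueSolutions_le_of_hess (h₀ := 420) (Or.inl rfl) hA hB hC (by norm_num)
          (by norm_num) (by decide +kernel)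
      · obtain ⟨rfl, rfl, rfl⟩ : b = 2 ∧ c = -1 ∧ d = -1 := by
          obtain rfl : b = 2 := by linarith
          omega
        exact encard_thueSolutions_le_of_hess (h₀ := 420) (Or.inl rfl) hA hB hC (by norm_num)
          (by norm_num) (by decide +kernel)
    · have : (b + 1) * (b + 2) = 0 := by linarith
      rcases mul_eq_zero.1 this with hb | hb
      · obtain ⟨rfl, rfl, rfl⟩ : b = -1 ∧ c = -2 ∧ d = 1 := by
          obtain rfl : b = -1 := by linarith
          omega
        exact encard_thueSolutions_le_of_hess (h₀ := 420) (Or.inl rfl) hA hB hC (by norm_num)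
          (by norm_num) (by decide +kernel)
      · obtain ⟨rfl, rfl, rfl⟩ : b = -2 ∧ c = -1 ∧ d = 1 := by
          obtain rfl : b = -2 := by linarith
          omega
        exact encard_thueSolutions_le_of_hess (h₀ := 420) (Or.inl rfl) hA hB hC (by norm_num)
          (by norm_num) (by decide +kernel)
  · rcases sq_eq_sq_iff_eq_or_eq_neg.1 hB with h | h <;> rw [h] at hsq
    · have : b * (b - 3) = 0 := by linarith
      rcases mul_eq_zero.1 this with hb | hb
      · obtain ⟨rfl, rfl, rfl⟩ : b = 0 ∧ c = -3 ∧ d = -1 := by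
          subst hb
          omega
        exact encard_thueSolutions_le_of_hess (h₀ := 496) (Or.inr rfl) hA hB hC (by norm_num)
          (by norm_num) (by decide +kernel)
      · obtain ⟨rfl, rfl, rfl⟩ : b = 3 ∧ c = 0 ∧ d = -1 := by
          obtain rfl : b = 3 := by linarith
          omega
        exact encard_thueSolutions_le_of_hess (h₀ := 496) (Or.inr rfl) hA hB hC (by norm_num)
          (by norm_num) (by decide +kernel)
    · have : b * (b + 3) = 0 := by linarith
      rcases mul_eq_zero.1 this with hb | hb
      · obtain ⟨rfl, rfl, rfl⟩ : b = 0 ∧ c = -3 ∧ d = 1 := by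
          subst hb
          omega
        exact encard_thueSolutions_le_of_hess (h₀ := 496) (Or.inr rfl) hA hB hC (by norm_num)
          (by norm_num) (by decide +kernel)
      · obtain ⟨rfl, rfl, rfl⟩ : b = -3 ∧ c = 0 ∧ d = 1 := by
          obtain rfl : b = -3 := by linarith
          omega
        exact encard_thueSolutions_le_of_hess (h₀ := 496) (Or.inr rfl) hA hB hC (by norm_num)
          (by norm_num) (by decide +kernel)

theorem encard_thueSolutions_le_of_reduced {a b c d : ℤ} (hD : 0 < cubicDisc a b c d)
    (hD' : cubicDisc a b c d ≤ 81) (hiso : ¬ CubicIsotropic a b c d)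
    (hB : (b * c - 9 * a * d) ^ 2 ≤ (b ^ 2 - 3 * a * c) ^ 2) (hA : 0 < b ^ 2 - 3 * a * c)
    (hAC : b ^ 2 - 3 * a * c ≤ c ^ 2 - 3 * b * d) : (thueSolutions a b c d).encard ≤ 10 := by
  have ha : a ≠ 0 := fun ha => hiso ⟨1, 0, by simp, by simp [cubicEval, ha]⟩
  have ha1 : 1 ≤ a ^ 2 := by have := Int.one_le_abs ha; rw [← sq_abs]; nlinarith
  have hcov : 27 * cubicDisc a b c d * a ^ 2 ≤ 4 * (b ^ 2 - 3 * a * c) ^ 3 := by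
    have h1 := cubicCov_sq a b c d 1 0
    have e1 : cubicEval a b c d 1 0 = a := by simp [cubicEval]
    have e2 : cubicHess a b c d 1 0 = b ^ 2 - 3 * a * c := by simp [cubicHess]
    rw [e1, e2] at h1
    linarith [sq_nonneg (cubicCov a b c d 1 0)]
  have hdisc : 4 * (b ^ 2 - 3 * a * c) * (c ^ 2 - 3 * b * d) - (b * c - 9 * a * d) ^ 2 =
      3 * cubicDisc a b c d := by simp only [cubicDisc]; ring
  have hfour := four_dvd_cubicDisc a b c d
  have hmod : b ^ 2 - 3 * a * c ≠ 8 := by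
    intro h8
    have h3 : (b ^ 2 - 3 * a * c) % 3 = 2 := by rw [h8]; rfl
    have : b % 3 = 0 ∨ b % 3 = 1 ∨ b % 3 = 2 := by omega
    rw [show b ^ 2 - 3 * a * c = b ^ 2 + 3 * (-(a * c)) by ring, Int.add_mul_emod_self_left,
      pow_two, Int.mul_emod] at h3
    rcases this with h | h | h <;> rw [h] at h3 <;> norm_num at h3
  have key : ∃ γ : ℤ, (γ = 7 ∨ γ = 9) ∧ a ^ 2 = 1 ∧ b ^ 2 - 3 * a * c = γ ∧
      (b * c - 9 * a * d) ^ 2 = γ ^ 2 ∧ c ^ 2 - 3 * b * d = γ := by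
    generalize cubicDisc a b c d = D at *
    generalize b ^ 2 - 3 * a * c = A at *
    generalize (b * c - 9 * a * d) ^ 2 = B at *
    generalize c ^ 2 - 3 * b * d = C at *
    generalize a ^ 2 = n at *
    have hAD : A ^ 2 ≤ D := by nlinarith
    have hA9 : A ≤ 9 := by nlinarith
    have hA7 : 7 ≤ A := by
      have h1 : 27 * A ^ 2 ≤ 4 * A ^ 3 := by nlinarith
      have h2 : A ^ 2 * (27 - 4 * A) ≤ 0 := by linarith
      by_contra hlt
      nlinarith [sq_pos_of_pos hA]
    obtain rfl | rfl : A = 7 ∨ A = 9 := by omega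
    · have hn : n = 1 := by nlinarith
      subst hn
      have hD49 : D = 49 := by
        have : D = 49 ∨ D = 50 := by omega
        rcases this with h | h
        · exact h
        · rw [h] at hfour; norm_num at hfour
      exact ⟨7, Or.inl rfl, rfl, rfl, by omega, by omega⟩
    · have hn : n = 1 := by nlinarith
      exact ⟨9, Or.inr rfl, hn, rfl, by omega, by omega⟩
  obtain ⟨γ, hγ, hn, hA', hB', hC'⟩ := key
  rcases sq_eq_sq_iff_eq_or_eq_neg.1 (hn.trans (one_pow 2).symm) with rfl | rfl
  · exact encard_thueSolutions_le_of_hess_eq hγ (by linarith) (by linarith) hC'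
  · refine (encard_thueSolutions_le (-1) b c d (p := -1) (q := 0) (r := 0) (t := 1)
      (by norm_num)).trans ?_
    have e1 : cubicEval (-1) b c d (-1) 0 = 1 := by simp [cubicEval]
    have e2 : cubicSnd (-1) b c d (-1) 0 0 1 = b := by simp [cubicSnd]
    have e3 : cubicTrd (-1) b c d (-1) 0 0 1 = -c := by simp [cubicTrd]
    have e4 : cubicEval (-1) b c d 0 1 = d := by simp [cubicEval]
    rw [e1, e2, e3, e4]
    exact encard_thueSolutions_le_of_hess_eq hγ (by linarith) (by linarith) (by linarith)

theorem encard_thueSolutions_le_of_disc_le {a b c d : ℤ} (hD : 0 < cubicDisc a b c d)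
    (hD' : cubicDisc a b c d ≤ 81) (hiso : ¬ CubicIsotropic a b c d) :
    (thueSolutions a b c d).encard ≤ 10 := by
  have hpos : ∀ x y : ℤ, (x ≠ 0 ∨ y ≠ 0) → 0 < cubicHess a b c d x y := by
    intro x y hxy
    have h0 : cubicEval a b c d x y ≠ 0 := fun h0 => hiso ⟨x, y, hxy, h0⟩
    have h1 := cubicCov_sq a b c d x y
    have h2 : 0 < cubicHess a b c d x y ^ 3 := by
      have : 0 < cubicDisc a b c d * cubicEval a b c d x y ^ 2 := by positivity
      nlinarith [sq_nonneg (cubicCov a b c d x y)]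
    exact (Odd.pow_pos_iff (by decide)).1 h2
  let f : ℤ × ℤ → ℕ := fun v => (cubicHess a b c d v.1 v.2).toNat
  have hne : {v : ℤ × ℤ | v.1 ≠ 0 ∨ v.2 ≠ 0}.Nonempty := ⟨(1, 0), by simp⟩
  have hmem := Function.argminOn_mem f _ hne
  have hmin := fun v hv => Function.argminOn_le f {v : ℤ × ℤ | v.1 ≠ 0 ∨ v.2 ≠ 0} (a := v) hv
  obtain ⟨⟨u₁, u₂⟩, hu⟩ : ∃ u, Function.argminOn f _ hne = u := ⟨_, rfl⟩
  rw [hu] at hmem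
  obtain ⟨g, p, r, q, t, hg, hp, hr, hdet⟩ := exists_primitive hmem
  have hpr : p ≠ 0 ∨ r ≠ 0 := by
    by_contra hc
    push Not at hc
    rw [hc.1, hc.2] at hdet
    simp at hdet
  have hA := hpos p r hpr
  have hmin' : ∀ x y : ℤ, (x ≠ 0 ∨ y ≠ 0) → cubicHess a b c d p r ≤ cubicHess a b c d x y := by
    intro x y hxy
    have h1 := hmin (x, y) hxy
    rw [hu] at h1
    have h2 : cubicHess a b c d u₁ u₂ ≤ cubicHess a b c d x y := by
      have := hpos x y hxy
      simp only [f] at h1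
      omega
    refine le_trans ?_ h2
    rw [show u₁ = g * p from hp, show u₂ = g * r from hr,
      show cubicHess a b c d (g * p) (g * r) = g ^ 2 * cubicHess a b c d p r by
        simp only [cubicHess]; ring]
    have : 1 ≤ g ^ 2 := by have := Int.one_le_abs hg; rw [← sq_abs]; nlinarith
    nlinarith
  set A := cubicHess a b c d p r with hAdef
  set n : ℤ := -((cubicPolar a b c d p r q t + A) / (2 * A)) with hn
  have hdet' : p * (t + n * r) - (q + n * p) * r = 1 := by linear_combination hdet
  have hB : cubicPolar a b c d p r (q + n * p) (t + n * r) ^ 2 ≤ A ^ 2 := by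
    have e : cubicPolar a b c d p r (q + n * p) (t + n * r) =
        cubicPolar a b c d p r q t + 2 * n * A := by
      simp only [hAdef, cubicPolar, cubicHess]; ring
    have h1 := Int.emod_nonneg (cubicPolar a b c d p r q t + A) (by omega : 2 * A ≠ 0)
    have h2 := Int.emod_lt_of_pos (cubicPolar a b c d p r q t + A) (by omega : 0 < 2 * A)
    have h3 := Int.emod_add_mul_ediv (cubicPolar a b c d p r q t + A) (2 * A)
    have h4 : cubicPolar a b c d p r q t + 2 * n * A =
        (cubicPolar a b c d p r q t + A) % (2 * A) - A := by
      rw [hn]; linear_combination -h3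
    rw [e, h4]
    refine sq_le_sq' ?_ ?_ <;> linarith
  have hqt : q + n * p ≠ 0 ∨ t + n * r ≠ 0 := by
    by_contra hc
    push Not at hc
    rw [hc.1, hc.2] at hdet'
    simp at hdet'
  have hC := hmin' _ _ hqt
  generalize q + n * p = q' at *
  generalize t + n * r = t' at *
  have hdet2 : (p * t' - q' * r) ^ 2 = 1 := by rw [hdet', one_pow]
  have eD := cubicDisc_comp a b c d p q' r t'
  have eA := cubicHess_comp a b c d p q' r t' 1 0
  have eC := cubicHess_comp a b c d p q' r t' 0 1
  have eB : cubicPolar (cubicEval a b c d p r) (cubicSnd a b c d p q' r t')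
      (cubicTrd a b c d p q' r t') (cubicEval a b c d q' t') 1 0 0 1 =
      (p * t' - q' * r) ^ 2 * cubicPolar a b c d p r q' t' := by
    simp only [cubicPolar, cubicEval, cubicSnd, cubicTrd]; ring
  have hiso' := fun hi => hiso (CubicIsotropic.of_comp hdet2 hi)
  rw [hdet'] at eD eA eB eC
  simp only [one_pow, one_mul, mul_one, mul_zero, add_zero, zero_add] at eD eA eB eC
  refine (encard_thueSolutions_le a b c d hdet2).trans ?_
  generalize cubicEval a b c d p r = a' at *
  generalize cubicSnd a b c d p q' r t' = b' at *
  generalize cubicTrd a b c d p q' r t' = c' at *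
  generalize cubicEval a b c d q' t' = d' at *
  rw [← eB] at hB
  rw [← eC, hAdef, ← eA] at hC
  rw [hAdef, ← eA] at hA hB
  rw [← eD] at hD hD'
  simp only [cubicHess, cubicPolar, mul_one, mul_zero, add_zero, zero_add, one_pow,
    ne_eq, OfNat.ofNat_ne_zero, not_false_eq_true, zero_pow] at hA hB hC
  exact encard_thueSolutions_le_of_reduced hD hD' hiso' hB hA hC

theorem encard_thueSolutions_le_ten {a b c d : ℤ} (hD : cubicDisc a b c d ≠ 0) :
    (thueSolutions a b c d).encard ≤ 10 := by
  by_cases hiso : CubicIsotropic a b c d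
  · exact (encard_thueSolutions_le_of_isotropic hD hiso).trans (by norm_num)
  rcases hD.lt_or_gt with hneg | hpos
  · exact encard_thueSolutions_le_of_disc_neg hneg hiso
  rcases le_or_gt (cubicDisc a b c d) 81 with h | h
  · exact encard_thueSolutions_le_of_disc_le hpos h hiso
  · exact encard_thueSolutions_le_of_disc_ge h hiso

/-- A cubic Thue equation `f(x,y) = 1` with `Disc(f) ≠ 0` has at most 10 integer solutions. -/
theorem cubic_thue_at_most_10_solutions (a b c d : ℤ) (h : cubicDisc a b c d ≠ 0) :
    ∃ S : Finset (ℤ × ℤ), S.card ≤ 10 ∧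
      ∀ x y : ℤ, a * x ^ 3 + b * x ^ 2 * y + c * x * y ^ 2 + d * y ^ 3 = 1 → (x, y) ∈ S := by
  have h10 := encard_thueSolutions_le_ten h
  have hfin : (thueSolutions a b c d).Finite := Set.finite_of_encard_le_coe (k := 10) h10
  refine ⟨hfin.toFinset, ?_, fun x y hxy => hfin.mem_toFinset.2 hxy⟩
  rw [hfin.encard_eq_coe_toFinset_card] at h10
  exact_mod_cast h10
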